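/- Let n ≥ 1 and 1 ≤ m ≤ n. Let U be a connected open neighborhood of 0 in ℂⁿ. Let X₁, …, X_m : U → ℂⁿ be analytic vector fields with X_i(0) = 0 for all i, which commute pairwise, i.e. [X_i, X_j](x) = 0 for all x ∈ U and all i, j, and let f₁, …, f_{n−m} : U → ℂ be analytic functions which are common first integrals, i.e. Df_j(x)(X_i(x)) = 0 for all x ∈ U and all i, j. Assume there exists a point x ∈ U at which the vectors X₁(x), …, X_m(x) are linearly independent over ℂ, and there exists a point x ∈ U at which the continuous linear functionals Df₁(x), …, Df_{n−m}(x) are linearly independent over ℂ. Then X₁, …, X_m admit a simultaneous convergent Poincaré–Dulac normalization: there exist an analytic map φ defined near 0 with φ(0) = 0 and Dφ(0) invertible, and analytic vector fields Y₁, …, Y_m defined near 0, each in Poincaré–Dulac normal form, such that Dφ(x)(Y_i(x)) = X_i(φ(x)) for all x near 0 and all i. -/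

import Mathlib

/-- `Y` is in Poincaré–Dulac normal form on the neighborhood `U` of `0`:
writing the Jordan–Chevalley decomposition `DY(0) = S + N` with `S` semisimple,
`N` nilpotent and `S ∘ N = N ∘ S`, the Lie bracket `[Y, Yˢ]` (where `Yˢ x = S x`)
vanishes on `U`. -/
def InPDNormalForm (𝕂 : Type*) [NontriviallyNormedField 𝕂] {n : ℕ}
    (Y : (Fin n → 𝕂) → (Fin n → 𝕂)) (U : Set (Fin n → 𝕂)) : Prop :=
  ∃ S N : (Fin n → 𝕂) →L[𝕂] (Fin n → 𝕂),
    fderiv 𝕂 Y 0 = S + N ∧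
    Module.End.IsSemisimple (S : Module.End 𝕂 (Fin n → 𝕂)) ∧
    IsNilpotent (N : Module.End 𝕂 (Fin n → 𝕂)) ∧
    S ∘L N = N ∘L S ∧
    ∀ x ∈ U, VectorField.lieBracket 𝕂 Y (fun y => S y) x = 0

/-- `X` admits a convergent Poincaré–Dulac normalization: there are an analytic
vector field `Y` near `0`, in Poincaré–Dulac normal form with `Y 0 = 0`, and an
analytic map `φ` near `0` with `φ 0 = 0` and `Dφ(0)` invertible, such that
`Dφ(x) (Y x) = X (φ x)` for all `x` near `0`. -/
def AdmitsPDNormalization (𝕂 : Type*) [NontriviallyNormedField 𝕂] {n : ℕ}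
    (X : (Fin n → 𝕂) → (Fin n → 𝕂)) : Prop :=
  ∃ (V : Set (Fin n → 𝕂)) (Y φ : (Fin n → 𝕂) → (Fin n → 𝕂)),
    IsOpen V ∧ (0 : Fin n → 𝕂) ∈ V ∧
    AnalyticOnNhd 𝕂 Y V ∧ AnalyticOnNhd 𝕂 φ V ∧
    Y 0 = 0 ∧ φ 0 = 0 ∧ Function.Bijective (fderiv 𝕂 φ 0) ∧
    InPDNormalForm 𝕂 Y V ∧
    ∀ x ∈ V, fderiv 𝕂 φ x (Y x) = X (φ x)

open Filter Topology Asymptotics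

namespace ZungPD

section Orders

variable {E F : Type*} [NormedAddCommGroup E] [NormedSpace ℂ E]
  [NormedAddCommGroup F] [NormedSpace ℂ F]

/-- If an analytic function vanishes to order `N + 1` at `0`, its derivative vanishes to
order `N`. -/
theorem fderiv_isBigO_pow [CompleteSpace F] {f : E → F} (hf : AnalyticAt ℂ f 0) {N : ℕ}
    (h : f =O[𝓝 0] fun x => ‖x‖ ^ (N + 1)) :
    (fun x => fderiv ℂ f x) =O[𝓝 0] fun x => ‖x‖ ^ N := by
  rcases Nat.eq_zero_or_pos N with rfl | hN
  · simp only [pow_zero]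
    exact (hf.fderiv.continuousAt.norm.isBoundedUnder_le).isBigO_one ℝ
  have h0 : fderiv ℂ f 0 = 0 := by
    have : HasFDerivAt f (0 : E →L[ℂ] F) 0 := by
      apply IsBigO.hasFDerivAt (n := N + 1) (by simpa using h) (by omega)
    exact this.fderiv
  obtain ⟨C, hC⟩ := h.bound
  have hd : ∀ᶠ y in 𝓝 (0 : E), DifferentiableAt ℂ f y := hf.eventually_analyticAt.mono
    fun y hy => hy.differentiableAt
  obtain ⟨r, hr, hball⟩ := Metric.eventually_nhds_iff_ball.1 (hC.and hd)
  have hC0 : 0 ≤ |C| := abs_nonneg C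
  refine IsBigO.of_bound (|C| * 2 ^ (N + 1)) ?_
  filter_upwards [Metric.ball_mem_nhds (0 : E) (half_pos hr)] with x hx
  rw [mem_ball_zero_iff] at hx
  rcases eq_or_ne x 0 with rfl | hx0
  · rw [h0]; simp; positivity
  have hxp : 0 < ‖x‖ := norm_pos_iff.2 hx0
  refine ContinuousLinearMap.opNorm_le_bound _ (by positivity) fun u => ?_
  rcases eq_or_ne u 0 with rfl | hu0
  · simp
  have hup : 0 < ‖u‖ := norm_pos_iff.2 hu0
  set R := ‖x‖ / ‖u‖ with hR
  have hRp : 0 < R := by positivity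
  have hmem : ∀ s ∈ Metric.closedBall (0 : ℂ) R, ‖x + s • u‖ ≤ 2 * ‖x‖ := by
    intro s hs
    rw [mem_closedBall_zero_iff] at hs
    calc ‖x + s • u‖ ≤ ‖x‖ + ‖s • u‖ := norm_add_le _ _
      _ ≤ ‖x‖ + R * ‖u‖ := by rw [norm_smul]; gcongr
      _ = 2 * ‖x‖ := by rw [hR]; field_simp; ring
  have hder : HasDerivAt (fun s : ℂ => f (x + s • u)) (fderiv ℂ f x u) 0 := by
    have h1 : HasFDerivAt f (fderiv ℂ f x) (x + (0 : ℂ) • u) := by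
      simp only [zero_smul, add_zero]
      refine (hball x ?_).2.hasFDerivAt
      rw [mem_ball_zero_iff]; linarith
    have h2 : HasDerivAt (fun s : ℂ => x + s • u) u 0 := by
      simpa using ((hasDerivAt_id (0 : ℂ)).smul_const u).const_add x
    exact h1.comp_hasDerivAt (0 : ℂ) h2
  have hdc : DiffContOnCl ℂ (fun s : ℂ => f (x + s • u)) (Metric.ball 0 R) := by
    refine DifferentiableOn.diffContOnCl fun s hs => ?_
    have hs' := hmem s (Metric.closure_ball_subset_closedBall hs)
    refine DifferentiableAt.differentiableWithinAt ?_
    refine DifferentiableAt.comp s (hball _ ?_).2 (by fun_prop)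
    rw [mem_ball_zero_iff]; linarith
  have := Complex.norm_deriv_le_of_forall_mem_sphere_norm_le hRp hdc
    (C := |C| * (2 * ‖x‖) ^ (N + 1)) (by
      intro s hs
      have hs' := hmem s (Metric.sphere_subset_closedBall hs)
      have := (hball (x + s • u) (by rw [mem_ball_zero_iff]; linarith)).1
      calc _ ≤ _ := this
        _ ≤ |C| * ‖‖x + s • u‖ ^ (N + 1)‖ := by gcongr; exact le_abs_self C
        _ = |C| * ‖x + s • u‖ ^ (N + 1) := by simp
        _ ≤ _ := by gcongr)
  rw [hder.deriv] at this
  calc _ ≤ _ := this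
    _ = |C| * 2 ^ (N + 1) * ‖‖x‖ ^ N‖ * ‖u‖ := by
      rw [hR, norm_pow, norm_norm]; field_simp; ring

/-- The low order Taylor coefficients of a function vanishing to order `N + 1` are zero. -/
theorem coeff_diag_eq_zero {f : E → F} {p : FormalMultilinearSeries ℂ E F}
    (hp : HasFPowerSeriesAt f p 0) {N : ℕ} (h : f =O[𝓝 0] fun x => ‖x‖ ^ (N + 1))
    {j : ℕ} (hj : j ≤ N) (y : E) : p j (fun _ => y) = 0 := by
  induction j using Nat.strong_induction_on generalizing y with
  | _ j ih =>
    have h1 := hp.isBigO_sub_partialSum_pow (j + 1)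
    have h0 : f =O[𝓝 0] fun x => ‖x‖ ^ (j + 1) := by
      refine h.trans (IsBigO.of_bound 1 ?_)
      filter_upwards [Metric.ball_mem_nhds (0 : E) one_pos] with x hx
      rw [mem_ball_zero_iff] at hx
      simp only [norm_pow, norm_norm, one_mul]
      exact pow_le_pow_of_le_one (norm_nonneg _) hx.le (by omega)
    have h2 : (fun y => p j (fun _ => y)) =O[𝓝 0] fun y => ‖y‖ ^ (j + 1) := by
      have h3 := h0.sub (by simpa using h1)
      refine h3.congr_left fun y => ?_
      simp [FormalMultilinearSeries.partialSum, Finset.sum_range_succ,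
        Finset.sum_eq_zero fun i hi => ih i (Finset.mem_range.1 hi)
          ((Finset.mem_range.1 hi).le.trans hj) y]
    exact h2.continuousMultilinearMap_apply_eq_zero y

/-- An analytic function vanishing to infinite order at `0` vanishes near `0`. -/
theorem eventually_eq_zero_of_isBigO_pow {f : E → F} (hf : AnalyticAt ℂ f 0)
    (h : ∀ N : ℕ, f =O[𝓝 0] fun x => ‖x‖ ^ (N + 1)) : f =ᶠ[𝓝 0] 0 := by
  obtain ⟨p, hp⟩ := hf
  filter_upwards [hp.eventually_hasSum] with y hy
  have : HasSum (fun n => p n (fun _ => y)) 0 := by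
    simp [coeff_diag_eq_zero hp (h _) le_rfl, hasSum_zero]
  simpa using hy.unique this

/-- The Schwarz lemma for functions vanishing to higher order. -/
theorem norm_le_mul_div_pow {f : E → F} {r C : ℝ} {N : ℕ}
    (hd : DifferentiableOn ℂ f (Metric.ball 0 r)) (hC : ∀ x ∈ Metric.ball (0 : E) r, ‖f x‖ ≤ C)
    (h : f =O[𝓝 0] fun x => ‖x‖ ^ (N + 1)) {x : E} (hx : x ∈ Metric.ball (0 : E) r) :
    ‖f x‖ ≤ C * (‖x‖ / r) ^ (N + 1) := by
  have h0 : f 0 = 0 := by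
    have := h.eq_zero_imp
    have := this.self_of_nhds
    simpa using this
  have hlo : (fun x => f x - f 0) =o[𝓝 0] fun x => ‖x - 0‖ ^ N := by
    simp only [h0, sub_zero]
    refine h.trans_isLittleO ?_
    have h1 : (fun x : E => ‖x‖) =o[𝓝 0] fun _ => (1 : ℝ) := by
      rw [isLittleO_one_iff]
      simpa using (continuous_norm (E := E)).tendsto 0
    simpa [pow_succ] using (isBigO_refl (fun x : E => ‖x‖ ^ N) (𝓝 0)).mul_isLittleO h1
  have := Complex.dist_le_mul_div_pow_of_mapsTo_ball_of_isLittleO (R₂ := C) hd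
    (fun y hy => by simpa [h0] using hC y hy) hlo hx
  simpa [h0] using this

/-- Cauchy estimates for iterated Fréchet derivatives. -/
theorem norm_iteratedFDeriv_le_of_bound [CompleteSpace F] {f : E → F} {r C : ℝ} (hr : 0 < r)
    (hf : AnalyticOnNhd ℂ f (Metric.ball 0 r)) (hC : ∀ x ∈ Metric.ball (0 : E) r, ‖f x‖ ≤ C)
    (k : ℕ) : ‖iteratedFDeriv ℂ k f 0‖ ≤ C * (2 * k / r) ^ k := by
  rcases Nat.eq_zero_or_pos k with rfl | hk
  · simpa using hC 0 (Metric.mem_ball_self hr)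
  have hk' : (0 : ℝ) < k := by exact_mod_cast hk
  have hC0 : 0 ≤ C := (norm_nonneg _).trans (hC 0 (Metric.mem_ball_self hr))
  have key : ∀ j : ℕ, j ≤ k → ∀ x : E, ‖x‖ + j * (r / k) < r ∨ (‖x‖ = 0 ∧ j = k) →
      ‖iteratedFDeriv ℂ j f x‖ ≤ C * (2 * k / r) ^ j := by
    intro j
    induction j with
    | zero =>
      intro _ x hx
      have : x ∈ Metric.ball (0 : E) r := by
        rcases hx with hx | hx
        · simpa using hx
        · omega
      simpa using hC x this
    | succ j ih =>
      intro hj x hx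
      have hxr : ‖x‖ + (j + 1) * (r / k) ≤ r := by
        rcases hx with hx | ⟨h1, h2⟩
        · push_cast at hx; exact hx.le
        · rw [h1, ← h2]; push_cast; field_simp; simp
      have hrk : 0 < r / k := by positivity
      have hsub : Metric.ball x (r / k) ⊆ Metric.ball 0 r := by
        intro y hy
        rw [mem_ball_iff_norm] at hy
        rw [mem_ball_zero_iff]
        have := norm_le_norm_add_norm_sub' y x
        have : (0 : ℝ) ≤ j * (r / k) := by positivity
        linarith
      have hb : ∀ y ∈ Metric.ball x (r / k),
          ‖iteratedFDeriv ℂ j f y‖ ≤ C * (2 * k / r) ^ j := by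
        intro y hy
        refine ih (by omega) y (Or.inl ?_)
        rw [mem_ball_iff_norm] at hy
        have := norm_le_norm_add_norm_sub' y x
        linarith
      rw [← norm_fderiv_iteratedFDeriv]
      have := Complex.norm_fderiv_le_div_of_mapsTo_ball (f := iteratedFDeriv ℂ j f) (c := x)
        (R₁ := r / k) (R₂ := 2 * (C * (2 * k / r) ^ j))
        (fun y hy => ((hf.iteratedFDeriv j) y (hsub hy)).differentiableAt.differentiableWithinAt)
        (fun y hy => by
          rw [mem_closedBall_iff_norm]
          refine (norm_sub_le _ _).trans ?_
          have h1 := hb y hy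
          have h2 := hb x (Metric.mem_ball_self hrk)
          linarith) hrk
      refine this.trans (le_of_eq ?_)
      rw [pow_succ]
      field_simp
  exact key k le_rfl 0 (Or.inr ⟨norm_zero, rfl⟩)

theorem isBigO_pow_of_le {E F : Type*} [SeminormedAddCommGroup E] [SeminormedAddCommGroup F] {f : E → F} {N N' : ℕ} (hN : N ≤ N')
    (h : f =O[𝓝 0] fun x => ‖x‖ ^ N') : f =O[𝓝 0] fun x => ‖x‖ ^ N := by
  refine h.trans (IsBigO.of_bound 1 ?_)
  filter_upwards [Metric.ball_mem_nhds (0 : E) one_pos] with x hx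
  rw [mem_ball_zero_iff] at hx
  simp only [norm_pow, norm_norm, one_mul]
  exact pow_le_pow_of_le_one (norm_nonneg _) hx.le hN

/-- A bound for a homogeneous polynomial on a ball implies the same bound on the ball of the same
radius centred at the origin. -/
theorem norm_diag_le_of_bound_ball {k : ℕ} (L : E [×k]→L[ℂ] F) {v : E} {r C : ℝ}
    (h : ∀ x ∈ Metric.ball v r, ‖L (fun _ => x)‖ ≤ C) {x : E} (hx : x ∈ Metric.ball (0 : E) r) :
    ‖L (fun _ => x)‖ ≤ C := by
  have hd : Differentiable ℂ fun s : ℂ => L (fun _ => s • v + x) := by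
    have : Differentiable ℂ fun s : ℂ => fun _ : Fin k => s • v + x := by fun_prop
    exact (L.contDiff (n := 1)).differentiable (by simp) |>.comp this
  have := Complex.norm_le_of_forall_mem_frontier_norm_le (U := Metric.ball (0 : ℂ) 1)
    Metric.isBounded_ball hd.diffContOnCl (C := C) (fun s hs => ?_)
    (subset_closure (Metric.mem_ball_self one_pos))
  · simpa using this
  · rw [frontier_ball _ one_ne_zero, mem_sphere_zero_iff_norm] at hs
    have hs0 : s ≠ 0 := by rintro rfl; simp at hs
    have h1 : s • v + x = s • (v + s⁻¹ • x) := by rw [smul_add, smul_inv_smul₀ hs0]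
    simp only [h1]
    rw [ContinuousMultilinearMap.map_smul_univ (m := fun _ => v + s⁻¹ • x) L (fun _ => s)]
    simp only [Finset.prod_const, norm_smul, norm_pow, hs, one_pow, one_mul]
    refine h _ ?_
    rw [mem_ball_zero_iff] at hx
    rw [mem_ball_iff_norm]
    simpa [norm_smul, hs] using hx

/-- A coherent sequence of jets which converges along all lines with direction in a nonempty open
set is the Taylor expansion of an analytic function. -/
theorem exists_analyticAt_of_cone [CompleteSpace E] [CompleteSpace F] {p : ℕ → E → F}
    (hp : ∀ N, AnalyticAt ℂ (p N) 0)
    (hc : ∀ N N', N ≤ N' → (fun x => p N' x - p N x) =O[𝓝 0] fun x => ‖x‖ ^ (N + 1))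
    {B : Set E} (hB : IsOpen B) (hBne : B.Nonempty)
    (hq : ∀ v ∈ B, ∃ q : ℂ → F, AnalyticAt ℂ q 0 ∧
      ∀ N, (fun t : ℂ => p N (t • v) - q t) =O[𝓝 0] fun t => ‖t‖ ^ (N + 1)) :
    ∃ P : E → F, AnalyticAt ℂ P 0 ∧
      ∀ N, (fun x => P x - p N x) =O[𝓝 0] fun x => ‖x‖ ^ (N + 1) := by
  choose s hs using hp
  set h : ℕ → E → F := fun k x => s k k (fun _ => x) with hh
  have hsj : ∀ N j, j ≤ N → ∀ x, s N j (fun _ => x) = h j x := by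
    intro N j hj x
    have := coeff_diag_eq_zero ((hs N).sub (hs j)) (hc j N hj) le_rfl x
    simpa [sub_eq_zero] using this
  have hbound : ∀ v ∈ B, ∃ M : ℕ, ∀ k, ‖h k v‖ ≤ (M : ℝ) ^ (k + 1) := by
    intro v hv
    obtain ⟨q, ⟨u, hu⟩, hqN⟩ := hq v hv
    obtain ⟨C, r, hC, hr, hCr⟩ := u.le_mul_pow_of_radius_pos hu.radius_pos
    obtain ⟨M, hM⟩ := exists_nat_ge (max C r)
    refine ⟨M, fun k => ?_⟩
    have h1 : HasFPowerSeriesAt (p k ∘ (ContinuousLinearMap.toSpanSingleton ℂ v))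
        ((s k).compContinuousLinearMap (ContinuousLinearMap.toSpanSingleton ℂ v)) 0 := by
      apply HasFPowerSeriesAt.compContinuousLinearMap
      simpa using hs k
    have h2 := coeff_diag_eq_zero (h1.sub hu) (hqN k) le_rfl 1
    have h3 : h k v = u k (fun _ => 1) := by
      rw [← sub_eq_zero, ← h2]
      simp only [hh, FormalMultilinearSeries.sub_apply, _root_.sub_apply,
        FormalMultilinearSeries.compContinuousLinearMap_apply]
      congr 2
      ext i
      simp
    rw [h3]
    calc ‖u k fun _ => 1‖ ≤ ‖u k‖ * ∏ _i : Fin k, ‖(1 : ℂ)‖ := (u k).le_opNorm _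
      _ = ‖u k‖ := by simp
      _ ≤ C * r ^ k := hCr k
      _ ≤ M * M ^ k := by
        gcongr
        · exact (le_max_left _ _).trans hM
        · exact (le_max_right _ _).trans hM
      _ = _ := by ring
  have hcont : ∀ k, Continuous (h k) := fun k =>
    (s k k).cont.comp (continuous_pi fun _ => continuous_id)
  have hdense := dense_iUnion_interior_of_closed
    (f := fun M : ℕ => Bᶜ ∪ {v | ∀ k, ‖h k v‖ ≤ (M : ℝ) ^ (k + 1)})
    (fun M => hB.isClosed_compl.union (by
      rw [Set.ofPred_forall]
      exact isClosed_iInter fun k => isClosed_le (hcont k).norm continuous_const))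
    (by
      rw [Set.eq_univ_iff_forall]
      intro v
      rw [Set.mem_iUnion]
      by_cases hv : v ∈ B
      · obtain ⟨M, hM⟩ := hbound v hv
        exact ⟨M, Or.inr hM⟩
      · exact ⟨0, Or.inl hv⟩)
  obtain ⟨v, hvB, hv⟩ := hdense.inter_open_nonempty B hB hBne
  obtain ⟨M, hM⟩ := Set.mem_iUnion.1 hv
  obtain ⟨r, hr, hball⟩ := Metric.isOpen_iff.1 (isOpen_interior.inter hB) v ⟨hM, hvB⟩
  have hb0 : ∀ k, ∀ x ∈ Metric.ball (0 : E) r, ‖h k x‖ ≤ (M : ℝ) ^ (k + 1) := by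
    intro k x hx
    refine norm_diag_le_of_bound_ball (v := v) (s k k) (fun y hy => ?_) hx
    have := hball hy
    rcases interior_subset this.1 with h1 | h1
    · exact absurd this.2 h1
    · exact h1 k
  have hser : ∀ k, HasFPowerSeriesOnBall (h k) (fun j => if j = k then s k j else 0) 0 ⊤ := by
    intro k
    have h1 := (FormalMultilinearSeries.hasFiniteFPowerSeriesOnBall_of_finite
      (fun j => if j = k then s k j else 0) (n := k + 1)
      (fun j hj => if_neg (by omega))).toHasFPowerSeriesOnBall
    refine h1.congr fun x _ => ?_
    change ∑' j, _ = _
    rw [tsum_eq_single k (fun j hj => by simp [hj])]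
    simp [hh]
  have hdiag : ∀ k x, iteratedFDeriv ℂ k (h k) 0 (fun _ => x) = (k.factorial : ℂ) • h k x := by
    intro k x
    rw [(hser k).iteratedFDeriv_eq_sum_of_completeSpace]
    simp [hh, Fintype.card_perm, Nat.cast_smul_eq_nsmul]
  have han : ∀ k, AnalyticOnNhd ℂ (h k) (Metric.ball 0 r) := fun k x _ =>
    (hser k).analyticOnNhd x (by simp)
  set S : FormalMultilinearSeries ℂ E F := fun k =>
    (k.factorial : ℂ)⁻¹ • iteratedFDeriv ℂ k (h k) 0 with hS
  have hSd : ∀ k x, S k (fun _ => x) = h k x := by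
    intro k x
    have : (k.factorial : ℂ) ≠ 0 := by exact_mod_cast k.factorial_ne_zero
    simp only [hS]
    rw [_root_.smul_apply, hdiag, inv_smul_smul₀ this]
  set ρ : ℝ := r / (2 * Real.exp 1 * (M + 1)) with hρ
  have hρ0 : 0 < ρ := by positivity
  have hSb : ∀ k, ‖S k‖ * ρ ^ k ≤ M + 1 := by
    intro k
    have h1 := norm_iteratedFDeriv_le_of_bound hr (han k) (hb0 k) k
    have h2 : (k : ℝ) ^ k / k.factorial ≤ Real.exp k :=
      Real.pow_div_factorial_le_exp _ (by positivity) k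
    have h3 : Real.exp k = Real.exp 1 ^ k := by rw [← Real.exp_nat_mul]; simp
    calc ‖S k‖ * ρ ^ k
        = (k.factorial : ℝ)⁻¹ * ‖iteratedFDeriv ℂ k (h k) 0‖ * ρ ^ k := by
          simp only [hS]
          rw [norm_smul]; simp
      _ ≤ (k.factorial : ℝ)⁻¹ * ((M : ℝ) ^ (k + 1) * (2 * k / r) ^ k) * ρ ^ k := by gcongr
      _ = ((k : ℝ) ^ k / k.factorial) * ((M : ℝ) ^ (k + 1) * (2 * ρ / r) ^ k) := by
          simp only [div_pow, mul_pow]; field_simp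
      _ ≤ Real.exp 1 ^ k * ((M + 1 : ℝ) ^ (k + 1) * (2 * ρ / r) ^ k) := by
          rw [← h3]; gcongr; linarith
      _ = M + 1 := by
          have : 2 * ρ / r = (Real.exp 1 * (M + 1))⁻¹ := by rw [hρ]; field_simp
          rw [this, pow_succ, inv_pow, mul_pow]
          field_simp
  have hrad : (ρ.toNNReal : ENNReal) ≤ S.radius :=
    S.le_radius_of_bound (M + 1) (by simpa [Real.coe_toNNReal ρ hρ0.le] using hSb)
  have hrad0 : 0 < S.radius := lt_of_lt_of_le (by simpa using hρ0) hrad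
  have hsum := (S.hasFPowerSeriesOnBall hrad0).hasFPowerSeriesAt
  refine ⟨S.sum, ⟨S, hsum⟩, fun N => ?_⟩
  have h1 := hsum.isBigO_sub_partialSum_pow (N + 1)
  have h2 := (hs N).isBigO_sub_partialSum_pow (N + 1)
  refine (h1.sub h2).congr_left fun x => ?_
  have : S.partialSum (N + 1) x = (s N).partialSum (N + 1) x := by
    simp only [FormalMultilinearSeries.partialSum]
    refine Finset.sum_congr rfl fun j hj => ?_
    rw [hSd, hsj N j (by simpa [Nat.lt_succ_iff] using hj)]
  simp [this]

end Orders
section Cone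

variable {E : Type*} [NormedAddCommGroup E] [NormedSpace ℂ E]

theorem isBigO_pow_comp_smul {F : Type*} [NormedAddCommGroup F] {f : E → F} {N : ℕ}
    (h : f =O[𝓝 0] fun x => ‖x‖ ^ N) (v : E) :
    (fun t : ℂ => f (t • v)) =O[𝓝 0] fun t => ‖t‖ ^ N := by
  have ht : Tendsto (fun t : ℂ => t • v) (𝓝 0) (𝓝 0) := by
    have : Continuous fun t : ℂ => t • v := by fun_prop
    simpa using this.tendsto 0
  refine (h.comp_tendsto ht).trans ?_
  refine IsBigO.of_bound (‖v‖ ^ N) (Eventually.of_forall fun t => ?_)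
  simp [norm_smul, mul_pow, mul_comm]

/-- A function which does not vanish to order `d + 1` is bounded below by `‖t‖ ^ d` along the lines
with direction in some nonempty open set. -/
theorem exists_cone_lower_bound {f : E → ℂ} (hf : AnalyticAt ℂ f 0) {d : ℕ}
    (h : ¬ f =O[𝓝 0] fun x => ‖x‖ ^ (d + 1)) :
    ∃ B : Set E, IsOpen B ∧ B.Nonempty ∧ ∀ v ∈ B, ∃ c : ℝ, 0 < c ∧
      ∀ᶠ t : ℂ in 𝓝 0, c * ‖t‖ ^ d ≤ ‖f (t • v)‖ := by
  classical
  obtain ⟨p, hp⟩ := hf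
  have hex : ∃ k, k ≤ d ∧ ∃ v, p k (fun _ => v) ≠ 0 := by
    by_contra! hcon
    refine h ?_
    have := hp.isBigO_sub_partialSum_pow (d + 1)
    refine this.congr_left fun x => ?_
    simp only [zero_add, FormalMultilinearSeries.partialSum]
    rw [Finset.sum_eq_zero fun i hi => hcon i (by simpa [Nat.lt_succ_iff] using hi) x, sub_zero]
  obtain ⟨hk, v₀, hv₀⟩ := Nat.find_spec hex
  set k := Nat.find hex with hkdef
  have hmin : ∀ j < k, ∀ v, p j (fun _ => v) = 0 := by
    intro j hj v
    by_contra hne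
    exact Nat.find_min hex hj ⟨hj.le.trans hk, v, hne⟩
  have hcont : Continuous fun v => p k (fun _ => v) :=
    (p k).cont.comp (continuous_pi fun _ => continuous_id)
  refine ⟨{v | p k (fun _ => v) ≠ 0}, isOpen_ne_fun hcont continuous_const, ⟨v₀, hv₀⟩, ?_⟩
  intro v hv
  have hv' : 0 < ‖p k (fun _ => v)‖ := norm_pos_iff.2 hv
  have h1 : (fun x => f x - p k (fun _ => x)) =O[𝓝 0] fun x => ‖x‖ ^ (k + 1) := by
    have := hp.isBigO_sub_partialSum_pow (k + 1)
    refine this.congr_left fun x => ?_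
    simp only [zero_add, FormalMultilinearSeries.partialSum, Finset.sum_range_succ]
    rw [Finset.sum_eq_zero fun i hi => hmin i (by simpa using hi) x, zero_add]
  obtain ⟨C, hC⟩ := (isBigO_pow_comp_smul h1 v).bound
  refine ⟨‖p k (fun _ => v)‖ / 2, by positivity, ?_⟩
  have hsmall : ∀ᶠ t : ℂ in 𝓝 0, C * ‖t‖ < ‖p k (fun _ => v)‖ / 2 := by
    have : Tendsto (fun t : ℂ => C * ‖t‖) (𝓝 0) (𝓝 0) := by
      have : Continuous fun t : ℂ => C * ‖t‖ := by fun_prop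
      simpa using this.tendsto 0
    exact this.eventually (gt_mem_nhds (by positivity))
  filter_upwards [hC, hsmall, Metric.ball_mem_nhds (0 : ℂ) one_pos] with t ht1 ht2 ht3
  rw [mem_ball_zero_iff] at ht3
  have h2 : p k (fun _ => t • v) = t ^ k • p k (fun _ => v) := by
    rw [ContinuousMultilinearMap.map_smul_univ (m := fun _ => v) (p k) (fun _ => t)]
    simp
  rw [h2] at ht1
  have h3 : ‖t‖ ^ k * ‖p k (fun _ => v)‖ ≤ ‖f (t • v)‖ + C * ‖t‖ ^ (k + 1) := by
    have h4 : t ^ k • p k (fun _ => v) = f (t • v) - (f (t • v) - t ^ k • p k (fun _ => v)) := by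
      ring
    calc _ = ‖t ^ k • p k (fun _ => v)‖ := by rw [norm_smul, norm_pow]
      _ ≤ ‖f (t • v)‖ + ‖f (t • v) - t ^ k • p k (fun _ => v)‖ := by
        conv_lhs => rw [h4]
        exact norm_sub_le _ _
      _ ≤ _ := by
        gcongr
        simpa using ht1
  calc _ ≤ ‖p k (fun _ => v)‖ / 2 * ‖t‖ ^ k := by
        gcongr _ * ?_
        exact pow_le_pow_of_le_one (norm_nonneg _) ht3.le hk
    _ ≤ ‖f (t • v)‖ := by
      have : C * ‖t‖ ^ (k + 1) ≤ ‖p k (fun _ => v)‖ / 2 * ‖t‖ ^ k := by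
        rw [pow_succ']
        calc C * (‖t‖ * ‖t‖ ^ k) = C * ‖t‖ * ‖t‖ ^ k := by ring
          _ ≤ _ := by gcongr
      linarith

end Cone

section LocalBounds

variable {E F : Type*} [NormedAddCommGroup E] [NormedSpace ℂ E]
  [NormedAddCommGroup F] [NormedSpace ℂ F]

/-- Lipschitz and quadratic bounds for an analytic map near a point. -/
theorem exists_ball_bounds [CompleteSpace F] {f : E → F} (hf : AnalyticAt ℂ f 0) :
    ∃ r > 0, ∃ C > 0, AnalyticOnNhd ℂ f (Metric.ball 0 r) ∧
      (∀ x ∈ Metric.ball (0 : E) r, ‖f x‖ ≤ C) ∧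
      (∀ x ∈ Metric.ball (0 : E) r, ‖fderiv ℂ f x‖ ≤ C) ∧
      (∀ x ∈ Metric.ball (0 : E) r, ∀ y ∈ Metric.ball (0 : E) r, ‖f x - f y‖ ≤ C * ‖x - y‖) ∧
      (∀ x ∈ Metric.ball (0 : E) r, ∀ y ∈ Metric.ball (0 : E) r,
        ‖fderiv ℂ f x - fderiv ℂ f y‖ ≤ C * ‖x - y‖) ∧
      ∀ z ∈ Metric.ball (0 : E) r, ∀ x ∈ Metric.ball (0 : E) r, ∀ y ∈ Metric.ball (0 : E) r,
        ‖f x - f y - fderiv ℂ f z (x - y)‖ ≤ C * (‖x - z‖ + ‖y - z‖) * ‖x - y‖ := by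
  have hb : ∀ {g : E → ℝ}, ContinuousAt g 0 → ∀ᶠ x in 𝓝 (0 : E), g x ≤ g 0 + 1 :=
    fun {g} hg => (hg.eventually (gt_mem_nhds (lt_add_one (g 0)))).mono fun x hx => hx.le
  obtain ⟨r, hr, hball⟩ := Metric.eventually_nhds_iff_ball.1 (hf.eventually_analyticAt.and
    ((hb hf.continuousAt.norm).and ((hb hf.fderiv.continuousAt.norm).and
      (hb hf.fderiv.fderiv.continuousAt.norm))))
  set C := max (‖f 0‖ + 1) (max (‖fderiv ℂ f 0‖ + 1) (‖fderiv ℂ (fderiv ℂ f) 0‖ + 1)) with hC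
  have h1 : ∀ x ∈ Metric.ball (0 : E) r, ‖f x‖ ≤ C := fun x hx =>
    (hball x hx).2.1.trans (le_max_left _ _)
  have h2 : ∀ x ∈ Metric.ball (0 : E) r, ‖fderiv ℂ f x‖ ≤ C := fun x hx =>
    (hball x hx).2.2.1.trans ((le_max_left _ _).trans (le_max_right _ _))
  have h3 : ∀ x ∈ Metric.ball (0 : E) r, ‖fderiv ℂ (fderiv ℂ f) x‖ ≤ C := fun x hx =>
    (hball x hx).2.2.2.trans ((le_max_right _ _).trans (le_max_right _ _))
  have h4 : ∀ x ∈ Metric.ball (0 : E) r, ∀ y ∈ Metric.ball (0 : E) r,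
      ‖fderiv ℂ f x - fderiv ℂ f y‖ ≤ C * ‖x - y‖ := fun x hx y hy =>
    (convex_ball (0 : E) r).norm_image_sub_le_of_norm_fderiv_le
      (fun z hz => (hball z hz).1.fderiv.differentiableAt) h3 hy hx
  have hC0 : 0 < C := lt_of_lt_of_le (by positivity) (le_max_left _ _)
  refine ⟨r, hr, C, hC0, fun x hx => (hball x hx).1,
    h1, h2, fun x hx y hy => ?_, h4, fun z hz x hx y hy => ?_⟩
  · exact (convex_ball (0 : E) r).norm_image_sub_le_of_norm_fderiv_le
      (fun z hz => (hball z hz).1.differentiableAt) h2 hy hx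
  · have hseg : segment ℝ y x ⊆ Metric.ball 0 r := (convex_ball (0 : E) r).segment_subset hy hx
    refine (convex_segment y x).norm_image_sub_le_of_norm_fderiv_le' (𝕜 := ℂ)
      (fun w hw => (hball w (hseg hw)).1.differentiableAt) (fun w hw => ?_)
      (left_mem_segment ℝ y x) (right_mem_segment ℝ y x)
    refine (h4 w (hseg hw) z hz).trans ?_
    gcongr
    obtain ⟨a, b, ha, hb, hab, rfl⟩ := hw
    have : a • y + b • x - z = a • (y - z) + b • (x - z) := by
      rw [smul_sub, smul_sub, ← sub_eq_zero]
      have : z = a • z + b • z := by rw [← add_smul, hab, one_smul]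
      nth_rewrite 1 [this]; abel
    rw [this]
    refine (norm_add_le _ _).trans ?_
    rw [norm_smul, norm_smul, Real.norm_of_nonneg ha, Real.norm_of_nonneg hb]
    nlinarith [norm_nonneg (y - z), norm_nonneg (x - z)]

end LocalBounds
section Nemytskii

set_option linter.unusedSectionVars false

variable {K : Type*} [TopologicalSpace K] [CompactSpace K]
  {V F : Type*} [NormedAddCommGroup V] [NormedSpace ℂ V]
  [NormedAddCommGroup F] [NormedSpace ℂ F]

open Classical in
/-- The superposition operator `u ↦ (θ ↦ Y θ (u θ))` on continuous functions. -/
noncomputable def nem (Y : K → V → F) (u : C(K, V)) : C(K, F) :=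
  if h : Continuous fun θ => Y θ (u θ) then ⟨fun θ => Y θ (u θ), h⟩ else 0

theorem nem_apply {Y : K → V → F} {u : C(K, V)} (h : Continuous fun θ => Y θ (u θ)) (θ : K) :
    nem Y u θ = Y θ (u θ) := by
  simp [nem, h]

/-- Superposition operators are complex differentiable. -/
theorem differentiableAt_nem {Y : K → V → F} {Y' : K → V → V →L[ℂ] F} {r C : ℝ}
    (hc : ∀ u : C(K, V), ‖u‖ < r → Continuous fun θ => Y θ (u θ))
    (hc' : ∀ u : C(K, V), ‖u‖ < r → Continuous fun θ => Y' θ (u θ))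
    (hq : ∀ θ x y, ‖x‖ < r → ‖y‖ < r → ‖Y θ y - Y θ x - Y' θ x (y - x)‖ ≤ C * ‖y - x‖ ^ 2)
    {u : C(K, V)} (hu : ‖u‖ < r) : DifferentiableAt ℂ (nem Y) u := by
  set a : C(K, V →L[ℂ] F) := ⟨fun θ => Y' θ (u θ), hc' u hu⟩ with ha
  set L : C(K, V) →L[ℂ] C(K, F) := LinearMap.mkContinuous
    { toFun := fun h => ⟨fun θ => a θ (h θ), a.continuous.clm_apply h.continuous⟩
      map_add' := fun h h' => by ext θ; simp
      map_smul' := fun c h => by ext θ; simp } ‖a‖ (fun h => by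
        refine (ContinuousMap.norm_le _ (by positivity)).2 fun θ => ?_
        refine ((a θ).le_opNorm _).trans ?_
        gcongr
        · exact a.norm_coe_le_norm θ
        · exact h.norm_coe_le_norm θ) with hL
  have hC : 0 ≤ |C| := abs_nonneg C
  have hd : HasFDerivAt (nem Y) L u := by
    rw [hasFDerivAt_iff_isLittleO_nhds_zero]
    have h1 : (fun h : C(K, V) => nem Y (u + h) - nem Y u - L h) =O[𝓝 0] fun h => ‖h‖ ^ 2 := by
      refine IsBigO.of_bound |C| ?_
      have hev : ∀ᶠ h : C(K, V) in 𝓝 0, ‖u + h‖ < r := by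
        have : Tendsto (fun h : C(K, V) => ‖u + h‖) (𝓝 0) (𝓝 ‖u‖) := by
          have : Continuous fun h : C(K, V) => ‖u + h‖ := by fun_prop
          simpa using this.tendsto 0
        exact this.eventually (gt_mem_nhds hu)
      filter_upwards [hev] with h hh
      refine (ContinuousMap.norm_le _ (by positivity)).2 fun θ => ?_
      have h2 := hq θ (u θ) ((u + h) θ) ((u.norm_coe_le_norm θ).trans_lt hu)
        (((u + h).norm_coe_le_norm θ).trans_lt hh)
      simp only [ContinuousMap.sub_apply, nem_apply (hc _ hh), nem_apply (hc _ hu)]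
      have h3 : (u + h) θ - u θ = h θ := by simp
      rw [h3] at h2
      refine (show _ ≤ C * ‖h θ‖ ^ 2 from h2).trans ?_
      calc C * ‖h θ‖ ^ 2 ≤ |C| * ‖h‖ ^ 2 := by
            gcongr
            · exact le_abs_self C
            · exact h.norm_coe_le_norm θ
        _ = _ := by simp
    refine h1.trans_isLittleO ?_
    exact (isLittleO_norm_pow_id one_lt_two)
  exact hd.differentiableAt

end Nemytskii

section Contraction

variable {V : Type*} [NormedAddCommGroup V] [NormedSpace ℂ V] [CompleteSpace V]

/-- The fixed point of a holomorphic family of contractions depends holomorphically on the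
parameter. -/
theorem exists_holomorphic_fixedPoint {Ω : Set ℂ} (hΩ : IsOpen Ω) {T : ℂ → V → V} {ε : ℂ → ℝ}
    (hε : ∀ t ∈ Ω, 0 ≤ ε t) (hε1 : ∀ t ∈ Ω, ε t ≤ 1)
    (h0 : ∀ t ∈ Ω, ‖T t 0‖ ≤ ε t / 2)
    (hlip : ∀ t ∈ Ω, ∀ z z', ‖z‖ ≤ ε t → ‖z'‖ ≤ ε t → ‖T t z - T t z'‖ ≤ ‖z - z'‖ / 2)
    (hhol : ∀ y : ℂ → V, DifferentiableOn ℂ y Ω → (∀ t ∈ Ω, ‖y t‖ ≤ ε t) →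
      DifferentiableOn ℂ (fun t => T t (y t)) Ω) :
    ∃ y : ℂ → V, DifferentiableOn ℂ y Ω ∧ (∀ t ∈ Ω, ‖y t‖ ≤ ε t) ∧
      ∀ t ∈ Ω, ∀ z, ‖z‖ ≤ ε t → ‖z - y t‖ ≤ 2 * ‖z - T t z‖ := by
  set s : ℕ → ℂ → V := fun k => Nat.rec (fun _ => 0) (fun _ y t => T t (y t)) k with hs
  have hs0 : ∀ t, s 0 t = 0 := fun t => rfl
  have hss : ∀ k t, s (k + 1) t = T t (s k t) := fun k t => rfl
  have hmaps : ∀ t ∈ Ω, ∀ z, ‖z‖ ≤ ε t → ‖T t z‖ ≤ ε t := by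
    intro t ht z hz
    have h1 := hlip t ht z 0 hz (by simpa using hε t ht)
    have h2 := h0 t ht
    have h3 : ‖T t z‖ ≤ ‖T t z - T t 0‖ + ‖T t 0‖ := by
      simpa using norm_add_le (T t z - T t 0) (T t 0)
    rw [sub_zero] at h1
    linarith
  have hsb : ∀ k, ∀ t ∈ Ω, ‖s k t‖ ≤ ε t := by
    intro k
    induction k with
    | zero => intro t ht; simpa [hs0] using hε t ht
    | succ k ih => intro t ht; rw [hss]; exact hmaps t ht _ (ih t ht)
  have hsd : ∀ k, DifferentiableOn ℂ (s k) Ω := by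
    intro k
    induction k with
    | zero => exact differentiableOn_const 0
    | succ k ih => exact hhol _ ih (hsb k)
  have hstep : ∀ t ∈ Ω, ∀ k, dist (s k t) (s (k + 1) t) ≤ 1 / 2 / 2 ^ k := by
    intro t ht k
    induction k with
    | zero =>
      rw [hss, hs0, dist_zero_left]
      have := h0 t ht
      have := hε1 t ht
      simp; linarith
    | succ k ih =>
      rw [dist_eq_norm] at ih ⊢
      have := hlip t ht _ _ (hsb k t ht) (hsb (k + 1) t ht)
      rw [← hss k t, ← hss (k + 1) t] at this
      refine this.trans ?_
      rw [pow_succ, ← div_div]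
      linarith
  choose! y hy using fun t (ht : t ∈ Ω) => cauchySeq_tendsto_of_complete
    (cauchySeq_of_le_geometric_two (hstep t ht))
  have hdist : ∀ t ∈ Ω, ∀ k, dist (s k t) (y t) ≤ 1 / 2 ^ k := fun t ht k =>
    dist_le_of_le_geometric_two_of_tendsto (hstep t ht) (hy t ht) k
  have hyb : ∀ t ∈ Ω, ‖y t‖ ≤ ε t := fun t ht =>
    le_of_tendsto (hy t ht).norm (Eventually.of_forall fun k => hsb k t ht)
  have hunif : TendstoUniformlyOn s y atTop Ω := by
    rw [Metric.tendstoUniformlyOn_iff]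
    intro δ hδ
    obtain ⟨k₀, hk₀⟩ := exists_pow_lt_of_lt_one hδ (show (1 / 2 : ℝ) < 1 by norm_num)
    filter_upwards [eventually_ge_atTop k₀] with k hk t ht
    rw [dist_comm]
    refine (hdist t ht k).trans_lt (lt_of_le_of_lt ?_ hk₀)
    rw [one_div_pow]
    gcongr
    norm_num
  refine ⟨y, hunif.tendstoLocallyUniformlyOn.differentiableOn (Eventually.of_forall hsd) hΩ, hyb,
    fun t ht z hz => ?_⟩
  have hfix : T t (y t) = y t := by
    refine tendsto_nhds_unique (f := fun k => s (k + 1) t) (l := atTop) ?_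
      ((tendsto_add_atTop_iff_nat 1).2 (hy t ht))
    rw [tendsto_iff_norm_sub_tendsto_zero]
    refine squeeze_zero (fun k => norm_nonneg _)
      (fun k => hlip t ht _ _ (hsb k t ht) (hyb t ht)) ?_
    simpa using ((tendsto_iff_norm_sub_tendsto_zero.1 (hy t ht)).div_const 2)
  have h1 := hlip t ht z (y t) hz (hyb t ht)
  rw [hfix] at h1
  have h2 : ‖z - y t‖ ≤ ‖z - T t z‖ + ‖T t z - y t‖ := by
    simpa using norm_add_le (z - T t z) (T t z - y t)
  linarith

end Contraction
section Primitive

set_option linter.unusedSectionVars false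

/-- The parameter interval of the circle action. -/
abbrev Cir : Type := Set.Icc (0 : ℝ) (2 * Real.pi)

/-- The end point of the parameter interval. -/
noncomputable def Cir.last : Cir := ⟨2 * Real.pi, Real.two_pi_pos.le, le_rfl⟩

variable {V W : Type*} [NormedAddCommGroup V] [NormedSpace ℂ V] [CompleteSpace V]
  [NormedAddCommGroup W] [NormedSpace ℂ W] [CompleteSpace W]

theorem continuous_extend (ω : C(Cir, V)) :
    Continuous fun s : ℝ => ω (Set.projIcc 0 (2 * Real.pi) Real.two_pi_pos.le s) :=
  ω.continuous.comp continuous_projIcc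

/-- Integration from `0`, as an operator on continuous functions. -/
noncomputable def prim : C(Cir, V) →L[ℂ] C(Cir, V) :=
  LinearMap.mkContinuous
    { toFun := fun ω => ⟨fun θ => ∫ s in (0 : ℝ)..θ,
          ω (Set.projIcc 0 (2 * Real.pi) Real.two_pi_pos.le s),
        (intervalIntegral.continuous_primitive
          (fun a b => (continuous_extend ω).intervalIntegrable a b) 0).comp continuous_subtype_val⟩
      map_add' := fun ω ω' => by
        ext θ
        exact intervalIntegral.integral_add ((continuous_extend ω).intervalIntegrable _ _)
          ((continuous_extend ω').intervalIntegrable _ _)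
      map_smul' := fun c ω => by
        ext θ
        exact intervalIntegral.integral_smul c _ }
    (2 * Real.pi) (fun ω => by
      have hpi := Real.two_pi_pos
      refine (ContinuousMap.norm_le _ (by positivity)).2 fun θ => ?_
      have h1 := intervalIntegral.norm_integral_le_of_norm_le_const
        (f := fun s : ℝ => ω (Set.projIcc 0 (2 * Real.pi) Real.two_pi_pos.le s))
        (a := 0) (b := θ) (C := ‖ω‖) (fun s _ => ω.norm_coe_le_norm _)
      refine h1.trans ?_
      rw [sub_zero, abs_of_nonneg θ.2.1, mul_comm]
      gcongr
      exact θ.2.2)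

theorem prim_apply (ω : C(Cir, V)) (θ : Cir) : prim ω θ =
    ∫ s in (0 : ℝ)..θ, ω (Set.projIcc 0 (2 * Real.pi) Real.two_pi_pos.le s) := rfl

theorem norm_prim_le (ω : C(Cir, V)) : ‖prim ω‖ ≤ 2 * Real.pi * ‖ω‖ :=
  (prim.le_opNorm ω).trans (by
    gcongr
    exact LinearMap.mkContinuous_norm_le _ Real.two_pi_pos.le _)

/-- Integration over the full period. -/
noncomputable def primLast : C(Cir, V) →L[ℂ] V :=
  (ContinuousMap.evalCLM ℂ Cir.last).comp prim

theorem primLast_apply (ω : C(Cir, V)) : primLast ω = prim ω Cir.last := rfl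

theorem norm_primLast_le (ω : C(Cir, V)) : ‖primLast ω‖ ≤ 2 * Real.pi * ‖ω‖ :=
  ((prim ω).norm_coe_le_norm _).trans (norm_prim_le ω)

theorem prim_eq_sub {w : ℝ → V} {ω : C(Cir, V)} (hw : ∀ θ : Cir, HasDerivAt w (ω θ) θ) (θ : Cir) :
    prim ω θ = w θ - w 0 := by
  rw [prim_apply]
  refine intervalIntegral.integral_eq_sub_of_hasDerivAt (fun s hs => ?_)
    ((continuous_extend ω).intervalIntegrable _ _)
  rw [Set.uIcc_of_le θ.2.1] at hs
  have hs' : s ∈ Set.Icc 0 (2 * Real.pi) := ⟨hs.1, hs.2.trans θ.2.2⟩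
  rw [Set.projIcc_of_mem _ hs']
  exact hw ⟨s, hs'⟩

theorem prim_const (c : V) (θ : Cir) : prim (ContinuousMap.const Cir c) θ = (θ : ℝ) • c := by
  simp [prim_apply]

theorem primLast_const (c : V) :
    primLast (ContinuousMap.const Cir c) = (2 * (Real.pi : ℂ)) • c := by
  rw [primLast_apply, prim_const]
  simp only [Cir.last]
  rw [← Complex.coe_smul]
  simp

/-- Pointwise action of linear maps on continuous functions. -/
noncomputable def post : (V →L[ℂ] W) →L[ℂ] C(Cir, V) →L[ℂ] C(Cir, W) :=
  LinearMap.mkContinuous₂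
    { toFun := fun A =>
        { toFun := fun u => ⟨fun θ => A (u θ), A.continuous.comp u.continuous⟩
          map_add' := fun u u' => by ext θ; simp
          map_smul' := fun c u => by ext θ; simp }
      map_add' := fun A A' => by ext u θ; simp
      map_smul' := fun c A => by ext u θ; simp } 1 (fun A u => by
      refine (ContinuousMap.norm_le _ (by positivity)).2 fun θ => ?_
      rw [one_mul]
      refine (A.le_opNorm _).trans ?_
      gcongr
      exact u.norm_coe_le_norm θ)

@[simp]
theorem post_apply (A : V →L[ℂ] W) (u : C(Cir, V)) (θ : Cir) : post A u θ = A (u θ) := rfl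

theorem norm_post_le (A : V →L[ℂ] W) (u : C(Cir, V)) : ‖post A u‖ ≤ ‖A‖ * ‖u‖ := by
  refine (ContinuousMap.norm_le _ (by positivity)).2 fun θ => ?_
  refine (A.le_opNorm _).trans ?_
  gcongr
  exact u.norm_coe_le_norm θ

theorem prim_post (A : V →L[ℂ] W) (u : C(Cir, V)) : prim (post A u) = post A (prim u) := by
  ext θ
  simp only [prim_apply, post_apply]
  exact A.intervalIntegral_comp_comm ((continuous_extend u).intervalIntegrable _ _)

/-- Constant functions. -/
noncomputable def constCLM : V →L[ℂ] C(Cir, V) :=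
  LinearMap.mkContinuous
    { toFun := fun c => ContinuousMap.const Cir c
      map_add' := fun c c' => by ext θ; simp
      map_smul' := fun a c => by ext θ; simp } 1 (fun c => by
      refine (ContinuousMap.norm_le _ (by positivity)).2 fun θ => ?_
      simp)

@[simp]
theorem constCLM_apply (c : V) (θ : Cir) : constCLM c θ = c := rfl

theorem norm_constCLM_le (c : V) : ‖constCLM c‖ ≤ ‖c‖ :=
  (ContinuousMap.norm_le _ (by positivity)).2 fun θ => by simp

theorem primLast_constCLM (c : V) : primLast (constCLM c) = (2 * (Real.pi : ℂ)) • c :=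
  primLast_const c

end Primitive
section Static

set_option linter.unusedSectionVars false

variable {V P G : Type*} [NormedAddCommGroup V] [NormedSpace ℂ V] [CompleteSpace V]
  [NormedAddCommGroup P] [NormedSpace ℂ P] [CompleteSpace P]
  [NormedAddCommGroup G] [NormedSpace ℂ G]

/-- The right hand side of the equation of the toric action, in rotating coordinates. -/
noncomputable def vel (Y : Cir → V → P →L[ℂ] V) (D : V →L[ℂ] V) (x : V) (b : P)
    (z : C(Cir, V) × P) : C(Cir, V) :=
  Complex.I • (post (ContinuousLinearMap.apply ℂ V (b + z.2)) (nem Y (constCLM x + prim z.1))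
    - post D (constCLM x + prim z.1))

/-- The linearization of `vel` in the space variable. -/
noncomputable def lin (X' : V →L[ℂ] P →L[ℂ] V) (D : V →L[ℂ] V) (b : P) : V →L[ℂ] V :=
  Complex.I • ((ContinuousLinearMap.apply ℂ V b).comp X' - D)

/-- The part of `vel`, iterated once, that is not accounted for by the parameter shift. -/
noncomputable def velRem (Y : Cir → V → P →L[ℂ] V) (D A : V →L[ℂ] V) (X₀ : P →L[ℂ] V) (x : V)
    (b : P) (z : C(Cir, V) × P) : C(Cir, V) :=
  vel Y D x b z + post A (prim (vel Y D x b z) - prim z.1) - Complex.I • constCLM (X₀ z.2)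

/-- Solve the linearized equation of periodic orbits with given remainder. -/
noncomputable def solveLin (X₀ : P →L[ℂ] V) (Q : V →L[ℂ] P) (g : C(Cir, V)) : C(Cir, V) × P :=
  (g - (1 / (2 * (Real.pi : ℂ))) • constCLM (X₀ (Q (primLast g))),
    (Complex.I / (2 * (Real.pi : ℂ))) • Q (primLast g))

theorem solveLin_sub (X₀ : P →L[ℂ] V) (Q : V →L[ℂ] P) (g g' : C(Cir, V)) :
    solveLin X₀ Q g - solveLin X₀ Q g' = solveLin X₀ Q (g - g') := by
  simp only [solveLin, map_sub, smul_sub, Prod.mk_sub_mk]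
  congr 1
  abel

theorem norm_solveLin_le {X₀ : P →L[ℂ] V} {Q : V →L[ℂ] P} {C L : ℝ} (hC : 1 ≤ C) (hL : 1 ≤ L)
    (hX : ‖X₀‖ ≤ C) (hQ : ‖Q‖ ≤ C * L) (g : C(Cir, V)) :
    ‖solveLin X₀ Q g‖ ≤ 2 * C ^ 2 * L * ‖g‖ := by
  have hpi := Real.two_pi_pos
  have hg := norm_primLast_le g
  have hpi' : ‖2 * (Real.pi : ℂ)‖ = 2 * Real.pi := by
    simp [abs_of_pos Real.pi_pos]
  have h1 : ‖Q (primLast g)‖ ≤ C * L * (2 * Real.pi * ‖g‖) :=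
    (Q.le_opNorm _).trans (by gcongr)
  have h2 : ‖constCLM (X₀ (Q (primLast g)))‖ ≤ C * (C * L * (2 * Real.pi * ‖g‖)) :=
    (norm_constCLM_le _).trans ((X₀.le_opNorm _).trans (by gcongr))
  have hCL : 1 ≤ C * L := by nlinarith
  have hCL2 : C * L ≤ C ^ 2 * L := by nlinarith
  have hg0 := norm_nonneg g
  rw [solveLin, Prod.norm_def]
  refine max_le ?_ ?_
  · refine (norm_sub_le _ _).trans ?_
    rw [norm_smul, norm_div, hpi', norm_one]
    have h3 : 1 / (2 * Real.pi) * ‖constCLM (X₀ (Q (primLast g)))‖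
        ≤ 1 / (2 * Real.pi) * (C * (C * L * (2 * Real.pi * ‖g‖))) := by gcongr
    have h4 : 1 / (2 * Real.pi) * (C * (C * L * (2 * Real.pi * ‖g‖))) = C ^ 2 * L * ‖g‖ := by
      field_simp
    have h5 : 1 * ‖g‖ ≤ C ^ 2 * L * ‖g‖ := by gcongr; linarith
    linarith
  · rw [norm_smul, norm_div, hpi', Complex.norm_I]
    have h3 : 1 / (2 * Real.pi) * ‖Q (primLast g)‖
        ≤ 1 / (2 * Real.pi) * (C * L * (2 * Real.pi * ‖g‖)) := by gcongr
    have h4 : 1 / (2 * Real.pi) * (C * L * (2 * Real.pi * ‖g‖)) = C * L * ‖g‖ := by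
      field_simp
    have h5 : C * L * ‖g‖ ≤ C ^ 2 * L * ‖g‖ := by gcongr
    have h6 : 0 ≤ C ^ 2 * L * ‖g‖ := by positivity
    linarith

/-- The values at a point `x` of the vector fields `X`, of their differentials `X'`, of the first
integrals (`f₁`, `f₂`) and of approximate symmetry `D`, with quantitative bounds. -/
structure PointData (x : V) (C L η : ℝ) where
  /-- the vector fields -/
  X₀ : P →L[ℂ] V
  /-- the differential of the vector fields -/
  X' : V →L[ℂ] P →L[ℂ] V
  /-- the linear symmetry -/
  D : V →L[ℂ] V
  /-- the left inverse of the vector fields -/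
  Q : V →L[ℂ] P
  /-- the right inverse of the differential of the first integrals -/
  R : G →L[ℂ] V
  /-- the differential of the first integrals -/
  f₁ : V →L[ℂ] G
  /-- the second differential of the first integrals -/
  f₂ : V →L[ℂ] V →L[ℂ] G
  hC : 1 ≤ C
  hL : 1 ≤ L
  hη : 0 ≤ η
  hx : ‖x‖ ≤ 1
  hX₀ : ‖X₀‖ ≤ C
  hX' : ‖X'‖ ≤ C
  hD : ‖D‖ ≤ C
  hf₁ : ‖f₁‖ ≤ C
  hf₂ : ‖f₂‖ ≤ C
  hQ : ‖Q‖ ≤ C * L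
  hR : ‖R‖ ≤ C * L
  hQX : ∀ β, Q (X₀ β) = β
  hXQ : ∀ u, X₀ (Q u) + R (f₁ u) = u
  hfX : ∀ β, f₁ (X₀ β) = 0
  hfX' : ∀ u β, f₂ u (X₀ β) + f₁ (X' u β) = 0
  hcomm : ∀ β β', X' (X₀ β) β' = X' (X₀ β') β
  hDX : ∀ β, ‖X' (D x) β - D (X₀ β)‖ ≤ η * ‖β‖
  hfD : ‖f₁ (D x)‖ ≤ η
  hfD' : ∀ u, ‖f₂ u (D x) + f₁ (D u)‖ ≤ η * ‖u‖

namespace PointData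

variable {x : V} {C L η : ℝ} (S : PointData (P := P) (G := G) x C L η)

/-- The first approximation of the parameter. -/
def b : P := S.Q (S.D x)

/-- The linearized velocity. -/
noncomputable def A : V →L[ℂ] V := lin S.X' S.D S.b

theorem A_apply (u : V) : S.A u = Complex.I • (S.X' u S.b - S.D u) := rfl

theorem norm_D_x_le : ‖S.D x‖ ≤ C := by
  have hC := S.hC
  calc ‖S.D x‖ ≤ C * 1 := S.D.le_of_opNorm_le_of_le S.hD S.hx
    _ = C := mul_one C

theorem norm_b_le : ‖S.b‖ ≤ C ^ 2 * L :=
  (S.Q.le_of_opNorm_le_of_le S.hQ S.norm_D_x_le).trans_eq (by ring)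

theorem norm_A_apply_le (u : V) : ‖S.A u‖ ≤ 2 * C ^ 3 * L * ‖u‖ := by
  have hC := S.hC
  have hL := S.hL
  rw [A_apply, norm_smul, Complex.norm_I, one_mul]
  refine (norm_sub_le _ _).trans ?_
  have h1 : ‖S.X' u S.b‖ ≤ C * ‖u‖ * (C ^ 2 * L) :=
    (S.X' u).le_of_opNorm_le_of_le (S.X'.le_of_opNorm_le S.hX' u) S.norm_b_le
  have h2 : ‖S.D u‖ ≤ C * ‖u‖ := S.D.le_of_opNorm_le S.hD u
  have h3 : C * ‖u‖ ≤ C * ‖u‖ * (C ^ 2 * L) :=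
    le_mul_of_one_le_right (by positivity) (by nlinarith [mul_self_nonneg (C - 1)])
  linarith

theorem norm_defect_le : ‖S.X₀ S.b - S.D x‖ ≤ C * L * η := by
  have h : S.X₀ S.b - S.D x = - S.R (S.f₁ (S.D x)) := by
    rw [sub_eq_iff_eq_add, neg_add_eq_sub, eq_sub_iff_add_eq]
    exact S.hXQ _
  rw [h, norm_neg]
  exact S.R.le_of_opNorm_le_of_le S.hR S.hfD

theorem norm_A_X_le (β : P) : ‖S.A (S.X₀ β)‖ ≤ 2 * C ^ 2 * L * η * ‖β‖ := by
  have hC := S.hC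
  have hL := S.hL
  have hη := S.hη
  have h : S.A (S.X₀ β) = Complex.I • (S.X' (S.X₀ S.b - S.D x) β +
      (S.X' (S.D x) β - S.D (S.X₀ β))) := by
    rw [A_apply, S.hcomm]
    simp
  rw [h, norm_smul, Complex.norm_I, one_mul]
  refine (norm_add_le _ _).trans ?_
  have h1 : ‖S.X' (S.X₀ S.b - S.D x) β‖ ≤ C * (C * L * η) * ‖β‖ :=
    (S.X' _).le_of_opNorm_le (S.X'.le_of_opNorm_le_of_le S.hX' S.norm_defect_le) β
  have h2 := S.hDX β
  have h3 : 1 * (η * ‖β‖) ≤ C ^ 2 * L * (η * ‖β‖) := by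
    gcongr
    nlinarith [mul_self_nonneg (C - 1)]
  linarith

theorem norm_f_A_le (u : V) : ‖S.f₁ (S.A u)‖ ≤ 2 * C ^ 2 * L * η * ‖u‖ := by
  have hC := S.hC
  have hL := S.hL
  have hη := S.hη
  have h : S.f₁ (S.A u) = - Complex.I • (S.f₂ u (S.X₀ S.b - S.D x) +
      (S.f₂ u (S.D x) + S.f₁ (S.D u))) := by
    have h0 : S.f₁ (S.X' u S.b) = - S.f₂ u (S.X₀ S.b) := by
      rw [eq_neg_iff_add_eq_zero, add_comm]
      exact S.hfX' _ _
    rw [A_apply, map_smul, map_sub, h0, map_sub, neg_smul, ← smul_neg]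
    congr 1
    abel
  rw [h, norm_smul, norm_neg, Complex.norm_I, one_mul]
  refine (norm_add_le _ _).trans ?_
  have h1 : ‖S.f₂ u (S.X₀ S.b - S.D x)‖ ≤ C * ‖u‖ * (C * L * η) :=
    (S.f₂ u).le_of_opNorm_le_of_le (S.f₂.le_of_opNorm_le S.hf₂ u) S.norm_defect_le
  have h2 := S.hfD' u
  have h3 : 1 * (η * ‖u‖) ≤ C ^ 2 * L * (η * ‖u‖) := by
    gcongr
    nlinarith [mul_self_nonneg (C - 1)]
  linarith

theorem norm_A_A_le (u : V) : ‖S.A (S.A u)‖ ≤ 8 * C ^ 6 * L ^ 3 * η * ‖u‖ := by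
  have hC := S.hC
  have hL := S.hL
  have hη := S.hη
  rw [← S.hXQ (S.A u), map_add]
  refine (norm_add_le _ _).trans ?_
  have h1 : ‖S.A (S.X₀ (S.Q (S.A u)))‖
      ≤ 2 * C ^ 2 * L * η * (C * L * (2 * C ^ 3 * L * ‖u‖)) :=
    (S.norm_A_X_le _).trans (by
      gcongr
      exact S.Q.le_of_opNorm_le_of_le S.hQ (S.norm_A_apply_le u))
  have h2 : ‖S.A (S.R (S.f₁ (S.A u)))‖
      ≤ 2 * C ^ 3 * L * (C * L * (2 * C ^ 2 * L * η * ‖u‖)) :=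
    (S.norm_A_apply_le _).trans (by
      gcongr
      exact S.R.le_of_opNorm_le_of_le S.hR (S.norm_f_A_le u))
  calc _ ≤ _ := add_le_add h1 h2
    _ = 8 * C ^ 6 * L ^ 3 * η * ‖u‖ := by ring

end PointData

end Static
section Static

set_option linter.unusedSectionVars false

variable {V P G : Type*} [NormedAddCommGroup V] [NormedSpace ℂ V] [CompleteSpace V]
  [NormedAddCommGroup P] [NormedSpace ℂ P] [CompleteSpace P]
  [NormedAddCommGroup G] [NormedSpace ℂ G]

theorem norm_post_le_of {A : V →L[ℂ] V} {c : ℝ} (hc : 0 ≤ c) (h : ∀ u, ‖A u‖ ≤ c * ‖u‖)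
    (g : C(Cir, V)) : ‖post A g‖ ≤ c * ‖g‖ :=
  (norm_post_le A g).trans (by gcongr; exact A.opNorm_le_bound hc h)

theorem norm_prim_le_seven (ω : C(Cir, V)) : ‖prim ω‖ ≤ 7 * ‖ω‖ :=
  (norm_prim_le ω).trans (by gcongr; nlinarith [Real.pi_lt_d2])

namespace PointData

variable {x : V} {C L η : ℝ} (S : PointData (P := P) (G := G) x C L η)
  {Y : Cir → V → P →L[ℂ] V} {ε r : ℝ}

/-- The contraction whose fixed point is the orbit of the toric action through `x`. -/
noncomputable def contr (Y : Cir → V → P →L[ℂ] V) (z : C(Cir, V) × P) : C(Cir, V) × P :=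
  solveLin S.X₀ S.Q (velRem Y S.D S.A S.X₀ x S.b z)

theorem norm_contr_zero_le (hr : ‖x‖ < r)
    (hc : ∀ u : C(Cir, V), ‖u‖ < r → Continuous fun θ => Y θ (u θ))
    (hY : ∀ θ, ‖Y θ x - S.X₀‖ ≤ η) :
    ‖S.contr Y 0‖ ≤ 60 * C ^ 7 * L ^ 3 * η := by
  have hC := S.hC
  have hL := S.hL
  have hη := S.hη
  have hF : ‖vel Y S.D x S.b 0‖ ≤ 2 * C ^ 2 * L * η := by
    refine (ContinuousMap.norm_le _ (by positivity)).2 fun θ => ?_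
    have hx : ‖constCLM x‖ < r := (norm_constCLM_le x).trans_lt hr
    have h1 : vel Y S.D x S.b 0 θ =
        Complex.I • ((Y θ x - S.X₀) S.b + (S.X₀ S.b - S.D x)) := by
      simp [vel, nem_apply (hc _ hx)]
    rw [h1, norm_smul, Complex.norm_I, one_mul]
    refine (norm_add_le _ _).trans ?_
    have h2 : ‖(Y θ x - S.X₀) S.b‖ ≤ η * (C ^ 2 * L) :=
      (Y θ x - S.X₀).le_of_opNorm_le_of_le (hY θ) S.norm_b_le
    have h3 := S.norm_defect_le
    have h4 : C * L * η ≤ C ^ 2 * L * η := by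
      gcongr
      nlinarith
    linarith
  have hg : ‖velRem Y S.D S.A S.X₀ x S.b 0‖ ≤ 30 * C ^ 5 * L ^ 2 * η := by
    have h1 : velRem Y S.D S.A S.X₀ x S.b 0 =
        vel Y S.D x S.b 0 + post S.A (prim (vel Y S.D x S.b 0)) := by
      have h0 : (constCLM (0 : V)) = 0 := map_zero _
      simp [velRem, h0]
    rw [h1]
    refine (norm_add_le _ _).trans ?_
    have h2 : ‖post S.A (prim (vel Y S.D x S.b 0))‖ ≤
        2 * C ^ 3 * L * (7 * (2 * C ^ 2 * L * η)) :=
      (norm_post_le_of (by positivity) S.norm_A_apply_le _).trans (by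
        gcongr
        exact (norm_prim_le_seven _).trans (by gcongr))
    have h3 : 2 * C ^ 2 * L * η * 1 ≤ 2 * C ^ 2 * L * η * (C ^ 3 * L) := by
      gcongr
      nlinarith [one_le_pow₀ hC (n := 3)]
    nlinarith
  refine (norm_solveLin_le hC hL S.hX₀ S.hQ _).trans ?_
  calc _ ≤ 2 * C ^ 2 * L * (30 * C ^ 5 * L ^ 2 * η) := by gcongr
    _ = _ := by ring

set_option maxHeartbeats 800000 in
theorem norm_contr_sub_le (hε : 0 ≤ ε) (hr : ‖x‖ + 7 * ε < r)
    (hc : ∀ u : C(Cir, V), ‖u‖ < r → Continuous fun θ => Y θ (u θ))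
    (hY : ∀ θ, ‖Y θ x - S.X₀‖ ≤ η)
    (hYl : ∀ θ y z, ‖y‖ < r → ‖z‖ < r → ‖Y θ y - Y θ z‖ ≤ C * ‖y - z‖)
    (hYq : ∀ θ y z, ‖y‖ < r → ‖z‖ < r → ‖Y θ y - Y θ z - S.X' (y - z)‖ ≤
      C * (‖y - x‖ + ‖z - x‖ + η) * ‖y - z‖)
    {z₁ z₂ : C(Cir, V) × P} (h₁ : ‖z₁‖ ≤ ε) (h₂ : ‖z₂‖ ≤ ε) :
    ‖S.contr Y z₁ - S.contr Y z₂‖ ≤ 5000 * C ^ 8 * (L ^ 3 * ε + L ^ 4 * η) * ‖z₁ - z₂‖ := by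
  have hC := S.hC
  have hL := S.hL
  have hη := S.hη
  set δ := ‖z₁ - z₂‖ with hδ
  have hδ0 : 0 ≤ δ := norm_nonneg _
  have hz1 : ‖z₁.1 - z₂.1‖ ≤ δ := norm_fst_le (z₁ - z₂)
  have hz2 : ‖z₁.2 - z₂.2‖ ≤ δ := norm_snd_le (z₁ - z₂)
  set w₁ := constCLM x + prim z₁.1 with hw₁
  set w₂ := constCLM x + prim z₂.1 with hw₂
  set δu := prim (z₁.1 - z₂.1) with hδu
  have hw : w₁ - w₂ = δu := by simp [hw₁, hw₂, hδu]
  have hδu' : ‖δu‖ ≤ 7 * δ := (norm_prim_le_seven _).trans (by gcongr)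
  have hp : ∀ z : C(Cir, V) × P, ‖z‖ ≤ ε → ‖prim z.1‖ ≤ 7 * ε := fun z hz =>
    (norm_prim_le_seven _).trans (by gcongr; exact (norm_fst_le z).trans hz)
  have hwr : ∀ z : C(Cir, V) × P, ‖z‖ ≤ ε → ‖constCLM x + prim z.1‖ < r := fun z hz =>
    (norm_add_le _ _).trans_lt (by linarith [norm_constCLM_le x, hp z hz])
  have hw₁r : ‖w₁‖ < r := hwr _ h₁
  have hw₂r : ‖w₂‖ < r := hwr _ h₂
  set err : C(Cir, V) := vel Y S.D x S.b z₁ - vel Y S.D x S.b z₂ - post S.A δu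
    - Complex.I • constCLM (S.X₀ (z₁.2 - z₂.2)) with herr
  have herrn : ‖err‖ ≤ 113 * C ^ 3 * L * (ε + η) * δ := by
    refine (ContinuousMap.norm_le _ (by positivity)).2 fun θ => ?_
    have e1 : err θ = Complex.I • ((Y θ (w₁ θ) - Y θ (w₂ θ) - S.X' (w₁ θ - w₂ θ)) S.b
        + (Y θ (w₁ θ) - Y θ (w₂ θ)) z₁.2 + (Y θ (w₂ θ) - S.X₀) (z₁.2 - z₂.2)) := by
      have hwθ : δu θ = w₁ θ - w₂ θ := by rw [← hw]; rfl
      simp only [herr, vel, ContinuousMap.sub_apply, ContinuousMap.smul_apply, post_apply,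
        nem_apply (hc _ hw₁r), nem_apply (hc _ hw₂r), ← hw₁, ← hw₂,
        constCLM_apply, hwθ, A_apply, ← smul_sub]
      congr 1
      rw [ContinuousLinearMap.apply_apply, ContinuousLinearMap.apply_apply]
      simp only [map_add, map_sub, _root_.sub_apply]
      abel
    have b1 : ∀ z : C(Cir, V) × P, ‖z‖ ≤ ε → ‖(constCLM x + prim z.1) θ - x‖ ≤ 7 * ε := by
      intro z hz
      have : (constCLM x + prim z.1) θ - x = prim z.1 θ := by simp
      rw [this]
      exact ((prim z.1).norm_coe_le_norm θ).trans (hp z hz)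
    have b2 : ‖w₁ θ - w₂ θ‖ ≤ 7 * δ := by
      have : w₁ θ - w₂ θ = δu θ := by rw [← hw]; rfl
      rw [this]
      exact (δu.norm_coe_le_norm θ).trans hδu'
    have b1' : ‖w₁ θ - x‖ ≤ 7 * ε := b1 z₁ h₁
    have b1'' : ‖w₂ θ - x‖ ≤ 7 * ε := b1 z₂ h₂
    have r1 : ‖w₁ θ‖ < r := (w₁.norm_coe_le_norm θ).trans_lt hw₁r
    have r2 : ‖w₂ θ‖ < r := (w₂.norm_coe_le_norm θ).trans_lt hw₂r
    have t1 : ‖(Y θ (w₁ θ) - Y θ (w₂ θ) - S.X' (w₁ θ - w₂ θ)) S.b‖ ≤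
        C * (7 * ε + 7 * ε + η) * (7 * δ) * (C ^ 2 * L) :=
      ContinuousLinearMap.le_of_opNorm_le_of_le _ ((hYq θ _ _ r1 r2).trans (by gcongr))
        S.norm_b_le
    have t2 : ‖(Y θ (w₁ θ) - Y θ (w₂ θ)) z₁.2‖ ≤ C * (7 * δ) * ε :=
      ContinuousLinearMap.le_of_opNorm_le_of_le _ ((hYl θ _ _ r1 r2).trans (by gcongr))
        ((norm_snd_le z₁).trans h₁)
    have hxr : ‖x‖ < r := by linarith
    have t3 : ‖(Y θ (w₂ θ) - S.X₀) (z₁.2 - z₂.2)‖ ≤ (C * (7 * ε) + η) * δ := by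
      refine ContinuousLinearMap.le_of_opNorm_le_of_le _ ?_ hz2
      have := norm_add_le (Y θ (w₂ θ) - Y θ x) (Y θ x - S.X₀)
      rw [sub_add_sub_cancel] at this
      refine this.trans (add_le_add ((hYl θ _ _ r2 hxr).trans ?_) (hY θ))
      gcongr
    rw [e1, norm_smul, Complex.norm_I, one_mul]
    refine (norm_add₃_le ..).trans ?_
    have hC2 : C ≤ C ^ 3 * L := by
      have : C * 1 ≤ C * (C ^ 2 * L) := by gcongr; nlinarith [one_le_pow₀ hC (n := 2)]
      linarith
    have hC3 : 1 ≤ C ^ 3 * L := hC.trans hC2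
    have u1 : C * (7 * δ) * ε ≤ C ^ 3 * L * (7 * δ) * ε := by gcongr
    have u2 : (C * (7 * ε) + η) * δ ≤ (C ^ 3 * L * (7 * ε) + C ^ 3 * L * η) * δ := by
      gcongr
      nlinarith
    have u3 : 0 ≤ C ^ 3 * L * η * δ := by positivity
    have u4 : 0 ≤ C ^ 3 * L * ε * δ := by positivity
    linarith
  have hgsub : velRem Y S.D S.A S.X₀ x S.b z₁ - velRem Y S.D S.A S.X₀ x S.b z₂ =
      err + post S.A (prim err) + post S.A (post S.A (prim δu))
        + Complex.I • post S.A (prim (constCLM (S.X₀ (z₁.2 - z₂.2)))) := by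
    have e2 : vel Y S.D x S.b z₁ - vel Y S.D x S.b z₂ = err + post S.A δu
      + Complex.I • constCLM (S.X₀ (z₁.2 - z₂.2)) := by rw [herr]; abel
    have e3 : velRem Y S.D S.A S.X₀ x S.b z₁ - velRem Y S.D S.A S.X₀ x S.b z₂ =
        (vel Y S.D x S.b z₁ - vel Y S.D x S.b z₂)
        + post S.A (prim (vel Y S.D x S.b z₁ - vel Y S.D x S.b z₂) - δu)
        - Complex.I • constCLM (S.X₀ (z₁.2 - z₂.2)) := by
      simp only [velRem, hδu, map_sub, smul_sub]
      abel
    rw [e3, e2]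
    simp only [map_add, map_sub, map_smul, prim_post]
    abel
  have hg : ‖velRem Y S.D S.A S.X₀ x S.b z₁ - velRem Y S.D S.A S.X₀ x S.b z₂‖ ≤
      2500 * C ^ 6 * (L ^ 2 * ε + L ^ 3 * η) * δ := by
    rw [hgsub]
    have n1 : ‖post S.A (prim err)‖ ≤ 2 * C ^ 3 * L * (7 * (113 * C ^ 3 * L * (ε + η) * δ)) :=
      (norm_post_le_of (by positivity) S.norm_A_apply_le _).trans (by
        gcongr
        exact (norm_prim_le_seven _).trans (by gcongr))
    have n2 : ‖post S.A (post S.A (prim δu))‖ ≤ 8 * C ^ 6 * L ^ 3 * η * (7 * (7 * δ)) := by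
      have : ∀ θ, post S.A (post S.A (prim δu)) θ = S.A (S.A (prim δu θ)) := fun θ => rfl
      refine (ContinuousMap.norm_le _ (by positivity)).2 fun θ => ?_
      rw [this]
      refine (S.norm_A_A_le _).trans ?_
      gcongr
      refine ((prim δu).norm_coe_le_norm θ).trans ((norm_prim_le_seven _).trans ?_)
      gcongr
    have n3 : ‖Complex.I • post S.A (prim (constCLM (S.X₀ (z₁.2 - z₂.2))))‖ ≤
        7 * (2 * C ^ 2 * L * η * δ) := by
      rw [norm_smul, Complex.norm_I, one_mul, ← prim_post]
      refine (norm_prim_le_seven _).trans ?_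
      gcongr
      refine (ContinuousMap.norm_le _ (by positivity)).2 fun θ => ?_
      rw [post_apply, constCLM_apply]
      exact (S.norm_A_X_le _).trans (by gcongr)
    have m1 : C ^ 3 * L ≤ C ^ 6 * L ^ 2 :=
      mul_le_mul (pow_le_pow_right₀ hC (by norm_num)) (le_self_pow₀ hL (by norm_num))
        (by positivity) (by positivity)
    have m2 : C ^ 2 * L ≤ C ^ 6 * L ^ 3 :=
      mul_le_mul (pow_le_pow_right₀ hC (by norm_num)) (le_self_pow₀ hL (by norm_num))
        (by positivity) (by positivity)
    have m3 : C ^ 6 * L ^ 2 ≤ C ^ 6 * L ^ 3 :=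
      mul_le_mul_of_nonneg_left (pow_le_pow_right₀ hL (by norm_num)) (by positivity)
    have m4 : 113 * (C ^ 3 * L) * (ε + η) * δ ≤ 113 * (C ^ 6 * L ^ 2) * (ε + η) * δ := by gcongr
    have m5 : (C ^ 6 * L ^ 2) * η * δ ≤ (C ^ 6 * L ^ 3) * η * δ := by gcongr
    have m6 : C ^ 2 * L * η * δ ≤ C ^ 6 * L ^ 3 * η * δ := by gcongr
    have m7 : 0 ≤ C ^ 6 * L ^ 2 * ε * δ := by positivity
    have m8 : 0 ≤ C ^ 6 * L ^ 3 * η * δ := by positivity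
    refine (norm_add_le _ _).trans ?_
    have := norm_add₃_le (a := err) (b := post S.A (prim err)) (c := post S.A (post S.A (prim δu)))
    linarith
  rw [contr, contr, solveLin_sub]
  refine (norm_solveLin_le hC hL S.hX₀ S.hQ _).trans ?_
  calc _ ≤ 2 * C ^ 2 * L * (2500 * C ^ 6 * (L ^ 2 * ε + L ^ 3 * η) * δ) := by gcongr
    _ = _ := by ring

/-- An approximate solution of the periodic orbit equation is an approximate fixed point. -/
theorem norm_sub_contr_le {z : C(Cir, V) × P} (hper : primLast z.1 = 0) :
    ‖z - S.contr Y z‖ ≤ 30 * C ^ 5 * L ^ 2 * ‖vel Y S.D x S.b z - z.1‖ := by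
  have hC := S.hC
  have hL := S.hL
  have hpi : (2 * (Real.pi : ℂ)) ≠ 0 := by
    simp [Real.pi_ne_zero]
  set ρ := vel Y S.D x S.b z - z.1 with hρ
  set h := ρ + post S.A (prim ρ) with hh
  have e1 : velRem Y S.D S.A S.X₀ x S.b z = z.1 + h - Complex.I • constCLM (S.X₀ z.2) := by
    rw [velRem, hh, ← map_sub, ← hρ, hρ]
    abel
  have e2 : Q S (primLast (velRem Y S.D S.A S.X₀ x S.b z)) =
      S.Q (primLast h) - (Complex.I * (2 * Real.pi)) • z.2 := by
    rw [e1]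
    simp only [map_sub, map_add, map_smul, hper, primLast_constCLM, S.hQX, zero_add, smul_smul]
  have e3 : S.contr Y z = z + solveLin S.X₀ S.Q h := by
    rw [contr, solveLin, e2, e1, solveLin]
    refine Prod.ext ?_ ?_
    · simp only [Prod.fst_add, map_sub, map_smul, smul_sub, smul_smul]
      have : 1 / (2 * (Real.pi : ℂ)) * (Complex.I * (2 * Real.pi)) = Complex.I := by
        field_simp
      rw [this]
      abel
    · simp only [Prod.snd_add, smul_sub, smul_smul]
      have : Complex.I / (2 * (Real.pi : ℂ)) * (Complex.I * (2 * Real.pi)) = -1 := by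
        have := Complex.I_mul_I
        field_simp
        simp
      rw [this, neg_one_smul]
      abel
  have e4 : z - S.contr Y z = - solveLin S.X₀ S.Q h := by rw [e3]; abel
  rw [e4, norm_neg]
  have hhn : ‖h‖ ≤ 15 * C ^ 3 * L * ‖ρ‖ := by
    refine (norm_add_le _ _).trans ?_
    have n1 : ‖post S.A (prim ρ)‖ ≤ 2 * C ^ 3 * L * (7 * ‖ρ‖) :=
      (norm_post_le_of (by positivity) S.norm_A_apply_le _).trans (by
        gcongr
        exact norm_prim_le_seven _)
    have n2 : 1 * ‖ρ‖ ≤ C ^ 3 * L * ‖ρ‖ := by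
      gcongr
      nlinarith [one_le_pow₀ hC (n := 3)]
    linarith
  refine (norm_solveLin_le hC hL S.hX₀ S.hQ _).trans ?_
  calc _ ≤ 2 * C ^ 2 * L * (15 * C ^ 3 * L * ‖ρ‖) := by gcongr
    _ = _ := by ring

end PointData

end Static
section Bilinear

variable {E F G H : Type*} [NormedAddCommGroup E] [NormedSpace ℂ E]
  [NormedAddCommGroup F] [NormedSpace ℂ F] [NormedAddCommGroup G] [NormedSpace ℂ G]
  [NormedAddCommGroup H] [NormedSpace ℂ H]

theorem analyticAt_clm_apply {A : E → F →L[ℂ] G} {u : E → F} {x : E} (hA : AnalyticAt ℂ A x)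
    (hu : AnalyticAt ℂ u x) : AnalyticAt ℂ (fun y => A y (u y)) x :=
  AnalyticAt.comp (g := fun p : (F →L[ℂ] G) × F => p.1 p.2) (f := fun y => (A y, u y))
    ((ContinuousLinearMap.id ℂ (F →L[ℂ] G)).analyticAt_bilinear (A x, u x)) (hA.prod hu)

theorem analyticAt_clm_comp {A : E → G →L[ℂ] H} {B : E → F →L[ℂ] G} {x : E}
    (hA : AnalyticAt ℂ A x) (hB : AnalyticAt ℂ B x) :
    AnalyticAt ℂ (fun y => (A y).comp (B y)) x :=
  AnalyticAt.comp (g := fun p : (G →L[ℂ] H) × (F →L[ℂ] G) => p.1.comp p.2)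
    (f := fun y => (A y, B y))
    ((ContinuousLinearMap.compL ℂ F G H).analyticAt_bilinear (A x, B x)) (hA.prod hB)

end Bilinear

section Core

set_option linter.unusedSectionVars false

variable {V P G : Type*} [NormedAddCommGroup V] [NormedSpace ℂ V] [CompleteSpace V]
  [NormedAddCommGroup P] [NormedSpace ℂ P] [CompleteSpace P]
  [NormedAddCommGroup G] [NormedSpace ℂ G] [CompleteSpace G]

theorem differentiableAt_solveLin {X₀ : ℂ → P →L[ℂ] V} {Q : ℂ → V →L[ℂ] P} {g : ℂ → C(Cir, V)}
    {t : ℂ} (hX : DifferentiableAt ℂ X₀ t) (hQ : DifferentiableAt ℂ Q t)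
    (hg : DifferentiableAt ℂ g t) : DifferentiableAt ℂ (fun t => solveLin (X₀ t) (Q t) (g t)) t := by
  unfold solveLin
  fun_prop

theorem differentiableAt_vel {Y : Cir → V → P →L[ℂ] V} {r C : ℝ}
    (hc : ∀ u : C(Cir, V), ‖u‖ < r → Continuous fun θ => Y θ (u θ))
    (hc' : ∀ u : C(Cir, V), ‖u‖ < r → Continuous fun θ => fderiv ℂ (Y θ) (u θ))
    (hq : ∀ θ x y, ‖x‖ < r → ‖y‖ < r →
      ‖Y θ y - Y θ x - fderiv ℂ (Y θ) x (y - x)‖ ≤ C * ‖y - x‖ ^ 2)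
    {D : V →L[ℂ] V} {x : ℂ → V} {b : ℂ → P} {z : ℂ → C(Cir, V) × P} {t : ℂ}
    (hx : DifferentiableAt ℂ x t) (hb : DifferentiableAt ℂ b t) (hz : DifferentiableAt ℂ z t)
    (hr : ‖constCLM (x t) + prim (z t).1‖ < r) :
    DifferentiableAt ℂ (fun t => vel Y D (x t) (b t) (z t)) t := by
  have h1 : DifferentiableAt ℂ (fun t => constCLM (x t) + prim (z t).1) t := by fun_prop
  have h2 : DifferentiableAt ℂ (fun t => nem Y (constCLM (x t) + prim (z t).1)) t :=
    DifferentiableAt.comp t (g := nem Y) (f := fun t => constCLM (x t) + prim (z t).1)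
      (differentiableAt_nem hc hc' hq hr) h1
  have h3 : DifferentiableAt ℂ (fun t => ContinuousLinearMap.apply ℂ V (b t + (z t).2)) t :=
    DifferentiableAt.comp t (g := ContinuousLinearMap.apply ℂ V) (f := fun t => b t + (z t).2)
      (ContinuousLinearMap.differentiableAt _) (by fun_prop)
  unfold vel
  fun_prop

theorem differentiableAt_velRem {Y : Cir → V → P →L[ℂ] V}
    {D : V →L[ℂ] V} {A : ℂ → V →L[ℂ] V} {X₀ : ℂ → P →L[ℂ] V} {x : ℂ → V} {b : ℂ → P}
    {z : ℂ → C(Cir, V) × P} {t : ℂ}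
    (hv : DifferentiableAt ℂ (fun t => vel Y D (x t) (b t) (z t)) t)
    (hA : DifferentiableAt ℂ A t) (hX : DifferentiableAt ℂ X₀ t) (hz : DifferentiableAt ℂ z t) :
    DifferentiableAt ℂ (fun t => velRem Y D (A t) (X₀ t) (x t) (b t) (z t)) t := by
  unfold velRem
  fun_prop

theorem differentiableAt_lin {X' : ℂ → V →L[ℂ] P →L[ℂ] V} {D : V →L[ℂ] V} {b : ℂ → P} {t : ℂ}
    (hX : DifferentiableAt ℂ X' t) (hb : DifferentiableAt ℂ b t) :
    DifferentiableAt ℂ (fun t => lin (X' t) D (b t)) t := by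
  have h3 : DifferentiableAt ℂ (fun t => ContinuousLinearMap.apply ℂ V (b t)) t :=
    DifferentiableAt.comp t (g := ContinuousLinearMap.apply ℂ V) (f := b)
      (ContinuousLinearMap.differentiableAt _) hb
  unfold lin
  have h4 := h3.clm_comp hX
  exact (h4.sub_const D).const_smul Complex.I

variable (V P G) in
/-- Commuting vector fields with first integrals, a rational splitting, and a linear vector
field `D` which commutes with everything up to order `M`; `Y` is the family of the rotated vector
fields. -/
structure CoreData (M : ℕ) where
  /-- the vector fields -/
  X : V → P →L[ℂ] V
  /-- the first integrals -/
  f : V → G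
  /-- the linear symmetry -/
  D : V →L[ℂ] V
  /-- the numerator of the left inverse of the vector fields -/
  Qh : V → V →L[ℂ] P
  /-- the numerator of the right inverse of the differential of the first integrals -/
  R : V → G →L[ℂ] V
  /-- the common denominator -/
  Δ : V → ℂ
  /-- the rotated vector fields -/
  Y : Cir → V → P →L[ℂ] V
  /-- the radius of validity of the bounds on `Y` -/
  r : ℝ
  /-- the constant in the bounds on `Y` -/
  K : ℝ
  hX : AnalyticAt ℂ X 0
  hf : AnalyticAt ℂ f 0
  hQh : AnalyticAt ℂ Qh 0
  hR : AnalyticAt ℂ R 0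
  hΔ : AnalyticAt ℂ Δ 0
  hQX : ∀ᶠ x in 𝓝 0, ∀ β, Qh x (X x β) = Δ x • β
  hXQ : ∀ᶠ x in 𝓝 0, ∀ u, X x (Qh x u) + R x (fderiv ℂ f x u) = Δ x • u
  hfX : ∀ᶠ x in 𝓝 0, ∀ β, fderiv ℂ f x (X x β) = 0
  hcomm : ∀ᶠ x in 𝓝 0, ∀ β β', fderiv ℂ X x (X x β) β' = fderiv ℂ X x (X x β') β
  hDX : (fun x => fderiv ℂ X x (D x) - D.comp (X x)) =O[𝓝 0] fun x => ‖x‖ ^ M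
  hfD : (fun x => fderiv ℂ f x (D x)) =O[𝓝 0] fun x => ‖x‖ ^ (M + 1)
  hr : 0 < r
  hYc : ∀ u : C(Cir, V), ‖u‖ < r → Continuous fun θ => Y θ (u θ)
  hYc' : ∀ u : C(Cir, V), ‖u‖ < r → Continuous fun θ => fderiv ℂ (Y θ) (u θ)
  hYl : ∀ θ y z, ‖y‖ < r → ‖z‖ < r → ‖Y θ y - Y θ z‖ ≤ K * ‖y - z‖
  hYq : ∀ θ x y z, ‖x‖ < r → ‖y‖ < r → ‖z‖ < r →
    ‖Y θ y - Y θ z - fderiv ℂ (Y θ) x (y - z)‖ ≤ K * (‖y - x‖ + ‖z - x‖) * ‖y - z‖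
  hYX : ∀ θ x, ‖x‖ < r → ‖Y θ x - X x‖ ≤ K * ‖x‖ ^ M
  hYX' : ∀ θ x, ‖x‖ < r → ‖fderiv ℂ (Y θ) x - fderiv ℂ X x‖ ≤ K * ‖x‖ ^ M

namespace CoreData

variable {M : ℕ} (S : CoreData V P G M)

theorem eventually_hfX' : ∀ᶠ x in 𝓝 (0 : V), ∀ u β,
    fderiv ℂ (fderiv ℂ S.f) x u (S.X x β) + fderiv ℂ S.f x (fderiv ℂ S.X x u β) = 0 := by
  filter_upwards [S.hfX.eventually_nhds, S.hf.fderiv.eventually_analyticAt,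
    S.hX.eventually_analyticAt] with x h1 h2 h3 u β
  have h4 : HasFDerivAt (fun y => S.X y β)
      ((fderiv ℂ S.X x).flip β) x := by
    simpa using h3.differentiableAt.hasFDerivAt.clm_apply (hasFDerivAt_const β x)
  have h5 := h2.differentiableAt.hasFDerivAt.clm_apply h4
  have h6 : (fun y => fderiv ℂ S.f y (S.X y β)) =ᶠ[𝓝 x] fun _ => 0 := by
    filter_upwards [h1] with y hy using hy β
  have h7 := congrArg (fun L => L u) (h5.unique ((hasFDerivAt_const 0 x).congr_of_eventuallyEq h6))
  simp only [_root_.add_apply, ContinuousLinearMap.comp_apply,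
    ContinuousLinearMap.flip_apply, _root_.zero_apply] at h7
  rw [add_comm]
  exact h7

theorem isBigO_hfD' : (fun x => (fderiv ℂ (fderiv ℂ S.f) x).flip (S.D x)
      + (fderiv ℂ S.f x).comp S.D) =O[𝓝 0] fun x => ‖x‖ ^ M := by
  have h := fderiv_isBigO_pow (f := fun x => fderiv ℂ S.f x (S.D x))
    (analyticAt_clm_apply S.hf.fderiv (S.D.analyticAt 0)) S.hfD
  refine h.congr' ?_ EventuallyEq.rfl
  filter_upwards [S.hf.fderiv.eventually_analyticAt] with x h2
  have h5 := h2.differentiableAt.hasFDerivAt.clm_apply (S.D.hasFDerivAt (x := x))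
  rw [h5.fderiv, add_comm]

/-- The first approximation of the parameter. -/
noncomputable def b (x : V) : P := (S.Δ x)⁻¹ • S.Qh x (S.D x)

theorem exists_pointData (d : ℕ) {v : V} {c : ℝ} (hc : 0 < c)
    (hv : ∀ᶠ t : ℂ in 𝓝 0, c * ‖t‖ ^ d ≤ ‖S.Δ (t • v)‖) : ∃ C K₁ : ℝ, 1 ≤ C ∧ 0 ≤ K₁ ∧ S.K ≤ C ∧
    (∀ᶠ t : ℂ in 𝓝[≠] 0, ∃ T : PointData (P := P) (G := G) (t • v) C ((‖t‖ ^ d)⁻¹) (K₁ * ‖t‖ ^ M),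
      T.X₀ = S.X (t • v) ∧ T.X' = fderiv ℂ S.X (t • v) ∧ T.D = S.D ∧
      T.Q = (S.Δ (t • v))⁻¹ • S.Qh (t • v) ∧ S.K * ‖t • v‖ ^ M ≤ K₁ * ‖t‖ ^ M) := by
  obtain ⟨r₁, hr₁, C₁, hC₁, -, b1, b1', -⟩ := exists_ball_bounds S.hX
  obtain ⟨r₂, hr₂, C₂, hC₂, -, b2, b2', -⟩ := exists_ball_bounds S.hf.fderiv
  obtain ⟨r₃, hr₃, C₃, hC₃, -, b3, -⟩ := exists_ball_bounds S.hQh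
  obtain ⟨r₄, hr₄, C₄, hC₄, -, b4, -⟩ := exists_ball_bounds S.hR
  obtain ⟨K₂, hK₂, hDX⟩ := S.hDX.exists_pos
  obtain ⟨K₃, hK₃, hfD⟩ := S.hfD.exists_pos
  obtain ⟨K₄, hK₄, hfD'⟩ := S.isBigO_hfD'.exists_pos
  rw [isBigOWith_iff] at hDX hfD hfD'
  have hSK : 0 ≤ |S.K| := abs_nonneg _
  have hc' : 0 ≤ c⁻¹ := by positivity
  have hD := norm_nonneg S.D
  set C := 1 + C₁ + C₂ + C₃ * c⁻¹ + C₄ * c⁻¹ + ‖S.D‖ + |S.K| with hCdef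
  have hC3 : 0 ≤ C₃ * c⁻¹ := by positivity
  have hC4 : 0 ≤ C₄ * c⁻¹ := by positivity
  have hball : ∀ {ρ : ℝ}, 0 < ρ → ∀ᶠ x : V in 𝓝 0, x ∈ Metric.ball 0 ρ := fun h =>
    Metric.ball_mem_nhds _ h
  have hev : ∀ᶠ x : V in 𝓝 0, _ := (hball hr₁).and <| (hball hr₂).and <| (hball hr₃).and <|
    (hball hr₄).and <| hDX.and <| hfD.and <| hfD'.and <| S.hQX.and <| S.hXQ.and <| S.hfX.and <|
    S.hcomm.and <| S.eventually_hfX'.and <| (hball one_pos)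
  have htend : Tendsto (fun t : ℂ => t • v) (𝓝 0) (𝓝 0) := by
    have : Continuous fun t : ℂ => t • v := by fun_prop
    simpa using this.tendsto 0
  set K₁ := (|S.K| + K₂ + K₃ + K₄) * (‖v‖ ^ M) with hK₁
  have hvM : 0 ≤ ‖v‖ ^ M := by positivity
  refine ⟨C, K₁, by linarith, by positivity, by linarith [le_abs_self S.K], ?_⟩
  filter_upwards [(htend.eventually hev).filter_mono nhdsWithin_le_nhds,
    hv.filter_mono nhdsWithin_le_nhds, self_mem_nhdsWithin,
    mem_nhdsWithin_of_mem_nhds (Metric.ball_mem_nhds (0 : ℂ) one_pos)]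
    with t ⟨x1, x2, x3, x4, y1, y2, y3, q1, q2, q3, q4, q5, x5⟩ hΔ ht0 ht1
  have ht0' : 0 < ‖t‖ := norm_pos_iff.2 ht0
  have ht1' : ‖t‖ < 1 := by simpa using ht1
  have htd : 0 < ‖t‖ ^ d := by positivity
  have hΔpos : 0 < ‖S.Δ (t • v)‖ := lt_of_lt_of_le (by positivity) hΔ
  have hΔ0 : S.Δ (t • v) ≠ 0 := norm_pos_iff.1 hΔpos
  have hΔinv : ‖(S.Δ (t • v))⁻¹‖ ≤ c⁻¹ * (‖t‖ ^ d)⁻¹ := by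
    rw [norm_inv, ← mul_inv]
    gcongr
  have hx1 : ‖t • v‖ < 1 := by simpa using x5
  have hM : ‖t • v‖ ^ M = ‖v‖ ^ M * ‖t‖ ^ M := by rw [norm_smul, mul_pow, mul_comm]
  have htM : 0 ≤ ‖t • v‖ ^ M := by positivity
  have hK : ∀ k, k ≤ |S.K| + K₂ + K₃ + K₄ → k * ‖t • v‖ ^ M ≤ K₁ * ‖t‖ ^ M := by
    intro k hk
    rw [hK₁, mul_assoc, ← hM]
    gcongr
  have hL0 : 0 ≤ (‖t‖ ^ d)⁻¹ := by positivity
  simp only [norm_pow, norm_norm] at y1 y2 y3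
  refine ⟨{ X₀ := S.X (t • v), X' := fderiv ℂ S.X (t • v), D := S.D
            Q := (S.Δ (t • v))⁻¹ • S.Qh (t • v)
            R := (S.Δ (t • v))⁻¹ • S.R (t • v)
            f₁ := fderiv ℂ S.f (t • v)
            f₂ := fderiv ℂ (fderiv ℂ S.f) (t • v)
            hC := by linarith
            hL := (one_le_inv₀ htd).2 (pow_le_one₀ ht0'.le ht1'.le)
            hη := by positivity
            hx := hx1.le
            hX₀ := (b1 _ x1).trans (by linarith)
            hX' := (b1' _ x1).trans (by linarith)
            hD := by linarith
            hf₁ := (b2 _ x2).trans (by linarith)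
            hf₂ := (b2' _ x2).trans (by linarith)
            hQ := ?_, hR := ?_, hQX := ?_, hXQ := ?_
            hfX := q3, hfX' := q5, hcomm := q4
            hDX := ?_, hfD := ?_, hfD' := ?_ }, rfl, rfl, rfl, rfl, hK _ ?_⟩
  · rw [norm_smul]
    calc _ ≤ c⁻¹ * (‖t‖ ^ d)⁻¹ * C₃ := by gcongr; exact b3 _ x3
      _ = (C₃ * c⁻¹) * (‖t‖ ^ d)⁻¹ := by ring
      _ ≤ _ := by gcongr; linarith
  · rw [norm_smul]
    calc _ ≤ c⁻¹ * (‖t‖ ^ d)⁻¹ * C₄ := by gcongr; exact b4 _ x4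
      _ = (C₄ * c⁻¹) * (‖t‖ ^ d)⁻¹ := by ring
      _ ≤ _ := by gcongr; linarith
  · intro β
    simp [q1, smul_smul, hΔ0]
  · intro u
    simp only [_root_.smul_apply, map_smul, ← smul_add, q2, smul_smul]
    simp [hΔ0]
  · intro β
    have := ContinuousLinearMap.le_of_opNorm_le _ (y1.trans (hK K₂ (by linarith))) β
    exact this
  · refine y2.trans (le_trans ?_ (hK K₃ (by linarith)))
    exact mul_le_mul_of_nonneg_left
      (pow_le_pow_of_le_one (norm_nonneg _) hx1.le (Nat.le_succ M)) hK₃.le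
  · intro u
    have := ContinuousLinearMap.le_of_opNorm_le _ (y3.trans (hK K₄ (by linarith))) u
    exact this
  · linarith [le_abs_self S.K]

end CoreData

end Core
section Core

set_option linter.unusedSectionVars false

variable {V P G : Type*} [NormedAddCommGroup V] [NormedSpace ℂ V] [CompleteSpace V]
  [NormedAddCommGroup P] [NormedSpace ℂ P] [CompleteSpace P]
  [NormedAddCommGroup G] [NormedSpace ℂ G] [CompleteSpace G]

namespace CoreData

variable {M : ℕ} (S : CoreData V P G M)

/-- The contraction attached to the point `x`. -/
noncomputable def contr (x : V) (z : C(Cir, V) × P) : C(Cir, V) × P :=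
  solveLin (S.X x) ((S.Δ x)⁻¹ • S.Qh x)
    (velRem S.Y S.D (lin (fderiv ℂ S.X x) S.D (S.b x)) (S.X x) x (S.b x) z)

theorem contr_eq {x : V} {C L η : ℝ} (T : PointData (P := P) (G := G) x C L η)
    (h1 : T.X₀ = S.X x) (h2 : T.X' = fderiv ℂ S.X x) (h3 : T.D = S.D)
    (h4 : T.Q = (S.Δ x)⁻¹ • S.Qh x) : T.contr S.Y = S.contr x := by
  have hb : T.b = S.b x := by
    rw [PointData.b, h4, h3]
    rfl
  ext1 z
  rw [PointData.contr, contr, PointData.A, h1, h2, h3, h4, hb]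

/-- The orbits of the toric action on a complex line depend holomorphically on the point of the
line, and approximate orbits are close to them. -/
theorem exists_orbit (d : ℕ) (hM : 6 * d + 2 ≤ M) {v : V} {c : ℝ} (hc : 0 < c)
    (hv : ∀ᶠ t : ℂ in 𝓝 0, c * ‖t‖ ^ d ≤ ‖S.Δ (t • v)‖) :
    ∃ ρ : ℝ, 0 < ρ ∧ ∃ z : ℂ → C(Cir, V) × P,
      (∀ t ∈ Metric.ball (0 : ℂ) ρ \ {0}, DifferentiableAt ℂ z t) ∧
      (∀ t ∈ Metric.ball (0 : ℂ) ρ \ {0}, ‖z t‖ ≤ ‖t‖ ^ (3 * d + 1)) ∧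
      ∀ (y : ℂ → C(Cir, V) × P) (N : ℕ), (∀ᶠ t : ℂ in 𝓝[≠] 0, ‖y t‖ ≤ ‖t‖ ^ (3 * d + 1)) →
        (∀ᶠ t : ℂ in 𝓝[≠] 0, primLast (y t).1 = 0) →
        ((fun t : ℂ => vel S.Y S.D (t • v) (S.b (t • v)) (y t) - (y t).1) =O[𝓝[≠] 0]
          fun t => ‖t‖ ^ (N + 2 * d)) →
        (fun t : ℂ => y t - z t) =O[𝓝[≠] 0] fun t => ‖t‖ ^ N := by
  obtain ⟨C, K₁, hC, hK₁, hKC, hT⟩ := S.exists_pointData d hc hv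
  have hr := S.hr
  have htend : Tendsto (fun t : ℂ => t • v) (𝓝 0) (𝓝 0) := by
    have : Continuous fun t : ℂ => t • v := by fun_prop
    simpa using this.tendsto 0
  have hsmall : ∀ B : ℝ, ∀ᶠ t : ℂ in 𝓝[≠] 0, ‖t‖ * B < S.r / 2 ∧ ‖t‖ * B < 1 := by
    intro B
    have : Tendsto (fun t : ℂ => ‖t‖ * B) (𝓝 0) (𝓝 0) := by
      have : Continuous fun t : ℂ => ‖t‖ * B := by fun_prop
      simpa using this.tendsto 0
    exact (this.eventually ((gt_mem_nhds (half_pos hr)).and (gt_mem_nhds one_pos))).filter_mono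
      nhdsWithin_le_nhds
  have hΔ : ∀ᶠ t : ℂ in 𝓝[≠] 0, S.Δ (t • v) ≠ 0 := by
    filter_upwards [hv.filter_mono nhdsWithin_le_nhds, self_mem_nhdsWithin] with t h1 h2
    have : 0 < ‖t‖ := norm_pos_iff.2 h2
    exact norm_pos_iff.1 (lt_of_lt_of_le (by positivity) h1)
  have han : ∀ᶠ t : ℂ in 𝓝[≠] 0, AnalyticAt ℂ S.X (t • v) ∧ AnalyticAt ℂ S.Qh (t • v) ∧
      AnalyticAt ℂ S.Δ (t • v) :=
    (htend.eventually (S.hX.eventually_analyticAt.and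
      (S.hQh.eventually_analyticAt.and S.hΔ.eventually_analyticAt))).filter_mono nhdsWithin_le_nhds
  have hall := hT.and <| hΔ.and <| han.and <| (hsmall ‖v‖).and <| (hsmall 7).and <|
    (hsmall (120 * C ^ 7 * K₁)).and <| (hsmall (10000 * C ^ 8 * (1 + K₁)))
  rw [eventually_nhdsWithin_iff, Metric.eventually_nhds_iff_ball] at hall
  obtain ⟨ρ, hρ, hall⟩ := hall
  set Ω := Metric.ball (0 : ℂ) ρ \ {0} with hΩ
  have hΩo : IsOpen Ω := Metric.isOpen_ball.sdiff isClosed_singleton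
  have hΩn : ∀ᶠ t : ℂ in 𝓝[≠] 0, t ∈ Ω :=
    inter_mem (mem_nhdsWithin_of_mem_nhds (Metric.ball_mem_nhds _ hρ)) self_mem_nhdsWithin
  replace hall := fun t (ht : t ∈ Ω) => hall t ht.1 ht.2
  have key : ∀ t ∈ Ω, 0 < ‖t‖ ∧ ‖t‖ < 1 ∧ ‖t • v‖ + 7 * ‖t‖ ^ (3 * d + 1) < S.r ∧
      60 * C ^ 7 * ((‖t‖ ^ d)⁻¹) ^ 3 * (K₁ * ‖t‖ ^ M) ≤ ‖t‖ ^ (3 * d + 1) / 2 ∧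
      5000 * C ^ 8 * (((‖t‖ ^ d)⁻¹) ^ 3 * ‖t‖ ^ (3 * d + 1) +
        ((‖t‖ ^ d)⁻¹) ^ 4 * (K₁ * ‖t‖ ^ M)) ≤ 1 / 2 := by
    intro t ht
    obtain ⟨-, -, -, ⟨s1, -⟩, ⟨s2, s3⟩, ⟨-, s4⟩, -, s5⟩ := hall t ht
    have h0 : 0 < ‖t‖ := norm_pos_iff.2 ht.2
    have h1 : ‖t‖ < 1 := by linarith
    have hp : ∀ k, 1 ≤ k → ‖t‖ ^ k ≤ ‖t‖ := fun k hk =>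
      pow_le_of_le_one h0.le h1.le (by omega)
    obtain ⟨j, rfl⟩ := Nat.exists_eq_add_of_le hM
    refine ⟨h0, h1, ?_, ?_, ?_⟩
    · rw [norm_smul]
      have := hp (3 * d + 1) (by omega)
      linarith
    · have e1 : ((‖t‖ ^ d)⁻¹) ^ 3 * ‖t‖ ^ (6 * d + 2 + j) = ‖t‖ ^ (3 * d + 1) * ‖t‖ ^ (j + 1) := by
        field_simp
        ring
      calc 60 * C ^ 7 * ((‖t‖ ^ d)⁻¹) ^ 3 * (K₁ * ‖t‖ ^ (6 * d + 2 + j))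
          = 60 * C ^ 7 * K₁ * (((‖t‖ ^ d)⁻¹) ^ 3 * ‖t‖ ^ (6 * d + 2 + j)) := by ring
        _ = (‖t‖ ^ (j + 1) * (120 * C ^ 7 * K₁)) / 2 * ‖t‖ ^ (3 * d + 1) := by rw [e1]; ring
        _ ≤ (‖t‖ * (120 * C ^ 7 * K₁)) / 2 * ‖t‖ ^ (3 * d + 1) := by
            gcongr
            exact hp _ (by omega)
        _ ≤ 1 / 2 * ‖t‖ ^ (3 * d + 1) := by gcongr
        _ = _ := by ring
    · have e1 : ((‖t‖ ^ d)⁻¹) ^ 4 * ‖t‖ ^ (6 * d + 2 + j) = ‖t‖ ^ (2 * d + j + 2) := by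
        field_simp
        ring
      have e2 : ((‖t‖ ^ d)⁻¹) ^ 3 * ‖t‖ ^ (3 * d + 1) = ‖t‖ := by
        field_simp
        ring
      have e3 : ((‖t‖ ^ d)⁻¹) ^ 4 * (K₁ * ‖t‖ ^ (6 * d + 2 + j)) = K₁ * ‖t‖ ^ (2 * d + j + 2) := by
        rw [← e1]; ring
      rw [e2, e3]
      have e4 : K₁ * ‖t‖ ^ (2 * d + j + 2) ≤ K₁ * ‖t‖ := by
        gcongr
        exact hp _ (by omega)
      calc _ ≤ 5000 * C ^ 8 * (‖t‖ + K₁ * ‖t‖) := by gcongr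
        _ = (‖t‖ * (10000 * C ^ 8 * (1 + K₁))) / 2 := by ring
        _ ≤ 1 / 2 := by linarith
  obtain ⟨z, hz, hzε, hzc⟩ := exists_holomorphic_fixedPoint (T := fun t => S.contr (t • v))
    (ε := fun t => ‖t‖ ^ (3 * d + 1)) hΩo (fun t _ => by positivity)
    (fun t ht => pow_le_one₀ (norm_nonneg t) (key t ht).2.1.le)
    (fun t ht => by
      obtain ⟨⟨T, h1, h2, h3, h4, h5⟩, -⟩ := hall t ht
      obtain ⟨k1, k2, k3, k4, k5⟩ := key t ht
      have hxr : ‖t • v‖ < S.r := by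
        have : 0 ≤ ‖t‖ ^ (3 * d + 1) := by positivity
        linarith
      rw [← S.contr_eq T h1 h2 h3 h4]
      refine (T.norm_contr_zero_le hxr S.hYc fun θ => ?_).trans k4
      rw [h1]
      exact (S.hYX θ _ hxr).trans h5)
    (fun t ht z₁ z₂ hz₁ hz₂ => by
      obtain ⟨⟨T, h1, h2, h3, h4, h5⟩, -⟩ := hall t ht
      obtain ⟨k1, k2, k3, k4, k5⟩ := key t ht
      have hε0 : 0 ≤ ‖t‖ ^ (3 * d + 1) := by positivity
      have hxr : ‖t • v‖ < S.r := by linarith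
      rw [← S.contr_eq T h1 h2 h3 h4]
      refine (T.norm_contr_sub_le hε0 k3 S.hYc (fun θ => ?_) (fun θ y z hy hz => ?_)
        (fun θ y z hy hz => ?_) hz₁ hz₂).trans ?_
      · rw [h1]
        exact (S.hYX θ _ hxr).trans h5
      · exact (S.hYl θ y z hy hz).trans (by gcongr)
      · have e1 := S.hYq θ (t • v) y z hxr hy hz
        have e2 := ContinuousLinearMap.le_of_opNorm_le _ ((S.hYX' θ _ hxr).trans h5) (y - z)
        rw [h2]
        have e3 : S.Y θ y - S.Y θ z - fderiv ℂ S.X (t • v) (y - z) =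
          (S.Y θ y - S.Y θ z - fderiv ℂ (S.Y θ) (t • v) (y - z)) +
          (fderiv ℂ (S.Y θ) (t • v) - fderiv ℂ S.X (t • v)) (y - z) := by
            rw [_root_.sub_apply]; abel
        rw [e3]
        refine (norm_add_le _ _).trans ((add_le_add e1 e2).trans ?_)
        have e4 : S.K * (‖y - t • v‖ + ‖z - t • v‖) * ‖y - z‖ ≤
            C * (‖y - t • v‖ + ‖z - t • v‖) * ‖y - z‖ := by gcongr
        have e5 : 1 * (K₁ * ‖t‖ ^ M * ‖y - z‖) ≤ C * (K₁ * ‖t‖ ^ M * ‖y - z‖) := by gcongr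
        linarith
      · calc _ ≤ 1 / 2 * ‖z₁ - z₂‖ := by gcongr
          _ = _ := by ring)
    (fun y hy hyε t ht => by
      obtain ⟨-, hΔ0, ⟨a1, a2, a3⟩, -⟩ := hall t ht
      obtain ⟨k1, k2, k3, k4, k5⟩ := key t ht
      have hyt : DifferentiableAt ℂ y t := hy.differentiableAt (hΩo.mem_nhds ht)
      have hxt : DifferentiableAt ℂ (fun t : ℂ => t • v) t := by fun_prop
      have c1 : DifferentiableAt ℂ (fun t : ℂ => S.X (t • v)) t :=
        DifferentiableAt.comp t (g := S.X) a1.differentiableAt hxt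
      have c1' : DifferentiableAt ℂ (fun t : ℂ => fderiv ℂ S.X (t • v)) t :=
        DifferentiableAt.comp t (g := fderiv ℂ S.X) a1.fderiv.differentiableAt hxt
      have c2 : DifferentiableAt ℂ (fun t : ℂ => S.Qh (t • v)) t :=
        DifferentiableAt.comp t (g := S.Qh) a2.differentiableAt hxt
      have c3 : DifferentiableAt ℂ (fun t : ℂ => S.Δ (t • v)) t :=
        DifferentiableAt.comp t (g := S.Δ) a3.differentiableAt hxt
      have c4 : DifferentiableAt ℂ (fun t : ℂ => (S.Δ (t • v))⁻¹ • S.Qh (t • v)) t :=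
        (c3.fun_inv hΔ0).fun_smul c2
      have c5 : DifferentiableAt ℂ (fun t : ℂ => S.b (t • v)) t := by
        have : DifferentiableAt ℂ (fun t : ℂ => S.D (t • v)) t := by fun_prop
        exact (c3.fun_inv hΔ0).fun_smul (c2.clm_apply this)
      refine DifferentiableAt.differentiableWithinAt ?_
      refine differentiableAt_solveLin c1 c4 (differentiableAt_velRem ?_ (differentiableAt_lin c1' c5)
        c1 hyt)
      refine differentiableAt_vel (r := S.r) (C := S.K) S.hYc S.hYc' (fun θ x y hx hy => ?_)
        hxt c5 hyt ?_
      · have := S.hYq θ x y x hx hy hx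
        simp only [sub_self, norm_zero, add_zero] at this
        rw [pow_two, ← mul_assoc]
        exact this
      · refine (norm_add_le _ _).trans_lt ?_
        have h1 := norm_constCLM_le (t • v)
        have h2 := norm_prim_le_seven (y t).1
        have h3 := (norm_fst_le (y t)).trans (hyε t ht)
        linarith)
  refine ⟨ρ, hρ, z, fun t ht => hz.differentiableAt (hΩo.mem_nhds ht), hzε,
    fun y N hy hper hres => ?_⟩
  have hres' := hres.norm_left.const_mul_left (60 * C ^ 5)
  have hb : (fun t : ℂ => y t - z t) =O[𝓝[≠] 0] fun t => (60 * C ^ 5 *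
      ‖vel S.Y S.D (t • v) (S.b (t • v)) (y t) - (y t).1‖) * ((‖t‖ ^ d)⁻¹) ^ 2 := by
    refine IsBigO.of_bound 1 ?_
    filter_upwards [hΩn, hy, hper] with t ht h1 h2
    obtain ⟨⟨T, t1, t2, t3, t4, t5⟩, -⟩ := hall t ht
    have h3 := hzc t ht (y t) h1
    have hTb : T.b = S.b (t • v) := by
      rw [PointData.b, t4, t3]
      rfl
    beta_reduce at h3
    rw [← S.contr_eq T t1 t2 t3 t4] at h3
    have h4 := T.norm_sub_contr_le (Y := S.Y) h2
    rw [t3, hTb] at h4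
    refine h3.trans ?_
    rw [one_mul]
    refine le_trans ?_ (Real.le_norm_self _)
    linarith
  refine (hb.trans (hres'.mul (isBigO_refl (fun t : ℂ => ((‖t‖ ^ d)⁻¹) ^ 2) _))).trans ?_
  refine IsBigO.of_bound 1 ?_
  filter_upwards [hΩn] with t ht
  have h0 : 0 < ‖t‖ := norm_pos_iff.2 ht.2
  have : ‖t‖ ^ (N + 2 * d) * ((‖t‖ ^ d)⁻¹) ^ 2 = ‖t‖ ^ N := by
    field_simp
    ring
  rw [this, one_mul]

end CoreData

end Core
section Uniform

variable {V W : Type*} [NormedAddCommGroup V] [NormedSpace ℂ V]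
  [NormedAddCommGroup W] [NormedSpace ℂ W] [CompleteSpace W]

/-- Taylor estimates for analytic families are uniform over the circle. -/
theorem eventually_forall_circle_norm_le {H : ℂ → V → W} {N : ℕ}
    (hH : ∀ ζ, ‖ζ‖ = 1 → AnalyticAt ℂ (fun p : ℂ × V => H p.1 p.2) (ζ, 0))
    (hO : ∀ ζ, ‖ζ‖ = 1 → H ζ =O[𝓝 0] fun x => ‖x‖ ^ (N + 1)) :
    ∃ C : ℝ, 0 ≤ C ∧ ∀ᶠ x in 𝓝 (0 : V), ∀ ζ, ‖ζ‖ = 1 → ‖H ζ x‖ ≤ C * ‖x‖ ^ (N + 1) := by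
  have hcpt : IsCompact (Metric.sphere (0 : ℂ) 1) := isCompact_sphere 0 1
  have hzero : ∀ ζ, ‖ζ‖ = 1 → H ζ 0 = 0 := by
    intro ζ hζ
    have h : H ζ =O[𝓝 0] fun x => ‖x - 0‖ ^ (N + 1) := by simpa using hO ζ hζ
    exact h.eq_zero_of_norm_pow (by omega : N + 1 ≠ 0)
  have h1 : ∀ ζ ∈ Metric.sphere (0 : ℂ) 1, ∀ᶠ p : V × ℂ in 𝓝 ((0 : V), ζ),
      AnalyticAt ℂ (H p.2) p.1 ∧ ‖H p.2 p.1‖ < 1 := by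
    intro ζ hζ
    have hζ' : ‖ζ‖ = 1 := by simpa using hζ
    have hsw : Tendsto (fun p : V × ℂ => (p.2, p.1)) (𝓝 ((0 : V), ζ)) (𝓝 (ζ, (0 : V))) :=
      (continuous_swap.tendsto ((0 : V), ζ))
    have hA := hsw.eventually (hH ζ hζ').eventually_analyticAt
    have hn : Tendsto (fun p : ℂ × V => ‖H p.1 p.2‖) (𝓝 (ζ, (0 : V))) (𝓝 0) := by
      have := (hH ζ hζ').continuousAt.norm.tendsto
      simpa [hzero ζ hζ'] using this
    have hB := hsw.eventually (hn.eventually (gt_mem_nhds one_pos))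
    filter_upwards [hA, hB] with p hp hp'
    exact ⟨AnalyticAt.comp (g := fun p : ℂ × V => H p.1 p.2) (f := fun x => (p.2, x)) hp
      (analyticAt_const.prod analyticAt_id), hp'⟩
  have h2 := hcpt.eventually_forall_of_forall_eventually
    (P := fun x ζ => AnalyticAt ℂ (H ζ) x ∧ ‖H ζ x‖ < 1) h1
  obtain ⟨r, hr, h3⟩ := Metric.eventually_nhds_iff_ball.1 h2
  refine ⟨1 * (1 / r) ^ (N + 1), by positivity, ?_⟩
  filter_upwards [Metric.ball_mem_nhds (0 : V) hr] with x hx ζ hζ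
  have hζ' : ζ ∈ Metric.sphere (0 : ℂ) 1 := by simpa using hζ
  have := norm_le_mul_div_pow (f := H ζ) (r := r) (C := 1)
    (fun y hy => (h3 y hy ζ hζ').1.differentiableAt.differentiableWithinAt)
    (fun y hy => (h3 y hy ζ hζ').2.le) (hO ζ hζ) hx
  refine this.trans_eq ?_
  rw [div_pow, div_pow]
  ring

end Uniform

section Rotation

variable {n : ℕ}

/-- The diagonal endomorphism with given eigenvalues. -/
noncomputable def dg (a : Fin n → ℂ) : (Fin n → ℂ) →L[ℂ] (Fin n → ℂ) :=
  ∑ i, a i • (ContinuousLinearMap.single ℂ (fun _ : Fin n => ℂ) i).comp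
    (ContinuousLinearMap.proj (R := ℂ) (φ := fun _ : Fin n => ℂ) i)

@[simp]
theorem dg_apply (a x : Fin n → ℂ) (i : Fin n) : dg a x i = a i * x i := by
  simp [dg, Finset.sum_apply, Pi.single_apply]

/-- The action of the circle with weights `k`. -/
noncomputable def rot (k : Fin n → ℤ) (ζ : ℂ) : (Fin n → ℂ) →L[ℂ] (Fin n → ℂ) :=
  dg fun i => ζ ^ k i

@[simp]
theorem rot_apply (k : Fin n → ℤ) (ζ : ℂ) (x : Fin n → ℂ) (i : Fin n) :
    rot k ζ x i = ζ ^ k i * x i := dg_apply _ _ _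

theorem norm_rot_apply (k : Fin n → ℤ) {ζ : ℂ} (hζ : ‖ζ‖ = 1) (x : Fin n → ℂ) :
    ‖rot k ζ x‖ = ‖x‖ := by
  have h : ∀ i, ‖rot k ζ x i‖₊ = ‖x i‖₊ := fun i => by
    rw [← NNReal.coe_inj]
    simp [hζ]
  simp only [Pi.norm_def, h]

theorem rot_rot_inv (k : Fin n → ℤ) {ζ : ℂ} (hζ : ζ ≠ 0) (x : Fin n → ℂ) :
    rot k ζ (rot k ζ⁻¹ x) = x := by
  ext i
  have := zpow_ne_zero (k i) hζ
  simp [this]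

theorem analyticAt_rot (k : Fin n → ℤ) {ζ : ℂ} (hζ : ζ ≠ 0) : AnalyticAt ℂ (rot k) ζ := by
  unfold rot dg
  refine Finset.univ.analyticAt_fun_sum fun i _ => ?_
  exact (analyticAt_id.zpow hζ).smul analyticAt_const

/-- The point of the unit circle with given argument. -/
noncomputable def circ (θ : Cir) : ℂ := Complex.exp ((θ : ℝ) * Complex.I)

theorem norm_circ (θ : Cir) : ‖circ θ‖ = 1 := Complex.norm_exp_ofReal_mul_I _

theorem circ_ne_zero (θ : Cir) : circ θ ≠ 0 := Complex.exp_ne_zero _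

theorem continuous_circ : Continuous circ := by
  unfold circ
  fun_prop

theorem continuous_rot_circ (k : Fin n → ℤ) : Continuous fun θ => rot k (circ θ) :=
  continuous_iff_continuousAt.2 fun θ =>
    ContinuousAt.comp (g := rot k) (analyticAt_rot k (circ_ne_zero θ)).continuousAt
      continuous_circ.continuousAt

theorem continuous_rot_circ_inv (k : Fin n → ℤ) : Continuous fun θ => rot k (circ θ)⁻¹ :=
  continuous_iff_continuousAt.2 fun θ =>
    ContinuousAt.comp (g := rot k) (analyticAt_rot k (inv_ne_zero (circ_ne_zero θ))).continuousAt
      (continuous_circ.continuousAt.inv₀ (circ_ne_zero θ))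

variable {W W' : Type*} [NormedAddCommGroup W] [NormedSpace ℂ W] [CompleteSpace W]
  [NormedAddCommGroup W'] [NormedSpace ℂ W']

/-- Uniform bounds for a family of rotated analytic maps. -/
theorem exists_rotated_bounds (k : Fin n → ℤ) {a : (Fin n → ℂ) → W} (ha : AnalyticAt ℂ a 0)
    {B : Cir → W →L[ℂ] W'} (hB : Continuous B) (hBn : ∀ θ w, ‖B θ w‖ ≤ ‖w‖)
    {Y : Cir → (Fin n → ℂ) → W'} (hY : ∀ θ x, Y θ x = B θ (a (rot k (circ θ) x))) :
    ∃ r : ℝ, 0 < r ∧ ∃ K : ℝ, 0 ≤ K ∧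
      (∀ θ x, ‖x‖ < r → fderiv ℂ (Y θ) x =
        (B θ).comp ((fderiv ℂ a (rot k (circ θ) x)).comp (rot k (circ θ)))) ∧
      (∀ θ x, ‖x‖ < r → ‖Y θ x‖ ≤ K) ∧
      (∀ u : C(Cir, Fin n → ℂ), ‖u‖ < r → Continuous fun θ => Y θ (u θ)) ∧
      (∀ u : C(Cir, Fin n → ℂ), ‖u‖ < r → Continuous fun θ => fderiv ℂ (Y θ) (u θ)) ∧
      (∀ θ y z, ‖y‖ < r → ‖z‖ < r → ‖Y θ y - Y θ z‖ ≤ K * ‖y - z‖) ∧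
      (∀ θ x y z, ‖x‖ < r → ‖y‖ < r → ‖z‖ < r →
        ‖Y θ y - Y θ z - fderiv ℂ (Y θ) x (y - z)‖ ≤ K * (‖y - x‖ + ‖z - x‖) * ‖y - z‖) := by
  obtain ⟨r, hr, K, hK, han, b0, b1, b2, -, b4⟩ := exists_ball_bounds ha
  have hrot : ∀ θ x, ‖x‖ < r → rot k (circ θ) x ∈ Metric.ball (0 : Fin n → ℂ) r := by
    intro θ x hx
    rw [mem_ball_zero_iff, norm_rot_apply k (norm_circ θ)]
    exact hx
  have hfd : ∀ θ x, ‖x‖ < r → fderiv ℂ (Y θ) x =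
      (B θ).comp ((fderiv ℂ a (rot k (circ θ) x)).comp (rot k (circ θ))) := by
    intro θ x hx
    have h1 : HasFDerivAt (fun x => a (rot k (circ θ) x)) _ x :=
      HasFDerivAt.comp x (han _ (hrot θ x hx)).differentiableAt.hasFDerivAt
        (rot k (circ θ)).hasFDerivAt
    have h2 : Y θ = fun x => B θ (a (rot k (circ θ) x)) := funext (hY θ)
    rw [h2]
    exact ((B θ).hasFDerivAt.comp x h1).fderiv
  have hcu : ∀ u : C(Cir, Fin n → ℂ), Continuous fun θ => rot k (circ θ) (u θ) := fun u =>
    (continuous_rot_circ k).clm_apply u.continuous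
  have hur : ∀ u : C(Cir, Fin n → ℂ), ‖u‖ < r → ∀ θ, ‖u θ‖ < r := fun u hu θ =>
    (u.norm_coe_le_norm θ).trans_lt hu
  refine ⟨r, hr, K, hK.le, hfd, fun θ x hx => ?_, fun u hu => ?_, fun u hu => ?_,
    fun θ y z hy hz => ?_, fun θ x y z hx hy hz => ?_⟩
  · rw [hY]
    exact (hBn _ _).trans (b0 _ (hrot θ x hx))
  · simp only [hY]
    refine hB.clm_apply (continuous_iff_continuousAt.2 fun θ => ?_)
    exact ContinuousAt.comp (g := a) (han _ (hrot θ _ (hur u hu θ))).continuousAt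
      (hcu u).continuousAt
  · have : (fun θ => fderiv ℂ (Y θ) (u θ)) = fun θ =>
        (B θ).comp ((fderiv ℂ a (rot k (circ θ) (u θ))).comp (rot k (circ θ))) :=
      funext fun θ => hfd θ _ (hur u hu θ)
    rw [this]
    refine hB.clm_comp (Continuous.clm_comp (continuous_iff_continuousAt.2 fun θ => ?_)
      (continuous_rot_circ k))
    exact ContinuousAt.comp (g := fderiv ℂ a) (han _ (hrot θ _ (hur u hu θ))).fderiv.continuousAt
      (hcu u).continuousAt
  · rw [hY, hY, ← map_sub]
    refine (hBn _ _).trans ((b2 _ (hrot θ y hy) _ (hrot θ z hz)).trans_eq ?_)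
    rw [← map_sub, norm_rot_apply k (norm_circ θ)]
  · have e : Y θ y - Y θ z - fderiv ℂ (Y θ) x (y - z) = B θ (a (rot k (circ θ) y) -
        a (rot k (circ θ) z) - fderiv ℂ a (rot k (circ θ) x)
          (rot k (circ θ) y - rot k (circ θ) z)) := by
      rw [hfd θ x hx, hY, hY, map_sub (B θ), map_sub (B θ), ← map_sub (rot k (circ θ))]
      rfl
    rw [e]
    refine (hBn _ _).trans ((b4 _ (hrot θ x hx) _ (hrot θ y hy) _ (hrot θ z hz)).trans_eq ?_)
    simp only [← map_sub, norm_rot_apply k (norm_circ θ)]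

end Rotation
section Sym

set_option linter.unusedSectionVars false

variable {n : ℕ} {P G : Type*}
  [NormedAddCommGroup P] [NormedSpace ℂ P] [CompleteSpace P]
  [NormedAddCommGroup G] [NormedSpace ℂ G] [CompleteSpace G]

variable (n P G) in
/-- Commuting vector fields with first integrals, a rational splitting, and a linear circle action
with weights `k` which preserves everything up to order `M`. -/
structure SymData (M : ℕ) where
  /-- the vector fields -/
  X : (Fin n → ℂ) → P →L[ℂ] (Fin n → ℂ)
  /-- the first integrals -/
  f : (Fin n → ℂ) → G
  /-- the weights of the circle action -/
  k : Fin n → ℤ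
  /-- the numerator of the left inverse of the vector fields -/
  Qh : (Fin n → ℂ) → (Fin n → ℂ) →L[ℂ] P
  /-- the numerator of the right inverse of the differential of the first integrals -/
  R : (Fin n → ℂ) → G →L[ℂ] (Fin n → ℂ)
  /-- the common denominator -/
  Δ : (Fin n → ℂ) → ℂ
  hX : AnalyticAt ℂ X 0
  hf : AnalyticAt ℂ f 0
  hQh : AnalyticAt ℂ Qh 0
  hR : AnalyticAt ℂ R 0
  hΔ : AnalyticAt ℂ Δ 0
  hQX : ∀ᶠ x in 𝓝 0, ∀ β, Qh x (X x β) = Δ x • β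
  hXQ : ∀ᶠ x in 𝓝 0, ∀ u, X x (Qh x u) + R x (fderiv ℂ f x u) = Δ x • u
  hfX : ∀ᶠ x in 𝓝 0, ∀ β, fderiv ℂ f x (X x β) = 0
  hcomm : ∀ᶠ x in 𝓝 0, ∀ β β', fderiv ℂ X x (X x β) β' = fderiv ℂ X x (X x β') β
  hDX : (fun x => fderiv ℂ X x (dg (fun i => (k i : ℂ)) x) -
    (dg fun i => (k i : ℂ)).comp (X x)) =O[𝓝 0] fun x => ‖x‖ ^ (M + 1)
  hfD : (fun x => fderiv ℂ f x (dg (fun i => (k i : ℂ)) x)) =O[𝓝 0] fun x => ‖x‖ ^ (M + 1)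
  hrot : ∀ ζ, ‖ζ‖ = 1 → (fun x => (rot k ζ⁻¹).comp (X (rot k ζ x)) - X x) =O[𝓝 0]
    fun x => ‖x‖ ^ (M + 1)

namespace SymData

variable {M : ℕ} (S : SymData n P G M)

/-- The rotated vector fields. -/
noncomputable def Y (θ : Cir) (x : Fin n → ℂ) : P →L[ℂ] (Fin n → ℂ) :=
  (rot S.k (circ θ)⁻¹).comp (S.X (rot S.k (circ θ) x))

theorem exists_coreData (hM : 1 ≤ M) : ∃ T : CoreData (Fin n → ℂ) P G M, T.X = S.X ∧ T.f = S.f ∧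
    T.Y = S.Y ∧ T.D = dg (fun i => (S.k i : ℂ)) ∧ T.Qh = S.Qh ∧ T.Δ = S.Δ := by
  set B : Cir → (P →L[ℂ] (Fin n → ℂ)) →L[ℂ] (P →L[ℂ] (Fin n → ℂ)) := fun θ =>
    ContinuousLinearMap.compL ℂ P (Fin n → ℂ) (Fin n → ℂ) (rot S.k (circ θ)⁻¹) with hBdef
  have hB : Continuous B :=
    (ContinuousLinearMap.compL ℂ P (Fin n → ℂ) (Fin n → ℂ)).continuous.comp
      (continuous_rot_circ_inv S.k)
  have hBn : ∀ θ w, ‖B θ w‖ ≤ ‖w‖ := by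
    intro θ w
    refine ContinuousLinearMap.opNorm_le_bound _ (norm_nonneg w) fun β => ?_
    have : B θ w β = rot S.k (circ θ)⁻¹ (w β) := rfl
    rw [this, norm_rot_apply _ (by rw [norm_inv, norm_circ, inv_one])]
    exact w.le_opNorm β
  obtain ⟨r, hr, K, hK, hfd, -, hc, hc', hl, hq⟩ :=
    exists_rotated_bounds S.k S.hX hB hBn (Y := S.Y) (fun θ x => rfl)
  have hrotan : ∀ ζ : ℂ, ‖ζ‖ = 1 →
      AnalyticAt ℂ (fun p : ℂ × (Fin n → ℂ) => rot S.k p.1 p.2) (ζ, 0) := by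
    intro ζ hζ
    have hζ0 : ζ ≠ 0 := norm_ne_zero_iff.1 (by rw [hζ]; exact one_ne_zero)
    exact analyticAt_clm_apply
      (AnalyticAt.comp (g := rot S.k) (f := Prod.fst) (analyticAt_rot S.k hζ0) analyticAt_fst)
      analyticAt_snd
  have hrotinv : ∀ ζ : ℂ, ‖ζ‖ = 1 →
      AnalyticAt ℂ (fun p : ℂ × (Fin n → ℂ) => rot S.k p.1⁻¹) (ζ, 0) := by
    intro ζ hζ
    have hζ0 : ζ ≠ 0 := norm_ne_zero_iff.1 (by rw [hζ]; exact one_ne_zero)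
    exact AnalyticAt.comp (g := rot S.k) (f := fun p : ℂ × (Fin n → ℂ) => p.1⁻¹)
      (analyticAt_rot S.k (inv_ne_zero hζ0)) (analyticAt_fst.inv hζ0)
  obtain ⟨C₁, hC₁, h1⟩ := eventually_forall_circle_norm_le
    (H := fun ζ x => (rot S.k ζ⁻¹).comp (S.X (rot S.k ζ x)) - S.X x) (N := M)
    (fun ζ hζ => by
      refine AnalyticAt.sub (analyticAt_clm_comp (hrotinv ζ hζ) ?_) ?_
      · exact AnalyticAt.comp (g := S.X) (by simpa using S.hX) (hrotan ζ hζ)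
      · exact AnalyticAt.comp (g := S.X) S.hX analyticAt_snd) S.hrot
  have hder : ∀ ζ, ‖ζ‖ = 1 → (fun x => (ContinuousLinearMap.compL ℂ P (Fin n → ℂ) (Fin n → ℂ)
      (rot S.k ζ⁻¹)).comp ((fderiv ℂ S.X (rot S.k ζ x)).comp (rot S.k ζ)) - fderiv ℂ S.X x)
      =O[𝓝 0] fun x => ‖x‖ ^ (M - 1 + 1) := by
    intro ζ hζ
    have hX' : AnalyticAt ℂ S.X (rot S.k ζ 0) := by simpa using S.hX
    have ha : AnalyticAt ℂ (fun x => (rot S.k ζ⁻¹).comp (S.X (rot S.k ζ x)) - S.X x) 0 :=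
      (analyticAt_clm_comp analyticAt_const
        (AnalyticAt.comp (g := S.X) hX' ((rot S.k ζ).analyticAt 0))).sub S.hX
    have := fderiv_isBigO_pow ha (S.hrot ζ hζ)
    rw [Nat.sub_add_cancel hM]
    refine this.congr' ?_ EventuallyEq.rfl
    have ht : Tendsto (fun x => rot S.k ζ x) (𝓝 0) (𝓝 0) := by
      simpa using (rot S.k ζ).continuous.tendsto 0
    filter_upwards [S.hX.eventually_analyticAt, ht.eventually S.hX.eventually_analyticAt]
      with x h1 h2
    have h3 : HasFDerivAt (fun x => S.X (rot S.k ζ x)) _ x :=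
      HasFDerivAt.comp x h2.differentiableAt.hasFDerivAt (rot S.k ζ).hasFDerivAt
    have h4 := (((ContinuousLinearMap.compL ℂ P (Fin n → ℂ) (Fin n → ℂ)
      (rot S.k ζ⁻¹)).hasFDerivAt (x := S.X (rot S.k ζ x))).comp x h3).sub
        h1.differentiableAt.hasFDerivAt
    exact h4.fderiv
  obtain ⟨C₂, hC₂, h2⟩ := eventually_forall_circle_norm_le
    (H := fun ζ x => (ContinuousLinearMap.compL ℂ P (Fin n → ℂ) (Fin n → ℂ)
      (rot S.k ζ⁻¹)).comp ((fderiv ℂ S.X (rot S.k ζ x)).comp (rot S.k ζ)) - fderiv ℂ S.X x)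
    (N := M - 1)
    (fun ζ hζ => by
      have hζ0 : ζ ≠ 0 := norm_ne_zero_iff.1 (by rw [hζ]; exact one_ne_zero)
      refine AnalyticAt.sub (analyticAt_clm_comp ?_ (analyticAt_clm_comp ?_ ?_)) ?_
      · exact AnalyticAt.comp (g := ContinuousLinearMap.compL ℂ P (Fin n → ℂ) (Fin n → ℂ))
          (ContinuousLinearMap.analyticAt _ _) (hrotinv ζ hζ)
      · exact AnalyticAt.comp (g := fderiv ℂ S.X) (by simpa using S.hX.fderiv) (hrotan ζ hζ)
      · exact AnalyticAt.comp (g := rot S.k) (f := Prod.fst) (analyticAt_rot S.k hζ0)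
          analyticAt_fst
      · exact AnalyticAt.comp (g := fderiv ℂ S.X) S.hX.fderiv analyticAt_snd) hder
  rw [Nat.sub_add_cancel hM] at h2
  obtain ⟨ρ, hρ, h3⟩ := Metric.eventually_nhds_iff_ball.1 (h1.and h2)
  set r' := min (min r ρ) 1 with hr'
  have hr'1 : r' ≤ r := (min_le_left _ _).trans (min_le_left _ _)
  have hr'2 : r' ≤ ρ := (min_le_left _ _).trans (min_le_right _ _)
  have hr'3 : r' ≤ 1 := min_le_right _ _
  refine ⟨{ X := S.X, f := S.f, D := dg fun i => (S.k i : ℂ), Qh := S.Qh, R := S.R, Δ := S.Δ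
            Y := S.Y, r := r', K := K + C₁ + C₂
            hX := S.hX, hf := S.hf, hQh := S.hQh, hR := S.hR, hΔ := S.hΔ, hQX := S.hQX
            hXQ := S.hXQ, hfX := S.hfX, hcomm := S.hcomm
            hDX := isBigO_pow_of_le (Nat.le_succ M) S.hDX
            hfD := S.hfD
            hr := lt_min (lt_min hr hρ) one_pos
            hYc := fun u hu => hc u (hu.trans_le hr'1)
            hYc' := fun u hu => hc' u (hu.trans_le hr'1)
            hYl := fun θ y z hy hz => (hl θ y z (hy.trans_le hr'1) (hz.trans_le hr'1)).trans (by
              gcongr; linarith)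
            hYq := fun θ x y z hx hy hz => (hq θ x y z (hx.trans_le hr'1) (hy.trans_le hr'1)
              (hz.trans_le hr'1)).trans (by gcongr; linarith)
            hYX := fun θ x hx => ?_
            hYX' := fun θ x hx => ?_ }, rfl, rfl, rfl, rfl, rfl, rfl⟩
  · have hxρ : x ∈ Metric.ball (0 : Fin n → ℂ) ρ := by simpa using hx.trans_le hr'2
    refine ((h3 x hxρ).1 (circ θ) (norm_circ θ)).trans ?_
    have : ‖x‖ ^ (M + 1) ≤ ‖x‖ ^ M :=
      pow_le_pow_of_le_one (norm_nonneg _) (hx.le.trans hr'3) (Nat.le_succ M)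
    exact mul_le_mul (by linarith) this (by positivity) (by linarith)
  · have hxρ : x ∈ Metric.ball (0 : Fin n → ℂ) ρ := by simpa using hx.trans_le hr'2
    rw [hfd θ x (hx.trans_le hr'1)]
    refine ((h3 x hxρ).2 (circ θ) (norm_circ θ)).trans ?_
    gcongr
    linarith

end SymData

end Sym
section Harmonics

theorem eventually_norm_le_add_one {E W : Type*} [NormedAddCommGroup E] [NormedSpace ℂ E]
    [NormedAddCommGroup W] [NormedSpace ℂ W] {a : E → W} {x₀ : E} (ha : AnalyticAt ℂ a x₀) :
    ∀ᶠ x in 𝓝 x₀, ‖a x‖ ≤ ‖a x₀‖ + 1 :=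
  (ha.continuousAt.norm.tendsto.eventually (gt_mem_nhds (lt_add_one _))).mono fun _ hx => hx.le

theorem hasDerivAt_cexp_zpow (m : ℤ) (θ : ℝ) :
    HasDerivAt (fun θ : ℝ => Complex.exp (θ * Complex.I) ^ m)
      (Complex.I * m * Complex.exp (θ * Complex.I) ^ m) θ := by
  have h : ∀ θ : ℝ, Complex.exp (θ * Complex.I) ^ m = Complex.exp (m * (θ * Complex.I)) :=
    fun θ => (Complex.exp_int_mul _ _).symm
  simp only [h]
  have h1 : HasDerivAt (fun θ : ℝ => (θ : ℂ)) 1 θ := Complex.ofRealCLM.hasDerivAt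
  have h2 := ((h1.mul_const Complex.I).const_mul (m : ℂ)).cexp
  convert h2 using 1
  ring

theorem circ_last : circ Cir.last = 1 := by
  simp [circ, Cir.last]

theorem primLast_circ_zpow {u : C(Cir, ℂ)} {m : ℤ} (hu : ∀ θ, u θ = circ θ ^ m) :
    primLast u = if m = 0 then 2 * (Real.pi : ℂ) else 0 := by
  split_ifs with hm
  · have : u = constCLM 1 := by
      ext θ
      rw [hu, hm, zpow_zero, constCLM_apply]
    rw [this, primLast_constCLM, smul_eq_mul, mul_one]
  · have hm' : (m : ℂ) ≠ 0 := Int.cast_ne_zero.2 hm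
    rw [primLast_apply, prim_eq_sub
      (w := fun θ : ℝ => (Complex.I * m)⁻¹ * Complex.exp (θ * Complex.I) ^ m)
      (fun θ => ?_)]
    · have := circ_last
      simp only [circ] at this
      rw [this]
      simp
    · have := (hasDerivAt_cexp_zpow m θ).const_mul (Complex.I * (m : ℂ))⁻¹
      have e : u θ = (Complex.I * m)⁻¹ * (Complex.I * m * Complex.exp ((θ : ℝ) * Complex.I) ^ m) := by
        rw [hu, circ, inv_mul_cancel_left₀ (mul_ne_zero Complex.I_ne_zero hm')]
      rw [e]
      exact this

end Harmonics

section Approx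

set_option linter.unusedSectionVars false

variable {n : ℕ} {P G : Type*}
  [NormedAddCommGroup P] [NormedSpace ℂ P] [CompleteSpace P]
  [NormedAddCommGroup G] [NormedSpace ℂ G] [CompleteSpace G]

/-- A circle action preserving the vector fields and first integrals up to order `N`, together with
the harmonics of a function `g` with respect to it. -/
structure Approx {M : ℕ} (S : SymData n P G M) (g : (Fin n → ℂ) → ℂ) (N : ℕ) where
  /-- the frequencies -/
  s : Finset ℤ
  /-- the harmonics of the action -/
  p : ℤ → (Fin n → ℂ) → (Fin n → ℂ)
  /-- the harmonics of the function -/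
  h : ℤ → (Fin n → ℂ) → ℂ
  hp : ∀ j, AnalyticAt ℂ (p j) 0
  hp0 : ∀ j, p j 0 = 0
  hh : ∀ j, AnalyticAt ℂ (h j) 0
  hs : ∀ j, j ∉ s → h j = 0
  hsum : ∀ᶠ x in 𝓝 0, ∑ j ∈ s, p j x = x
  hsmall : ∀ j i, j ≠ S.k i → (fun x => p j x i) =O[𝓝 0] fun x => ‖x‖ ^ (M + 1)
  hX : ∀ ζ : ℂ, ‖ζ‖ = 1 → (fun x => S.X (∑ j ∈ s, ζ ^ j • p j x) -
    (∑ j ∈ s, ζ ^ j • fderiv ℂ (p j) x).comp (S.X x)) =O[𝓝 0] fun x => ‖x‖ ^ (N + 1)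
  hZ : ∀ ζ : ℂ, ‖ζ‖ = 1 → (fun x => (∑ j ∈ s, ζ ^ j • fderiv ℂ (p j) x) (∑ j ∈ s, (j : ℂ) • p j x)
    - ∑ j ∈ s, ((j : ℂ) * ζ ^ j) • p j x) =O[𝓝 0] fun x => ‖x‖ ^ (N + 1)
  hfZ : (fun x => fderiv ℂ S.f x (∑ j ∈ s, (j : ℂ) • p j x)) =O[𝓝 0] fun x => ‖x‖ ^ (N + 1)
  hg : ∀ ζ : ℂ, ‖ζ‖ = 1 → (fun x => g (∑ j ∈ s, ζ ^ j • p j x) - ∑ j ∈ s, ζ ^ j * h j x)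
    =O[𝓝 0] fun x => ‖x‖ ^ (N + 1)

namespace Approx

variable {M N : ℕ} {S : SymData n P G M} {g : (Fin n → ℂ) → ℂ} (A : Approx S g N)

/-- The orbits of the approximate action. -/
noncomputable def γ (ζ : ℂ) (x : Fin n → ℂ) : Fin n → ℂ := ∑ j ∈ A.s, ζ ^ j • A.p j x

/-- The space derivative of the orbits of the approximate action. -/
noncomputable def dγ (ζ : ℂ) (x : Fin n → ℂ) : (Fin n → ℂ) →L[ℂ] (Fin n → ℂ) :=
  ∑ j ∈ A.s, ζ ^ j • fderiv ℂ (A.p j) x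

/-- The generator of the approximate action. -/
noncomputable def Z (x : Fin n → ℂ) : Fin n → ℂ := ∑ j ∈ A.s, (j : ℂ) • A.p j x

/-- The velocity of the orbits of the approximate action. -/
noncomputable def γ' (ζ : ℂ) (x : Fin n → ℂ) : Fin n → ℂ :=
  ∑ j ∈ A.s, ((j : ℂ) * ζ ^ j) • A.p j x

/-- The velocity of the orbits in rotating coordinates. -/
noncomputable def ω (x : Fin n → ℂ) : C(Cir, Fin n → ℂ) where
  toFun θ i := ∑ j ∈ A.s, (Complex.I * ((j - S.k i : ℤ) : ℂ) * circ θ ^ (j - S.k i)) * A.p j x i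
  continuous_toFun := by
    refine continuous_pi fun i => continuous_finsetSum _ fun j _ => ?_
    exact (continuous_const.mul (continuous_circ.zpow₀ _ fun θ => Or.inl (circ_ne_zero θ))).mul
      continuous_const

theorem ω_apply (x : Fin n → ℂ) (θ : Cir) (i : Fin n) : A.ω x θ i = ∑ j ∈ A.s,
    (Complex.I * ((j - S.k i : ℤ) : ℂ) * circ θ ^ (j - S.k i)) * A.p j x i := rfl

theorem prim_ω (x : Fin n → ℂ) (θ : Cir) :
    prim (A.ω x) θ = rot S.k (circ θ)⁻¹ (A.γ (circ θ) x) - ∑ j ∈ A.s, A.p j x := by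
  rw [prim_eq_sub (w := fun (θ : ℝ) i => ∑ j ∈ A.s,
    Complex.exp (θ * Complex.I) ^ (j - S.k i) * A.p j x i) (fun θ => ?_)]
  · congr 1
    · ext i
      simp only [rot_apply, γ, Finset.sum_apply, Pi.smul_apply, smul_eq_mul, Finset.mul_sum]
      refine Finset.sum_congr rfl fun j _ => ?_
      have e : Complex.exp ((θ : ℝ) * Complex.I) = circ θ := rfl
      rw [e, zpow_sub₀ (circ_ne_zero θ), inv_zpow]
      ring
    · ext i
      simp
  · refine hasDerivAt_pi.2 fun i => ?_
    rw [ω_apply]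
    refine HasDerivAt.fun_sum fun j _ => ?_
    exact (hasDerivAt_cexp_zpow _ _).mul_const _

theorem primLast_ω (x : Fin n → ℂ) : primLast (A.ω x) = 0 := by
  rw [primLast_apply, prim_ω, circ_last]
  ext i
  simp [γ]

theorem ω_eq (x : Fin n → ℂ) (θ : Cir) : A.ω x θ = Complex.I • (rot S.k (circ θ)⁻¹ (A.γ' (circ θ) x)
    - dg (fun i => (S.k i : ℂ)) (rot S.k (circ θ)⁻¹ (A.γ (circ θ) x))) := by
  ext i
  simp only [ω_apply, rot_apply, γ, γ', Finset.sum_apply, Pi.smul_apply, smul_eq_mul,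
    Finset.mul_sum, Pi.sub_apply, dg_apply, ← Finset.sum_sub_distrib]
  refine Finset.sum_congr rfl fun j _ => ?_
  rw [zpow_sub₀ (circ_ne_zero θ), inv_zpow]
  push_cast
  ring

theorem exists_small : ∃ C : ℝ, 0 ≤ C ∧ ∀ᶠ x in 𝓝 (0 : Fin n → ℂ),
    ‖A.ω x‖ ≤ C * ‖x‖ ^ (M + 1) ∧ ‖A.Z x - dg (fun i => (S.k i : ℂ)) x‖ ≤ C * ‖x‖ ^ (M + 1) := by
  have h1 : ∀ j i, ∃ C : ℝ, 0 ≤ C ∧ ∀ᶠ x in 𝓝 (0 : Fin n → ℂ),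
      ‖((j - S.k i : ℤ) : ℂ) * A.p j x i‖ ≤ C * ‖x‖ ^ (M + 1) := by
    intro j i
    by_cases hj : j = S.k i
    · exact ⟨0, le_rfl, Eventually.of_forall fun x => by simp [hj]⟩
    · obtain ⟨C, hC, h⟩ := ((A.hsmall j i hj).const_mul_left ((j - S.k i : ℤ) : ℂ)).exists_nonneg
      refine ⟨C, hC, h.bound.mono fun x hx => by simpa using hx⟩
  choose C hC h using h1
  set C' : ℝ := ∑ i, ∑ j ∈ A.s, C j i with hC'
  have hle : ∀ i, ∑ j ∈ A.s, C j i ≤ C' := fun i =>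
    Finset.single_le_sum (f := fun i => ∑ j ∈ A.s, C j i)
      (fun i _ => Finset.sum_nonneg fun j _ => hC j i) (Finset.mem_univ i)
  have hC0 : 0 ≤ C' := Finset.sum_nonneg fun i _ => Finset.sum_nonneg fun j _ => hC j i
  refine ⟨C', hC0, ?_⟩
  have hall : ∀ᶠ x in 𝓝 (0 : Fin n → ℂ), ∀ i, ∀ j ∈ A.s,
      ‖((j - S.k i : ℤ) : ℂ) * A.p j x i‖ ≤ C j i * ‖x‖ ^ (M + 1) :=
    eventually_all.2 fun i => (eventually_all_finset _).2 fun j _ => h j i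
  filter_upwards [hall, A.hsum] with x hx hs
  refine ⟨(ContinuousMap.norm_le _ (by positivity)).2 fun θ =>
    (pi_norm_le_iff_of_nonneg (by positivity)).2 fun i => ?_,
    (pi_norm_le_iff_of_nonneg (by positivity)).2 fun i => ?_⟩
  · rw [ω_apply]
    refine (norm_sum_le _ _).trans ?_
    refine le_trans ?_ (mul_le_mul_of_nonneg_right (hle i) (by positivity))
    rw [Finset.sum_mul]
    refine Finset.sum_le_sum fun j hj => ?_
    refine le_trans (le_of_eq ?_) (hx i j hj)
    simp [norm_circ]
  · have e : (A.Z x - dg (fun i => (S.k i : ℂ)) x) i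
        = ∑ j ∈ A.s, ((j - S.k i : ℤ) : ℂ) * A.p j x i := by
      have : x i = ∑ j ∈ A.s, A.p j x i := by
        conv_lhs => rw [← hs]
        simp
      simp only [Z, Pi.sub_apply, Finset.sum_apply, Pi.smul_apply, smul_eq_mul, dg_apply]
      rw [this, Finset.mul_sum, ← Finset.sum_sub_distrib]
      refine Finset.sum_congr rfl fun j _ => ?_
      push_cast
      ring
    rw [e]
    refine (norm_sum_le _ _).trans ?_
    refine le_trans ?_ (mul_le_mul_of_nonneg_right (hle i) (by positivity))
    rw [Finset.sum_mul]
    exact Finset.sum_le_sum fun j hj => hx i j hj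

theorem analyticAt_γ {ζ : ℂ} (hζ : ζ ≠ 0) :
    AnalyticAt ℂ (fun q : ℂ × (Fin n → ℂ) => A.γ q.1 q.2) (ζ, 0) := by
  unfold γ
  refine Finset.analyticAt_fun_sum _ fun j _ => ?_
  exact (analyticAt_fst.zpow hζ).smul
    (AnalyticAt.comp (g := A.p j) (f := Prod.snd) (A.hp j) analyticAt_snd)

theorem analyticAt_γ' {ζ : ℂ} (hζ : ζ ≠ 0) :
    AnalyticAt ℂ (fun q : ℂ × (Fin n → ℂ) => A.γ' q.1 q.2) (ζ, 0) := by
  unfold γ'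
  refine Finset.analyticAt_fun_sum _ fun j _ => ?_
  exact (analyticAt_const.mul (analyticAt_fst.zpow hζ)).smul
    (AnalyticAt.comp (g := A.p j) (f := Prod.snd) (A.hp j) analyticAt_snd)

theorem analyticAt_dγ {ζ : ℂ} (hζ : ζ ≠ 0) :
    AnalyticAt ℂ (fun q : ℂ × (Fin n → ℂ) => A.dγ q.1 q.2) (ζ, 0) := by
  unfold dγ
  refine Finset.analyticAt_fun_sum _ fun j _ => ?_
  have : AnalyticAt ℂ (fderiv ℂ (A.p j)) 0 := (A.hp j).fderiv
  exact (analyticAt_fst.zpow hζ).smul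
    (AnalyticAt.comp (g := fderiv ℂ (A.p j)) (f := Prod.snd) this analyticAt_snd)

theorem analyticAt_Z : AnalyticAt ℂ A.Z 0 := by
  unfold Z
  exact Finset.analyticAt_fun_sum _ fun j _ => (A.hp j).fun_const_smul

theorem γ_zero (ζ : ℂ) : A.γ ζ 0 = 0 := by
  simp [γ, A.hp0]

theorem exists_residual (T : CoreData (Fin n → ℂ) P G M) (hTY : T.Y = S.Y)
    (hTD : T.D = dg (fun i => (S.k i : ℂ))) :
    ∃ C : ℝ, 0 ≤ C ∧ ∀ᶠ x in 𝓝 (0 : Fin n → ℂ), S.Δ x ≠ 0 → ∀ b β : P,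
      b + β = (S.Δ x)⁻¹ • S.Qh x (A.Z x) →
      ‖vel T.Y T.D x b (A.ω x, β) - A.ω x‖ ≤ C * ‖x‖ ^ (N + 1) * (1 + ‖S.Δ x‖⁻¹) := by
  have hne : ∀ ζ : ℂ, ‖ζ‖ = 1 → ζ ≠ 0 := fun ζ hζ =>
    norm_ne_zero_iff.1 (by rw [hζ]; exact one_ne_zero)
  obtain ⟨C₁, hC₁, h1⟩ := eventually_forall_circle_norm_le
    (H := fun ζ x => S.X (A.γ ζ x) - (A.dγ ζ x).comp (S.X x)) (N := N) (fun ζ hζ => by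
      refine AnalyticAt.sub ?_ (analyticAt_clm_comp (A.analyticAt_dγ (hne ζ hζ)) ?_)
      · exact AnalyticAt.comp (g := S.X) (f := fun q : ℂ × (Fin n → ℂ) => A.γ q.1 q.2)
          (by simpa [A.γ_zero] using S.hX) (A.analyticAt_γ (hne ζ hζ))
      · exact AnalyticAt.comp (g := S.X) (f := Prod.snd) S.hX analyticAt_snd) A.hX
  obtain ⟨C₂, hC₂, h2⟩ := eventually_forall_circle_norm_le
    (H := fun ζ x => A.dγ ζ x (A.Z x) - A.γ' ζ x) (N := N) (fun ζ hζ => by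
      refine AnalyticAt.sub (analyticAt_clm_apply (A.analyticAt_dγ (hne ζ hζ)) ?_)
        (A.analyticAt_γ' (hne ζ hζ))
      exact AnalyticAt.comp (g := A.Z) (f := Prod.snd) A.analyticAt_Z analyticAt_snd) A.hZ
  obtain ⟨C₃, hC₃, h3⟩ := A.hfZ.exists_nonneg
  have hdγ : ∀ᶠ x in 𝓝 (0 : Fin n → ℂ), ∀ ζ : ℂ, ‖ζ‖ = 1 → ‖A.dγ ζ x‖ ≤
      ∑ j ∈ A.s, (‖fderiv ℂ (A.p j) 0‖ + 1) := by
    have : ∀ᶠ x in 𝓝 (0 : Fin n → ℂ), ∀ j ∈ A.s,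
        ‖fderiv ℂ (A.p j) x‖ ≤ ‖fderiv ℂ (A.p j) 0‖ + 1 :=
      (eventually_all_finset _).2 fun j _ => by
        have : AnalyticAt ℂ (fderiv ℂ (A.p j)) 0 := (A.hp j).fderiv
        exact eventually_norm_le_add_one this
    filter_upwards [this] with x hx ζ hζ
    refine (norm_sum_le _ _).trans (Finset.sum_le_sum fun j hj => ?_)
    rw [norm_smul, norm_zpow, hζ, one_zpow, one_mul]
    exact hx j hj
  set K₁ := ‖S.Qh 0‖ + 1
  set K₂ := ‖A.Z 0‖ + 1
  set K₃ := ‖S.R 0‖ + 1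
  set K₄ := ∑ j ∈ A.s, (‖fderiv ℂ (A.p j) 0‖ + 1)
  have hK₁ : 0 ≤ K₁ := by positivity
  have hK₂ : 0 ≤ K₂ := by positivity
  have hK₃ : 0 ≤ K₃ := by positivity
  have hK₄ : 0 ≤ K₄ := Finset.sum_nonneg fun _ _ => by positivity
  obtain ⟨C₀, hC₀, h0⟩ := A.exists_small
  have hsm : ∀ᶠ x in 𝓝 (0 : Fin n → ℂ), ‖x‖ + 7 * (C₀ * ‖x‖ ^ (M + 1)) < T.r := by
    have : Continuous fun x : Fin n → ℂ => ‖x‖ + 7 * (C₀ * ‖x‖ ^ (M + 1)) := by fun_prop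
    have h := this.tendsto 0
    simp only [norm_zero, ne_eq, Nat.add_eq_zero_iff, one_ne_zero, and_false, not_false_eq_true,
      zero_pow, mul_zero, add_zero] at h
    exact h.eventually (gt_mem_nhds T.hr)
  refine ⟨C₁ * K₁ * K₂ + K₄ * K₃ * C₃ + C₂, by positivity, ?_⟩
  filter_upwards [h1, h2, h3.bound, eventually_norm_le_add_one S.hQh,
    eventually_norm_le_add_one A.analyticAt_Z, eventually_norm_le_add_one S.hR, hdγ, h0, hsm,
    S.hXQ, A.hsum] with x h1 h2 h3 b1 b2 b3 b4 h0 hsm hXQ hsum hΔ b β hb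
  rw [norm_pow, norm_norm] at h3
  have hΔ' : 0 < ‖S.Δ x‖ := norm_pos_iff.2 hΔ
  have hw : ∀ θ, (constCLM x + prim (A.ω x)) θ = rot S.k (circ θ)⁻¹ (A.γ (circ θ) x) := by
    intro θ
    rw [ContinuousMap.add_apply, constCLM_apply, prim_ω, hsum]
    abel
  have hr : ‖constCLM x + prim (A.ω x)‖ < T.r := by
    refine lt_of_le_of_lt ?_ hsm
    refine (norm_add_le _ _).trans (add_le_add (norm_constCLM_le x) ?_)
    refine (norm_prim_le_seven _).trans ?_
    exact mul_le_mul_of_nonneg_left h0.1 (by norm_num)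
  refine (ContinuousMap.norm_le _ (by positivity)).2 fun θ => ?_
  have e : (vel T.Y T.D x b (A.ω x, β) - A.ω x) θ = Complex.I • rot S.k (circ θ)⁻¹
      (S.X (A.γ (circ θ) x) ((S.Δ x)⁻¹ • S.Qh x (A.Z x)) - A.γ' (circ θ) x) := by
    simp only [vel, ContinuousMap.sub_apply, ContinuousMap.smul_apply, post_apply,
      nem_apply (T.hYc _ hr), hw, ContinuousLinearMap.apply_apply]
    rw [hb, hTY, hTD, SymData.Y, A.ω_eq, ← smul_sub, map_sub, ContinuousLinearMap.comp_apply,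
      rot_rot_inv _ (circ_ne_zero θ)]
    congr 1
    abel
  rw [e, norm_smul, Complex.norm_I, one_mul, norm_rot_apply _ (by rw [norm_inv, norm_circ, inv_one])]
  have hXb : S.X x ((S.Δ x)⁻¹ • S.Qh x (A.Z x)) - A.Z x =
      -((S.Δ x)⁻¹ • S.R x (fderiv ℂ S.f x (A.Z x))) := by
    have := hXQ (A.Z x)
    rw [map_smul, eq_sub_of_add_eq this, smul_sub, smul_smul, inv_mul_cancel₀ hΔ, one_smul]
    abel
  have e2 : S.X (A.γ (circ θ) x) ((S.Δ x)⁻¹ • S.Qh x (A.Z x)) - A.γ' (circ θ) x =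
      (S.X (A.γ (circ θ) x) - (A.dγ (circ θ) x).comp (S.X x)) ((S.Δ x)⁻¹ • S.Qh x (A.Z x))
      + A.dγ (circ θ) x (S.X x ((S.Δ x)⁻¹ • S.Qh x (A.Z x)) - A.Z x)
      + (A.dγ (circ θ) x (A.Z x) - A.γ' (circ θ) x) := by
    rw [map_sub]
    simp only [_root_.sub_apply, ContinuousLinearMap.comp_apply]
    abel
  rw [e2, hXb]
  have n1 : ‖(S.X (A.γ (circ θ) x) - (A.dγ (circ θ) x).comp (S.X x))
      ((S.Δ x)⁻¹ • S.Qh x (A.Z x))‖ ≤ C₁ * ‖x‖ ^ (N + 1) * (‖S.Δ x‖⁻¹ * (K₁ * K₂)) := by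
    refine (ContinuousLinearMap.le_opNorm _ _).trans ?_
    refine mul_le_mul (h1 _ (norm_circ θ)) ?_ (norm_nonneg _) (by positivity)
    rw [norm_smul, norm_inv]
    refine mul_le_mul_of_nonneg_left ?_ (by positivity)
    exact (ContinuousLinearMap.le_opNorm _ _).trans (mul_le_mul b1 b2 (norm_nonneg _) hK₁)
  have n2 : ‖A.dγ (circ θ) x (-((S.Δ x)⁻¹ • S.R x (fderiv ℂ S.f x (A.Z x))))‖ ≤
      K₄ * (‖S.Δ x‖⁻¹ * (K₃ * (C₃ * ‖x‖ ^ (N + 1)))) := by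
    refine (ContinuousLinearMap.le_opNorm _ _).trans ?_
    refine mul_le_mul (b4 _ (norm_circ θ)) ?_ (norm_nonneg _) (by positivity)
    rw [norm_neg, norm_smul, norm_inv]
    refine mul_le_mul_of_nonneg_left ?_ (by positivity)
    exact (ContinuousLinearMap.le_opNorm _ _).trans (mul_le_mul b3 h3 (norm_nonneg _) hK₃)
  refine (norm_add₃_le).trans ((add_le_add_three n1 n2 (h2 _ (norm_circ θ))).trans ?_)
  have hi : 0 ≤ ‖S.Δ x‖⁻¹ := by positivity
  have hp : 0 ≤ ‖x‖ ^ (N + 1) := by positivity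
  generalize ‖S.Δ x‖⁻¹ = δ at *
  generalize ‖x‖ ^ (N + 1) = ξ at *
  have t1 : 0 ≤ C₁ * K₁ * K₂ * ξ := by positivity
  have t2 : 0 ≤ K₄ * K₃ * C₃ * ξ := by positivity
  have t3 : 0 ≤ C₂ * ξ * δ := by positivity
  nlinarith

end Approx

end Approx
section Punctured

variable {F : Type*} [NormedAddCommGroup F]

theorem eventually_norm_le_pow_of_isBigO {y : ℂ → F} {b : ℕ}
    (h : y =O[𝓝[≠] 0] fun t => ‖t‖ ^ (b + 1)) : ∀ᶠ t in 𝓝[≠] 0, ‖y t‖ ≤ ‖t‖ ^ b := by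
  obtain ⟨C, hC, h⟩ := h.exists_nonneg
  have h1 : ∀ᶠ t : ℂ in 𝓝[≠] 0, C * ‖t‖ < 1 := by
    have : Continuous fun t : ℂ => C * ‖t‖ := by fun_prop
    have h := this.tendsto 0
    simp only [norm_zero, mul_zero] at h
    exact (h.eventually (gt_mem_nhds one_pos)).filter_mono nhdsWithin_le_nhds
  filter_upwards [h.bound, h1] with t ht h1
  rw [norm_pow, norm_norm, pow_succ] at ht
  calc ‖y t‖ ≤ C * (‖t‖ ^ b * ‖t‖) := ht
    _ = (C * ‖t‖) * ‖t‖ ^ b := by ring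
    _ ≤ 1 * ‖t‖ ^ b := by gcongr
    _ = ‖t‖ ^ b := one_mul _

theorem isBigO_pow_of_punctured {y : ℂ → F} {N : ℕ} (hc : ContinuousAt y 0)
    (h : y =O[𝓝[≠] 0] fun t => ‖t‖ ^ (N + 1)) : y =O[𝓝 0] fun t => ‖t‖ ^ (N + 1) := by
  have h0 : y 0 = 0 := by
    have h1 : Tendsto (fun t : ℂ => ‖t‖ ^ (N + 1)) (𝓝[≠] 0) (𝓝 0) := by
      have : Continuous fun t : ℂ => ‖t‖ ^ (N + 1) := by fun_prop
      have h := this.tendsto 0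
      simp only [norm_zero, ne_eq, Nat.add_eq_zero_iff, one_ne_zero, and_false, not_false_eq_true,
        zero_pow] at h
      exact h.mono_left nhdsWithin_le_nhds
    exact tendsto_nhds_unique (hc.tendsto.mono_left nhdsWithin_le_nhds) (h.trans_tendsto h1)
  obtain ⟨C, hC⟩ := h.bound
  refine IsBigO.of_bound C ?_
  rw [eventually_nhdsWithin_iff] at hC
  filter_upwards [hC] with t ht
  by_cases h : t = 0
  · simp [h, h0]
  · exact ht h

end Punctured

section Harmonic

variable {n : ℕ} {P G : Type*}
  [NormedAddCommGroup P] [NormedSpace ℂ P] [CompleteSpace P]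
  [NormedAddCommGroup G] [NormedSpace ℂ G] [CompleteSpace G]

/-- A power of the angular variable, as a continuous function. -/
noncomputable def cpow (m : ℤ) : C(Cir, ℂ) where
  toFun θ := circ θ ^ m
  continuous_toFun := continuous_circ.zpow₀ _ fun θ => Or.inl (circ_ne_zero θ)

/-- On a complex line, the harmonics of a function with respect to approximate circle actions are
the jets of a convergent function. -/
theorem SymData.exists_harmonic {M : ℕ} (S : SymData n P G M) (d : ℕ) (hM : 6 * d + 2 ≤ M)
    {v : Fin n → ℂ} {c : ℝ} (hc : 0 < c) (hv : ∀ᶠ t : ℂ in 𝓝 0, c * ‖t‖ ^ d ≤ ‖S.Δ (t • v)‖)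
    {g : (Fin n → ℂ) → ℂ} (hg : AnalyticAt ℂ g 0) (A : ∀ N, Approx S g N) (k₀ : ℤ) :
    ∃ q : ℂ → ℂ, AnalyticAt ℂ q 0 ∧ ∀ N, (fun t : ℂ => (A (N + 3 * d)).h k₀ (t • v) - q t)
      =O[𝓝 0] fun t => ‖t‖ ^ (N + 1) := by
  obtain ⟨T, hTX, hTf, hTY, hTD, hTQ, hTΔ⟩ := S.exists_coreData (by omega)
  obtain ⟨ρ, hρ, z, hz, hzs, hzu⟩ := T.exists_orbit d hM hc (by rw [hTΔ]; exact hv)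
  set B : Cir → ℂ →L[ℂ] ℂ := fun θ => circ θ ^ (-k₀) • ContinuousLinearMap.id ℂ ℂ with hBdef
  set g' : Cir → (Fin n → ℂ) → ℂ := fun θ x => circ θ ^ (-k₀) * g (rot S.k (circ θ) x) with hg'
  have hnz : ∀ θ (m : ℤ), ‖circ θ ^ m‖ = 1 := fun θ m => by rw [norm_zpow, norm_circ, one_zpow]
  obtain ⟨r, hr, K, hK, -, hb, hgc, hgc', hgl, hgq⟩ := exists_rotated_bounds S.k hg (B := B)
    ((continuous_circ.zpow₀ _ fun θ => Or.inl (circ_ne_zero θ)).smul continuous_const)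
    (fun θ w => by simp [hBdef, norm_circ]) (Y := g') (fun θ x => by simp [hBdef, hg'])
  have htv : Tendsto (fun t : ℂ => t • v) (𝓝 0) (𝓝 0) := by
    have : Continuous fun t : ℂ => t • v := by fun_prop
    simpa using this.tendsto 0
  have htv' : Tendsto (fun t : ℂ => t • v) (𝓝[≠] 0) (𝓝 0) := htv.mono_left nhdsWithin_le_nhds
  -- the orbits stay in the domain of `g`
  set u : ℂ → C(Cir, Fin n → ℂ) := fun t => constCLM (t • v) + prim (z t).1 with hu
  have hprim : ∀ ω : C(Cir, Fin n → ℂ), ‖prim ω‖ ≤ 7 * ‖ω‖ := norm_prim_le_seven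
  have hball : ∀ᶠ t in 𝓝 (0 : ℂ), ‖t • v‖ + 7 * ‖t‖ ^ (3 * d + 1) < r ∧ ‖t‖ < ρ := by
    have h1 : Continuous fun t : ℂ => ‖t • v‖ + 7 * ‖t‖ ^ (3 * d + 1) := by fun_prop
    have h2 := h1.tendsto 0
    simp only [zero_smul, norm_zero, ne_eq, Nat.add_eq_zero_iff, one_ne_zero, and_false,
      not_false_eq_true, zero_pow, mul_zero, add_zero] at h2
    refine (h2.eventually (gt_mem_nhds hr)).and ?_
    have := Metric.ball_mem_nhds (0 : ℂ) hρ
    filter_upwards [this] with t ht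
    simpa using ht
  obtain ⟨ρ', hρ', hball⟩ := Metric.eventually_nhds_iff_ball.1 hball
  have hdom : ∀ t ∈ Metric.ball (0 : ℂ) ρ' \ {0}, t ∈ Metric.ball (0 : ℂ) ρ \ {0} := fun t ht =>
    ⟨by simpa using (hball t ht.1).2, ht.2⟩
  have hur : ∀ t ∈ Metric.ball (0 : ℂ) ρ' \ {0}, ‖u t‖ < r := by
    intro t ht
    refine lt_of_le_of_lt ?_ (hball t ht.1).1
    refine (norm_add_le _ _).trans (add_le_add (norm_constCLM_le _) ((hprim _).trans ?_))
    exact mul_le_mul_of_nonneg_left ((norm_fst_le _).trans (hzs t (hdom t ht))) (by norm_num)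
  set τ : ℂ := (2 * (Real.pi : ℂ))⁻¹ with hτ
  set q₀ : ℂ → ℂ := fun t => τ * primLast (nem g' (u t)) with hq₀
  have hq₀d : ∀ t ∈ Metric.ball (0 : ℂ) ρ' \ {0}, DifferentiableAt ℂ q₀ t := by
    intro t ht
    have h1 : DifferentiableAt ℂ z t := hz t (hdom t ht)
    have h2 : DifferentiableAt ℂ u t := by
      rw [hu]
      fun_prop
    have h3 : DifferentiableAt ℂ (fun t => nem g' (u t)) t :=
      DifferentiableAt.comp t (g := nem g') (f := u)
        (differentiableAt_nem hgc hgc' (C := K) (fun θ x y hx hy => by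
          refine (hgq θ x y x hx hy hx).trans (le_of_eq ?_)
          rw [sub_self, norm_zero, add_zero, sq, mul_assoc]) (hur t ht)) h2
    rw [hq₀]
    fun_prop
  have hq₀b : ∀ t ∈ Metric.ball (0 : ℂ) ρ' \ {0}, ‖q₀ t‖ ≤ ‖τ‖ * (2 * Real.pi * K) := by
    intro t ht
    rw [hq₀]
    simp only [norm_mul]
    refine mul_le_mul_of_nonneg_left ((norm_primLast_le _).trans ?_) (norm_nonneg _)
    refine mul_le_mul_of_nonneg_left ?_ (by positivity)
    refine (ContinuousMap.norm_le _ hK).2 fun θ => ?_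
    rw [nem_apply (hgc _ (hur t ht))]
    exact hb _ _ (((u t).norm_coe_le_norm θ).trans_lt (hur t ht))
  have hq := Complex.differentiableOn_update_limUnder_of_bddAbove (f := q₀) (c := 0)
    (Metric.ball_mem_nhds 0 hρ')
    (fun t ht => (hq₀d t ht).differentiableWithinAt)
    ⟨_, by rintro _ ⟨t, ht, rfl⟩; exact hq₀b t ht⟩
  set q := Function.update q₀ 0 (limUnder (𝓝[≠] 0) q₀) with hqdef
  have hqa : AnalyticAt ℂ q 0 :=
    hq.analyticAt (Metric.ball_mem_nhds 0 hρ')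
  refine ⟨q, hqa, fun N => ?_⟩
  have hAc : ContinuousAt (fun t : ℂ => (A (N + 3 * d)).h k₀ (t • v)) 0 :=
    ContinuousAt.comp (g := (A (N + 3 * d)).h k₀) (f := fun t : ℂ => t • v)
      (by simpa using ((A (N + 3 * d)).hh k₀).continuousAt) (by fun_prop)
  refine isBigO_pow_of_punctured (hAc.sub hqa.continuousAt) ?_
  set a := A (N + 3 * d) with ha
  set y : ℂ → C(Cir, Fin n → ℂ) × P := fun t => (a.ω (t • v),
    (S.Δ (t • v))⁻¹ • S.Qh (t • v) (a.Z (t • v)) - T.b (t • v)) with hy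
  have hΔ : ∀ᶠ t : ℂ in 𝓝[≠] 0, S.Δ (t • v) ≠ 0 ∧ ‖S.Δ (t • v)‖⁻¹ * ‖t‖ ^ d ≤ c⁻¹ := by
    filter_upwards [hv.filter_mono nhdsWithin_le_nhds, self_mem_nhdsWithin] with t h1 h2
    have ht : 0 < ‖t‖ := norm_pos_iff.2 h2
    have h3 : 0 < ‖S.Δ (t • v)‖ := lt_of_lt_of_le (by positivity) h1
    refine ⟨norm_pos_iff.1 h3, ?_⟩
    rw [inv_mul_le_iff₀ h3, ← div_eq_mul_inv, le_div_iff₀ hc, mul_comm]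
    exact h1
  have hone : ∀ᶠ t : ℂ in 𝓝[≠] 0, ‖t‖ ≤ 1 := by
    refine Filter.Eventually.filter_mono nhdsWithin_le_nhds ?_
    filter_upwards [Metric.ball_mem_nhds (0 : ℂ) one_pos] with t ht
    simpa using (mem_ball_zero_iff.1 ht).le
  obtain ⟨C₀, hC₀, hs0⟩ := a.exists_small
  have hys : ∀ᶠ t : ℂ in 𝓝[≠] 0, ‖y t‖ ≤ ‖t‖ ^ (3 * d + 1) := by
    refine eventually_norm_le_pow_of_isBigO (IsBigO.prod_left ?_ ?_)
    · refine IsBigO.of_bound (C₀ * ‖v‖ ^ (M + 1)) ?_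
      filter_upwards [htv'.eventually hs0, hone] with t ht h1
      refine ht.1.trans ?_
      rw [norm_smul, mul_pow, norm_pow, norm_norm]
      have : ‖t‖ ^ (M + 1) ≤ ‖t‖ ^ (3 * d + 1 + 1) :=
        pow_le_pow_of_le_one (norm_nonneg _) h1 (by omega)
      calc C₀ * (‖t‖ ^ (M + 1) * ‖v‖ ^ (M + 1))
          ≤ C₀ * (‖t‖ ^ (3 * d + 1 + 1) * ‖v‖ ^ (M + 1)) := by gcongr
        _ = _ := by ring
    · refine IsBigO.of_bound (c⁻¹ * ((‖S.Qh 0‖ + 1) * (C₀ * ‖v‖ ^ (M + 1)))) ?_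
      filter_upwards [htv'.eventually hs0, hone, hΔ,
        htv'.eventually (eventually_norm_le_add_one S.hQh)] with t ht h1 h2 h3
      have e : (S.Δ (t • v))⁻¹ • S.Qh (t • v) (a.Z (t • v)) - T.b (t • v) =
          (S.Δ (t • v))⁻¹ • S.Qh (t • v) (a.Z (t • v) - dg (fun i => (S.k i : ℂ)) (t • v)) := by
        rw [map_sub, smul_sub, CoreData.b, hTΔ, hTQ, hTD]
      rw [e, norm_smul, norm_inv, norm_pow, norm_norm]
      have n1 : ‖S.Qh (t • v) (a.Z (t • v) - dg (fun i => (S.k i : ℂ)) (t • v))‖ ≤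
          (‖S.Qh 0‖ + 1) * (C₀ * ‖t • v‖ ^ (M + 1)) :=
        (ContinuousLinearMap.le_opNorm _ _).trans
          (mul_le_mul h3 ht.2 (norm_nonneg _) (by positivity))
      rw [norm_smul, mul_pow] at n1
      have n2 : ‖t‖ ^ (M + 1) ≤ ‖t‖ ^ d * ‖t‖ ^ (3 * d + 1 + 1) := by
        rw [← pow_add]
        exact pow_le_pow_of_le_one (norm_nonneg _) h1 (by omega)
      calc ‖S.Δ (t • v)‖⁻¹ * _
          ≤ ‖S.Δ (t • v)‖⁻¹ * ((‖S.Qh 0‖ + 1) * (C₀ *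
            ((‖t‖ ^ d * ‖t‖ ^ (3 * d + 1 + 1)) * ‖v‖ ^ (M + 1)))) := by
              refine mul_le_mul_of_nonneg_left (n1.trans ?_) (by positivity)
              gcongr
        _ = (‖S.Δ (t • v)‖⁻¹ * ‖t‖ ^ d) * (((‖S.Qh 0‖ + 1) * (C₀ * ‖v‖ ^ (M + 1))) *
              ‖t‖ ^ (3 * d + 1 + 1)) := by ring
        _ ≤ c⁻¹ * (((‖S.Qh 0‖ + 1) * (C₀ * ‖v‖ ^ (M + 1))) * ‖t‖ ^ (3 * d + 1 + 1)) := by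
              gcongr
              exact h2.2
        _ = _ := by ring
  obtain ⟨C₁, hC₁, hres⟩ := a.exists_residual T hTY hTD
  have hyz : (fun t => y t - z t) =O[𝓝[≠] 0] fun t => ‖t‖ ^ (N + 1) := by
    refine hzu y (N + 1) hys (Eventually.of_forall fun t => a.primLast_ω _) ?_
    refine IsBigO.of_bound (C₁ * ‖v‖ ^ (N + 3 * d + 1) * (1 + c⁻¹)) ?_
    filter_upwards [htv'.eventually hres, hone, hΔ] with t h1 h2 h3
    refine (h1 h3.1 _ _ (by rw [add_sub_cancel])).trans ?_
    rw [norm_smul, norm_pow, norm_norm, mul_pow]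
    have e : ‖t‖ ^ (N + 3 * d + 1) = ‖t‖ ^ d * ‖t‖ ^ (N + 1 + 2 * d) := by
      rw [← pow_add]
      congr 1
      omega
    have n1 : ‖t‖ ^ d ≤ 1 := pow_le_one₀ (norm_nonneg _) h2
    calc C₁ * (‖t‖ ^ (N + 3 * d + 1) * ‖v‖ ^ (N + 3 * d + 1)) * (1 + ‖S.Δ (t • v)‖⁻¹)
        = C₁ * ‖v‖ ^ (N + 3 * d + 1) * (‖t‖ ^ d + ‖S.Δ (t • v)‖⁻¹ * ‖t‖ ^ d) *
          ‖t‖ ^ (N + 1 + 2 * d) := by rw [e]; ring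
      _ ≤ C₁ * ‖v‖ ^ (N + 3 * d + 1) * (1 + c⁻¹) * ‖t‖ ^ (N + 1 + 2 * d) := by
          gcongr
          exact h3.2
  obtain ⟨C₂, hC₂, hgN⟩ := eventually_forall_circle_norm_le
    (H := fun ζ x => g (a.γ ζ x) - ∑ j ∈ a.s, ζ ^ j * a.h j x) (N := N + 3 * d) (fun ζ hζ => by
      have hζ0 : ζ ≠ 0 := norm_ne_zero_iff.1 (by rw [hζ]; exact one_ne_zero)
      refine AnalyticAt.sub ?_ (Finset.analyticAt_fun_sum _ fun j _ => ?_)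
      · exact AnalyticAt.comp (g := g) (f := fun q : ℂ × (Fin n → ℂ) => a.γ q.1 q.2)
          (by simpa [a.γ_zero] using hg) (a.analyticAt_γ hζ0)
      · exact (analyticAt_fst.zpow hζ0).mul
          (AnalyticAt.comp (g := a.h j) (f := Prod.snd) (a.hh j) analyticAt_snd)) a.hg
  set uN : ℂ → C(Cir, Fin n → ℂ) := fun t => constCLM (t • v) + prim (y t).1 with huN
  have hπ : (2 * (Real.pi : ℂ)) ≠ 0 := by
    simp [Real.pi_ne_zero]
  have hcomp : (fun t => a.h k₀ (t • v) - q₀ t) =O[𝓝[≠] 0] fun t => ‖t‖ ^ (N + 1) := by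
    obtain ⟨C₃, hC₃, hyz⟩ := hyz.exists_nonneg
    refine IsBigO.of_bound
      (‖τ‖ * (2 * Real.pi * (C₂ * ‖v‖ ^ (N + 3 * d + 1) + K * (7 * C₃)))) ?_
    have hbN : ∀ᶠ t in 𝓝[≠] (0 : ℂ), t ∈ Metric.ball (0 : ℂ) ρ' \ {0} := by
      filter_upwards [mem_nhdsWithin_of_mem_nhds (Metric.ball_mem_nhds (0 : ℂ) hρ'),
        self_mem_nhdsWithin] with t h1 h2
      exact ⟨h1, h2⟩
    filter_upwards [hbN, hys, hyz.bound, htv'.eventually hgN, htv'.eventually a.hsum, hone]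
      with t ht hys hyz hgN hsum h1
    rw [norm_pow, norm_norm] at hyz ⊢
    have huNr : ‖uN t‖ < r := by
      refine lt_of_le_of_lt ?_ (hball t ht.1).1
      refine (norm_add_le _ _).trans (add_le_add (norm_constCLM_le _) ((hprim _).trans ?_))
      exact mul_le_mul_of_nonneg_left ((norm_fst_le _).trans hys) (by norm_num)
    set H : C(Cir, ℂ) := ∑ j ∈ a.s, a.h j (t • v) • cpow (j - k₀) with hH
    have hHl : τ * primLast H = a.h k₀ (t • v) := by
      rw [hH, map_sum]
      simp only [map_smul, smul_eq_mul]
      have : ∀ j ∈ a.s, a.h j (t • v) * primLast (cpow (j - k₀)) =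
          if j = k₀ then a.h k₀ (t • v) * (2 * (Real.pi : ℂ)) else 0 := by
        intro j _
        rw [primLast_circ_zpow (m := j - k₀) fun θ => rfl]
        by_cases hj : j = k₀
        · simp [hj]
        · simp [hj, sub_eq_zero]
      rw [Finset.sum_congr rfl this, Finset.sum_ite_eq' a.s]
      split_ifs with hk
      · rw [hτ]
        field_simp
      · rw [a.hs k₀ hk]
        simp
    have e : a.h k₀ (t • v) - q₀ t = τ * primLast (H - nem g' (u t)) := by
      rw [map_sub, mul_sub, hHl]
    rw [e, norm_mul, mul_assoc]
    refine mul_le_mul_of_nonneg_left ((norm_primLast_le _).trans ?_) (norm_nonneg _)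
    rw [mul_assoc (2 * Real.pi)]
    refine mul_le_mul_of_nonneg_left ?_ (by positivity)
    refine (ContinuousMap.norm_le _ (by positivity)).2 fun θ => ?_
    have hw : uN t θ = rot S.k (circ θ)⁻¹ (a.γ (circ θ) (t • v)) := by
      simp only [huN, hy]
      rw [ContinuousMap.add_apply, constCLM_apply, a.prim_ω, hsum]
      abel
    have n1 : ‖H θ - g' θ (uN t θ)‖ ≤ C₂ * ‖v‖ ^ (N + 3 * d + 1) * ‖t‖ ^ (N + 1) := by
      have e1 : H θ - g' θ (uN t θ) = -(circ θ ^ (-k₀) * (g (a.γ (circ θ) (t • v)) -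
          ∑ j ∈ a.s, circ θ ^ j * a.h j (t • v))) := by
        rw [hw, hg']
        simp only
        rw [rot_rot_inv _ (circ_ne_zero θ), hH, ContinuousMap.sum_apply, mul_sub, Finset.mul_sum,
          neg_sub]
        congr 1
        refine Finset.sum_congr rfl fun j _ => ?_
        rw [ContinuousMap.smul_apply, smul_eq_mul]
        change a.h j (t • v) * circ θ ^ (j - k₀) = _
        rw [sub_eq_add_neg, zpow_add₀ (circ_ne_zero θ)]
        ring
      rw [e1, norm_neg, norm_mul, hnz, one_mul]
      refine (hgN _ (norm_circ θ)).trans ?_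
      rw [norm_smul, mul_pow]
      have : ‖t‖ ^ (N + 3 * d + 1) ≤ ‖t‖ ^ (N + 1) :=
        pow_le_pow_of_le_one (norm_nonneg _) h1 (by omega)
      calc C₂ * (‖t‖ ^ (N + 3 * d + 1) * ‖v‖ ^ (N + 3 * d + 1))
          ≤ C₂ * (‖t‖ ^ (N + 1) * ‖v‖ ^ (N + 3 * d + 1)) := by gcongr
        _ = _ := by ring
    have n2 : ‖g' θ (uN t θ) - g' θ (u t θ)‖ ≤ K * (7 * C₃) * ‖t‖ ^ (N + 1) := by
      refine (hgl θ _ _ (((uN t).norm_coe_le_norm θ).trans_lt huNr)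
        (((u t).norm_coe_le_norm θ).trans_lt (hur t ht))).trans ?_
      rw [mul_assoc]
      refine mul_le_mul_of_nonneg_left ?_ hK
      have e2 : uN t θ - u t θ = prim (y t - z t).1 θ := by
        simp only [huN, hu, Prod.fst_sub, map_sub, ContinuousMap.add_apply, ContinuousMap.sub_apply]
        abel
      rw [e2]
      refine ((ContinuousMap.norm_coe_le_norm _ θ).trans (hprim _)).trans ?_
      rw [mul_assoc]
      exact mul_le_mul_of_nonneg_left ((norm_fst_le _).trans hyz) (by norm_num)
    rw [ContinuousMap.sub_apply, nem_apply (hgc _ (hur t ht))]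
    calc ‖H θ - g' θ (u t θ)‖ ≤ ‖H θ - g' θ (uN t θ)‖ + ‖g' θ (uN t θ) - g' θ (u t θ)‖ :=
          norm_sub_le_norm_sub_add_norm_sub _ _ _
      _ ≤ _ := by
          refine (add_le_add n1 n2).trans (le_of_eq ?_)
          ring
  refine hcomp.congr' ?_ EventuallyEq.rfl
  filter_upwards [self_mem_nhdsWithin] with t ht
  rw [hqdef, Function.update_of_ne ht]

/-- The harmonics of a convergent function with respect to coherent approximate circle actions
converge. -/
theorem SymData.exists_analyticAt_harmonic {M : ℕ} (S : SymData n P G M) (d : ℕ)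
    (hM : 6 * d + 2 ≤ M) (hΔ : ¬ S.Δ =O[𝓝 0] fun x => ‖x‖ ^ (d + 1))
    {g : (Fin n → ℂ) → ℂ} (hg : AnalyticAt ℂ g 0) (A : ∀ N, Approx S g N) (k₀ : ℤ)
    (hA : ∀ N N', N ≤ N' → (fun x => (A N').h k₀ x - (A N).h k₀ x) =O[𝓝 0]
      fun x => ‖x‖ ^ (N + 1)) :
    ∃ p : (Fin n → ℂ) → ℂ, AnalyticAt ℂ p 0 ∧ ∀ N, (fun x => p x - (A N).h k₀ x) =O[𝓝 0]
      fun x => ‖x‖ ^ (N + 1) := by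
  obtain ⟨B, hB, hBne, hBv⟩ := exists_cone_lower_bound S.hΔ hΔ
  refine exists_analyticAt_of_cone (fun N => (A N).hh k₀) hA hB hBne fun v hv => ?_
  obtain ⟨c, hc, hcv⟩ := hBv v hv
  obtain ⟨q, hq, hqN⟩ := S.exists_harmonic d hM hc hcv hg A k₀
  refine ⟨q, hq, fun N => ?_⟩
  have h1 := isBigO_pow_comp_smul (hA N (N + 3 * d) (by omega)) v
  refine ((hqN N).sub h1).congr_left fun t => ?_
  ring

end Harmonic
section Jets

/-- The algebra of germs at the origin of analytic functions, with representatives. -/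
def O (n : ℕ) : Subalgebra ℂ ((Fin n → ℂ) → ℂ) where
  carrier := {f | AnalyticAt ℂ f 0}
  mul_mem' hf hg := AnalyticAt.mul hf hg
  add_mem' hf hg := AnalyticAt.add hf hg
  algebraMap_mem' _ := analyticAt_const

/-- The ideal of functions vanishing to order `N` at the origin. -/
def vanishing (n N : ℕ) : Ideal (O n) where
  carrier := {f | f.1 =O[𝓝 0] fun x => ‖x‖ ^ (N + 1)}
  add_mem' hf hg := IsBigO.add hf hg
  zero_mem' := isBigO_zero _ _
  smul_mem' g f hf := by
    have h1 : g.1 =O[𝓝 0] fun _ => (1 : ℝ) :=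
      (AnalyticAt.continuousAt g.2).tendsto.isBigO_one ℝ
    have h2 := h1.mul (show f.1 =O[𝓝 0] fun x => ‖x‖ ^ (N + 1) from hf)
    simp only [one_mul] at h2
    exact h2

/-- The algebra of `N`-jets at the origin. -/
def Jet (n N : ℕ) : Type := O n ⧸ vanishing n N

noncomputable instance (n N : ℕ) : CommRing (Jet n N) :=
  inferInstanceAs (CommRing (O n ⧸ vanishing n N))

noncomputable instance (n N : ℕ) : Algebra ℂ (Jet n N) :=
  inferInstanceAs (Algebra ℂ (O n ⧸ vanishing n N))

variable {n N N' : ℕ}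

variable (N) in
/-- The jet of a function. -/
noncomputable def jet : O n →ₐ[ℂ] Jet n N := Ideal.Quotient.mkₐ ℂ (vanishing n N)

theorem jet_surjective : Function.Surjective (jet N : O n → Jet n N) :=
  Ideal.Quotient.mkₐ_surjective ℂ (vanishing n N)

theorem jet_eq_jet {f g : O n} : jet N f = jet N g ↔
    (fun x => f.1 x - g.1 x) =O[𝓝 0] fun x => ‖x‖ ^ (N + 1) := by
  have := Ideal.Quotient.eq (I := vanishing n N) (x := f) (y := g)
  exact this

theorem jet_eq_zero {f : O n} : jet N f = 0 ↔ f.1 =O[𝓝 0] fun x => ‖x‖ ^ (N + 1) :=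
  Ideal.Quotient.eq_zero_iff_mem (I := vanishing n N)

/-- Truncation of jets. -/
noncomputable def trunc (h : N ≤ N') : Jet n N' →ₐ[ℂ] Jet n N :=
  Ideal.Quotient.factorₐ ℂ (I := vanishing n N') (J := vanishing n N)
    (fun _ hf => isBigO_pow_of_le (by omega) hf)

theorem trunc_jet (h : N ≤ N') (f : O n) : trunc h (jet N' f) = jet N f := rfl

variable (n) in
/-- Analytic self-maps fixing the origin; also, vector fields vanishing at the origin. -/
structure Map0 where
  /-- the underlying map -/
  toFun : (Fin n → ℂ) → (Fin n → ℂ)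
  analyticAt : AnalyticAt ℂ toFun 0
  map_zero : toFun 0 = 0

instance : CoeFun (Map0 n) fun _ => (Fin n → ℂ) → (Fin n → ℂ) := ⟨Map0.toFun⟩

/-- The components of a map. -/
def Map0.coord (X : Map0 n) (i : Fin n) : O n :=
  ⟨fun x => X x i, (analyticAt_pi_iff.1 X.analyticAt) i⟩

/-- The map with given components. -/
def Map0.ofCoord (y : Fin n → O n) (h : ∀ i, (y i).1 0 = 0) : Map0 n where
  toFun x i := (y i).1 x
  analyticAt := analyticAt_pi_iff.2 fun i => (y i).2
  map_zero := funext h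

variable (n) in
/-- The identity map. -/
def Map0.id : Map0 n := ⟨fun x => x, analyticAt_id, rfl⟩

/-- A linear map. -/
noncomputable def Map0.ofCLM (L : (Fin n → ℂ) →L[ℂ] (Fin n → ℂ)) : Map0 n := ⟨L, L.analyticAt 0, L.map_zero⟩

theorem Map0.tendsto (φ : Map0 n) : Tendsto φ (𝓝 0) (𝓝 0) := by
  simpa [φ.map_zero] using φ.analyticAt.continuousAt.tendsto

theorem Map0.isBigO (φ : Map0 n) : φ =O[𝓝 0] fun x => ‖x‖ := by
  have := φ.analyticAt.differentiableAt.isBigO_sub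
  simp only [φ.map_zero, sub_zero] at this
  exact this.norm_right

/-- The coordinate functions. -/
def co (i : Fin n) : O n := (Map0.id n).coord i

/-- Composition of a function with a map. -/
def compO (φ : Map0 n) : O n →ₐ[ℂ] O n where
  toFun f := ⟨fun x => f.1 (φ x), AnalyticAt.comp (g := f.1)
    (by have h : AnalyticAt ℂ f.1 0 := f.2
        rwa [← φ.map_zero] at h) φ.analyticAt⟩
  map_one' := rfl
  map_mul' _ _ := rfl
  map_zero' := rfl
  map_add' _ _ := rfl
  commutes' _ := rfl

theorem compO_apply (φ : Map0 n) (f : O n) (x : Fin n → ℂ) : (compO φ f).1 x = f.1 (φ x) := rfl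

theorem isBigO_comp {F : Type*} [NormedAddCommGroup F] (φ : Map0 n) {f : (Fin n → ℂ) → F}
    (hf : f =O[𝓝 0] fun x => ‖x‖ ^ N) : (fun x => f (φ x)) =O[𝓝 0] fun x => ‖x‖ ^ N :=
  (hf.comp_tendsto φ.tendsto).trans (φ.isBigO.norm_left.pow N)

variable (N) in
/-- Composition of a jet with a map. -/
noncomputable def compJ (φ : Map0 n) : Jet n N →ₐ[ℂ] Jet n N :=
  Ideal.quotientMapₐ (I := vanishing n N) (vanishing n N) (compO φ) fun f hf => isBigO_comp φ (f := f.1) hf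

theorem compJ_jet (φ : Map0 n) (f : O n) : compJ N φ (jet N f) = jet N (compO φ f) := rfl

/-- The derivative of a function along a vector field. -/
noncomputable def derO (X : Map0 n) (f : O n) : O n :=
  ⟨fun x => fderiv ℂ f.1 x (X x), analyticAt_clm_apply (AnalyticAt.fderiv f.2) X.analyticAt⟩

theorem analyticAt_val (f : O n) : AnalyticAt ℂ f.1 0 := f.2

theorem eventually_differentiableAt_val (f : O n) : ∀ᶠ x in 𝓝 0, DifferentiableAt ℂ f.1 x :=
  (analyticAt_val f).eventually_analyticAt.mono fun _ h => h.differentiableAt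

theorem jet_eq_of_eventuallyEq {f g : O n} (h : f.1 =ᶠ[𝓝 0] g.1) : jet N f = jet N g := by
  refine jet_eq_jet.2 ((isBigO_zero (fun x : Fin n → ℂ => ‖x‖ ^ (N + 1)) (𝓝 0)).congr' ?_
    EventuallyEq.rfl)
  filter_upwards [h] with x hx
  rw [hx, sub_self]

theorem jet_derO_congr (X : Map0 n) {f g : O n} (h : jet N f = jet N g) :
    jet N (derO X f) = jet N (derO X g) := by
  rw [jet_eq_jet] at h ⊢
  have h1 := fderiv_isBigO_pow ((analyticAt_val f).sub (analyticAt_val g)) h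
  have h2 : (fun x => fderiv ℂ (fun x => f.1 x - g.1 x) x (X x)) =O[𝓝 0]
      fun x => ‖x‖ ^ (N + 1) := by
    refine IsBigO.trans (IsBigO.of_bound 1 (Eventually.of_forall fun x => ?_))
      (h1.norm_left.mul X.isBigO.norm_left)
    rw [one_mul, norm_mul, norm_norm, norm_norm]
    exact ContinuousLinearMap.le_opNorm _ _
  refine h2.congr' ?_ EventuallyEq.rfl
  filter_upwards [(eventually_differentiableAt_val f), (eventually_differentiableAt_val g)] with x hf hg
  rw [fderiv_fun_sub hf hg]
  rfl

variable (N) in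
/-- The action of a vector field on jets. -/
noncomputable def der (X : Map0 n) : Jet n N →ₗ[ℂ] Jet n N where
  toFun a := jet N (derO X (Function.surjInv jet_surjective a))
  map_add' a b := by
    obtain ⟨f, rfl⟩ := jet_surjective a
    obtain ⟨g, rfl⟩ := jet_surjective b
    rw [← map_add, jet_derO_congr X (Function.surjInv_eq jet_surjective _),
      jet_derO_congr X (Function.surjInv_eq jet_surjective (jet N f)),
      jet_derO_congr X (Function.surjInv_eq jet_surjective (jet N g)), ← map_add]
    refine jet_eq_of_eventuallyEq ?_
    filter_upwards [(eventually_differentiableAt_val f), (eventually_differentiableAt_val g)] with x hf hg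
    change fderiv ℂ (f.1 + g.1) x (X x) = fderiv ℂ f.1 x (X x) + fderiv ℂ g.1 x (X x)
    rw [fderiv_add hf hg]
    rfl
  map_smul' c a := by
    obtain ⟨f, rfl⟩ := jet_surjective a
    rw [← map_smul, jet_derO_congr X (Function.surjInv_eq jet_surjective _),
      jet_derO_congr X (Function.surjInv_eq jet_surjective (jet N f)), RingHom.id_apply,
      ← map_smul]
    refine jet_eq_of_eventuallyEq ?_
    filter_upwards [(eventually_differentiableAt_val f)] with x hf
    change fderiv ℂ (c • f.1) x (X x) = c • fderiv ℂ f.1 x (X x)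
    rw [fderiv_const_smul hf]
    rfl

theorem der_jet (X : Map0 n) (f : O n) : der N X (jet N f) = jet N (derO X f) :=
  jet_derO_congr X (Function.surjInv_eq jet_surjective _)

theorem der_mul (X : Map0 n) (a b : Jet n N) : der N X (a * b) = a * der N X b + der N X a * b := by
  obtain ⟨f, rfl⟩ := jet_surjective a
  obtain ⟨g, rfl⟩ := jet_surjective b
  simp only [← map_mul, der_jet, ← map_add]
  refine jet_eq_of_eventuallyEq ?_
  filter_upwards [(eventually_differentiableAt_val f), (eventually_differentiableAt_val g)] with x hf hg
  change fderiv ℂ (f.1 * g.1) x (X x) =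
    f.1 x * fderiv ℂ g.1 x (X x) + fderiv ℂ f.1 x (X x) * g.1 x
  rw [fderiv_mul hf hg]
  simp [mul_comm]

theorem der_co (X : Map0 n) (i : Fin n) : der N X (jet N (co i)) = jet N (X.coord i) := by
  rw [der_jet]
  congr 1
  ext x
  have : (co i : O n).1 = (ContinuousLinearMap.proj (R := ℂ) (φ := fun _ : Fin n => ℂ) i) := rfl
  change fderiv ℂ (co i : O n).1 x (X x) = X x i
  rw [this, ContinuousLinearMap.fderiv]
  rfl

theorem compJ_co (φ : Map0 n) (i : Fin n) : compJ N φ (jet N (co i)) = jet N (φ.coord i) := rfl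

theorem trunc_surjective (h : N ≤ N') : Function.Surjective (trunc h : Jet n N' →ₐ[ℂ] Jet n N) := by
  intro a
  obtain ⟨f, rfl⟩ := jet_surjective a
  exact ⟨jet N' f, rfl⟩

theorem trunc_der (h : N ≤ N') (X : Map0 n) (a : Jet n N') :
    trunc h (der N' X a) = der N X (trunc h a) := by
  obtain ⟨f, rfl⟩ := jet_surjective a
  rw [der_jet, trunc_jet, trunc_jet, der_jet]

theorem compO_derO {X Y φ : Map0 n} (h : ∀ᶠ x in 𝓝 0, fderiv ℂ φ x (Y x) = X (φ x)) (f : O n) :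
    (compO φ (derO X f)).1 =ᶠ[𝓝 0] (derO Y (compO φ f)).1 := by
  filter_upwards [h, φ.tendsto.eventually (eventually_differentiableAt_val f),
    φ.analyticAt.eventually_analyticAt] with x hx hf hφ
  change fderiv ℂ f.1 (φ x) (X (φ x)) = fderiv ℂ (fun x => f.1 (φ x)) x (Y x)
  have e : HasFDerivAt (fun x => f.1 (φ x)) _ x :=
    HasFDerivAt.comp (g := f.1) x hf.hasFDerivAt hφ.differentiableAt.hasFDerivAt
  rw [← hx, e.fderiv]
  rfl

/-- Vector fields related by a map act compatibly on jets. -/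
theorem compJ_der {X Y φ : Map0 n} (h : ∀ᶠ x in 𝓝 0, fderiv ℂ φ x (Y x) = X (φ x)) (a : Jet n N) :
    compJ N φ (der N X a) = der N Y (compJ N φ a) := by
  obtain ⟨f, rfl⟩ := jet_surjective a
  rw [der_jet, compJ_jet, compJ_jet, der_jet]
  exact jet_eq_of_eventuallyEq (compO_derO h f)

theorem derO_comm {X Y : Map0 n} (h : ∀ᶠ x in 𝓝 0, fderiv ℂ X x (Y x) = fderiv ℂ Y x (X x))
    (f : O n) : (derO X (derO Y f)).1 =ᶠ[𝓝 0] (derO Y (derO X f)).1 := by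
  have hd : AnalyticAt ℂ (fderiv ℂ f.1) 0 := (analyticAt_val f).fderiv
  filter_upwards [h, (analyticAt_val f).eventually_analyticAt, hd.eventually_analyticAt,
    X.analyticAt.eventually_analyticAt, Y.analyticAt.eventually_analyticAt] with x hx hf hf' hX hY
  have e : ∀ Z : Map0 n, AnalyticAt ℂ Z x → ∀ u, fderiv ℂ (fun x => fderiv ℂ f.1 x (Z x)) x u =
      fderiv ℂ f.1 x (fderiv ℂ Z x u) + fderiv ℂ (fderiv ℂ f.1) x u (Z x) := by
    intro Z hZ u
    rw [(hf'.differentiableAt.hasFDerivAt.clm_apply hZ.differentiableAt.hasFDerivAt).fderiv]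
    rfl
  change fderiv ℂ (fun x => fderiv ℂ f.1 x (Y x)) x (X x) =
    fderiv ℂ (fun x => fderiv ℂ f.1 x (X x)) x (Y x)
  rw [e X hX, e Y hY, hx]
  congr 1
  have : IsSymmSndFDerivAt ℂ f.1 x := (hf.contDiffAt (n := ⊤)).isSymmSndFDerivAt (by simp)
  exact this _ _

/-- Commuting vector fields act on jets by commuting derivations. -/
theorem der_comm {X Y : Map0 n} (h : ∀ᶠ x in 𝓝 0, fderiv ℂ X x (Y x) = fderiv ℂ Y x (X x))
    (a : Jet n N) : der N X (der N Y a) = der N Y (der N X a) := by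
  obtain ⟨f, rfl⟩ := jet_surjective a
  simp only [der_jet]
  exact jet_eq_of_eventuallyEq (derO_comm h f)

theorem derO_coord (X Y : Map0 n) : ∀ᶠ x in 𝓝 0, ∀ i,
    (derO X (Y.coord i)).1 x = fderiv ℂ Y x (X x) i := by
  filter_upwards [Y.analyticAt.eventually_analyticAt] with x hx i
  change fderiv ℂ (fun x => Y x i) x (X x) = _
  rw [(hasFDerivAt_pi'.1 hx.differentiableAt.hasFDerivAt i).fderiv]
  rfl

end Jets
section Taylor
variable {n N N' : ℕ}

theorem span_monomials : Submodule.span ℂ (Set.range fun s : (Σ k : Fin (N + 1), (Fin k → Fin n)) =>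
    ∏ j, jet N (co (s.2 j))) = ⊤ := by
  refine eq_top_iff.2 fun a _ => ?_
  obtain ⟨f, rfl⟩ := jet_surjective a
  obtain ⟨p, hp⟩ := analyticAt_val f
  have h1 := hp.isBigO_sub_partialSum_pow (N + 1)
  simp only [zero_add] at h1
  let q : O n := ∑ k : Fin (N + 1), ∑ r : Fin k → Fin n,
    p k (fun j => Pi.single (r j) (1 : ℂ)) • ∏ j, co (r j)
  have hq : ∀ x, q.1 x = p.partialSum (N + 1) x := by
    intro x
    have e : ∀ k : ℕ, p k (fun _ => x) = ∑ r : Fin k → Fin n,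
        p k (fun j => Pi.single (r j) (1 : ℂ)) * ∏ j, x (r j) := by
      intro k
      have hx : (fun _ : Fin k => x) = fun _ => ∑ i, x i • (Pi.single i (1 : ℂ) : Fin n → ℂ) := by
        funext _
        ext i
        simp [Finset.sum_apply, Pi.single_apply]
      rw [hx, ContinuousMultilinearMap.map_sum]
      refine Finset.sum_congr rfl fun r _ => ?_
      rw [ContinuousMultilinearMap.map_smul_univ, smul_eq_mul, mul_comm]
    rw [FormalMultilinearSeries.partialSum, Finset.sum_range]
    simp only [e]
    have co_app : ∀ k : ℕ, ∀ r : Fin k → Fin n, (∏ j, co (r j) : O n).1 x = ∏ j, x (r j) := by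
      intro k r
      have := map_prod ((Pi.evalRingHom (fun _ : Fin n → ℂ => ℂ) x).comp (O n).val.toRingHom)
        (fun j => co (r j)) Finset.univ
      exact this
    have hsum : ∀ {ι : Type} (s : Finset ι) (u : ι → O n), (∑ i ∈ s, u i : O n).1 x = ∑ i ∈ s, (u i).1 x := by
      intro ι s u
      have := map_sum ((Pi.evalRingHom (fun _ : Fin n → ℂ => ℂ) x).comp (O n).val.toRingHom)
        u s
      exact this
    simp only [q, hsum]
    refine Finset.sum_congr rfl fun k _ => Finset.sum_congr rfl fun r _ => ?_
    rw [← co_app]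
    rfl
  have : jet N f = jet N q := by
    refine jet_eq_jet.2 ?_
    simp only [hq]
    exact h1
  rw [this, map_sum]
  refine Submodule.sum_mem _ fun k _ => ?_
  rw [map_sum]
  refine Submodule.sum_mem _ fun r _ => ?_
  rw [map_smul, map_prod]
  exact Submodule.smul_mem _ _ (Submodule.subset_span ⟨⟨k, r⟩, rfl⟩)

instance : Module.Finite ℂ (Jet n N) :=
  ⟨Submodule.fg_def.2 ⟨_, Set.finite_range _, span_monomials⟩⟩

theorem adjoin_co : Algebra.adjoin ℂ (Set.range fun i => jet N (co i : O n)) = ⊤ := by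
  refine eq_top_iff.2 fun a _ => ?_
  have : a ∈ Submodule.span ℂ _ := (span_monomials (n := n) (N := N)) ▸ Submodule.mem_top
  refine (Submodule.span_le (p := Subalgebra.toSubmodule (Algebra.adjoin ℂ _))).2 ?_ this
  rintro _ ⟨s, rfl⟩
  exact Subalgebra.prod_mem _ fun j _ => Algebra.subset_adjoin ⟨_, rfl⟩

/-- `φ` and `y` are inverse germs. -/
structure InvPair (φ y : Map0 n) : Prop where
  left : ∀ᶠ x in 𝓝 0, φ (y x) = x
  right : ∀ᶠ x in 𝓝 0, y (φ x) = x

theorem InvPair.symm {φ y : Map0 n} (h : InvPair φ y) : InvPair y φ := ⟨h.2, h.1⟩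

theorem exists_invPair (y : Map0 n) (hy : Function.Bijective (fderiv ℂ y 0)) :
    ∃ φ : Map0 n, InvPair φ y := by
  let i := ContinuousLinearEquiv.ofBijective (fderiv ℂ y 0) (LinearMap.ker_eq_bot.2 hy.1)
    (LinearMap.range_eq_top.2 hy.2)
  have hi : (i : (Fin n → ℂ) →L[ℂ] (Fin n → ℂ)) = fderiv ℂ y 0 :=
    ContinuousLinearEquiv.coe_ofBijective _ _ _
  have hs : HasStrictFDerivAt y (i : (Fin n → ℂ) →L[ℂ] (Fin n → ℂ)) 0 :=
    hi ▸ y.analyticAt.hasStrictFDerivAt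
  let e := hs.toOpenPartialHomeomorph y
  have he : (e : (Fin n → ℂ) → (Fin n → ℂ)) = y := hs.toOpenPartialHomeomorph_coe
  have h0 : (0 : Fin n → ℂ) ∈ e.source := hs.mem_toOpenPartialHomeomorph_source
  have h1 : AnalyticAt ℂ e.symm 0 := by
    have := e.analyticAt_symm' h0 (he ▸ y.analyticAt) (he ▸ hi.symm)
    rwa [he, y.map_zero] at this
  have h2 : e.symm 0 = 0 := by
    have := e.left_inv h0
    rwa [he, y.map_zero] at this
  refine ⟨⟨e.symm, h1, h2⟩, ?_, ?_⟩
  · have := e.eventually_left_inverse h0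
    rwa [he] at this
  · have h3 : (0 : Fin n → ℂ) ∈ e.target := by
      have := e.map_source h0
      rwa [he, y.map_zero] at this
    have := e.eventually_right_inverse h3
    rwa [he] at this

theorem InvPair.fderiv_comp {φ y : Map0 n} (h : InvPair φ y) :
    ∀ᶠ x in 𝓝 0, ∀ u, fderiv ℂ φ (y x) (fderiv ℂ y x u) = u := by
  filter_upwards [h.left.eventually_nhds, y.tendsto.eventually φ.analyticAt.eventually_analyticAt,
    y.analyticAt.eventually_analyticAt] with x hx hφ hy u
  have e : HasFDerivAt (fun x => φ (y x)) _ x :=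
    HasFDerivAt.comp (g := φ) x hφ.differentiableAt.hasFDerivAt hy.differentiableAt.hasFDerivAt
  have e' : HasFDerivAt (fun x => φ (y x)) (ContinuousLinearMap.id ℂ _) x :=
    (hasFDerivAt_id x).congr_of_eventuallyEq hx
  exact congrArg (fun L => L u) (e.unique e')

theorem InvPair.compJ_comp {φ y : Map0 n} (h : InvPair φ y) (a : Jet n N) :
    compJ N y (compJ N φ a) = a := by
  obtain ⟨f, rfl⟩ := jet_surjective a
  rw [compJ_jet, compJ_jet]
  refine jet_eq_of_eventuallyEq ?_
  filter_upwards [h.left] with x hx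
  rw [compO_apply, compO_apply, hx]

theorem InvPair.adjoin {φ y : Map0 n} (h : InvPair φ y) :
    Algebra.adjoin ℂ (Set.range fun i => jet N (y.coord i)) = ⊤ := by
  have h1 : (fun i => jet N (y.coord i)) = compJ N y ∘ fun i => jet N (co i) := rfl
  rw [h1, Set.range_comp, ← AlgHom.map_adjoin, adjoin_co, Algebra.map_top, AlgHom.range_eq_top]
  exact fun a => ⟨_, h.compJ_comp a⟩

/-- Two derivations agreeing on generators are equal. -/
theorem eq_of_leibniz {A : Type*} [CommRing A] [Algebra ℂ A] {D E : A →ₗ[ℂ] A}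
    (hD : ∀ a b, D (a * b) = a * D b + D a * b) (hE : ∀ a b, E (a * b) = a * E b + E a * b)
    {s : Set A} (hs : Algebra.adjoin ℂ s = ⊤) (h : ∀ a ∈ s, D a = E a) : D = E := by
  have one : ∀ F : A →ₗ[ℂ] A, (∀ a b, F (a * b) = a * F b + F a * b) → F 1 = 0 := by
    intro F hF
    have := hF 1 1
    simpa using this
  ext a
  have ha : a ∈ Algebra.adjoin ℂ s := hs ▸ Algebra.mem_top
  induction ha using Algebra.adjoin_induction with
  | mem x hx => exact h x hx
  | algebraMap r => rw [Algebra.algebraMap_eq_smul_one, map_smul, map_smul, one D hD, one E hE]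
  | add x y _ _ hx hy => rw [map_add, map_add, hx, hy]
  | mul x y _ _ hx hy => rw [hD, hE, hx, hy]

end Taylor
section Weights

set_option linter.unusedSectionVars false

/-- A commuting family of endomorphisms. -/
structure CommFam (ι A : Type*) [AddCommGroup A] [Module ℂ A] where
  /-- the endomorphisms -/
  D : ι → Module.End ℂ A
  comm : ∀ k l, Commute (D k) (D l)

namespace CommFam

variable {ι A B : Type*} [AddCommGroup A] [Module ℂ A] [AddCommGroup B] [Module ℂ B]

/-- The generalized weight spaces. -/
def V (T : CommFam ι A) (χ : ι → ℂ) : Submodule ℂ A := ⨅ l, (T.D l).maxGenEigenspace (χ l)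

theorem mem_V {T : CommFam ι A} {χ : ι → ℂ} {a : A} :
    a ∈ T.V χ ↔ ∀ l, ∃ k : ℕ, ((T.D l - χ l • 1) ^ k) a = 0 :=
  Module.End.mem_iInf_maxGenEigenspace_iff _ _ _

theorem map_mem_V {T : CommFam ι A} {T' : CommFam ι B} {F : A →ₗ[ℂ] B}
    (hF : ∀ l a, F (T.D l a) = T'.D l (F a)) {χ : ι → ℂ} {a : A} (ha : a ∈ T.V χ) :
    F a ∈ T'.V χ := by
  rw [mem_V] at ha ⊢
  intro l
  obtain ⟨k, hk⟩ := ha l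
  refine ⟨k, ?_⟩
  have : ∀ (k : ℕ) (a : A), F (((T.D l - χ l • 1) ^ k) a) = ((T'.D l - χ l • 1) ^ k) (F a) := by
    intro k
    induction k with
    | zero => intro a; rfl
    | succ k ih =>
      intro a
      rw [pow_succ, pow_succ, Module.End.mul_apply, Module.End.mul_apply, ih]
      congr 1
      simp [hF]
  rw [← this, hk, map_zero]

variable [Module.Finite ℂ A] [Module.Finite ℂ B]

theorem V_independent (T : CommFam ι A) : iSupIndep T.V :=
  Module.End.independent_iInf_maxGenEigenspace_of_forall_mapsTo _ fun _ _ _ =>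
    Module.End.mapsTo_maxGenEigenspace_of_comm (T.comm _ _) _

theorem iSup_V (T : CommFam ι A) : ⨆ χ, T.V χ = ⊤ :=
  Module.End.iSup_iInf_maxGenEigenspace_eq_top_of_iSup_maxGenEigenspace_eq_top_of_commute _
    (fun i j _ => T.comm i j) fun _ => Module.End.iSup_maxGenEigenspace_eq_top _

theorem finite_weights (T : CommFam ι A) : {χ | T.V χ ≠ ⊥}.Finite :=
  WellFoundedGT.finite_ne_bot_of_iSupIndep T.V_independent

open Classical in
theorem isInternal (T : CommFam ι A) : DirectSum.IsInternal T.V :=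
  (DirectSum.isInternal_submodule_iff_iSupIndep_and_iSup_eq_top _).2 ⟨T.V_independent, T.iSup_V⟩

open Classical in
/-- The endomorphism acting by the scalar `c χ` on the generalized weight space of weight `χ`. -/
noncomputable def wt (T : CommFam ι A) (c : (ι → ℂ) → ℂ) : A →ₗ[ℂ] A :=
  (DirectSum.toModule ℂ (ι → ℂ) A fun χ => c χ • (T.V χ).subtype) ∘ₗ
    (LinearEquiv.ofBijective (DirectSum.coeLinearMap T.V) T.isInternal).symm.toLinearMap

theorem wt_of_mem (T : CommFam ι A) (c : (ι → ℂ) → ℂ) {χ : ι → ℂ} {a : A} (ha : a ∈ T.V χ) :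
    T.wt c a = c χ • a := by
  classical
  have : (LinearEquiv.ofBijective (DirectSum.coeLinearMap T.V) T.isInternal).symm a =
      DirectSum.lof ℂ (ι → ℂ) (fun χ => T.V χ) χ ⟨a, ha⟩ := by
    rw [LinearEquiv.symm_apply_eq]
    exact (DirectSum.coeLinearMap_lof T.V χ ⟨a, ha⟩).symm
  rw [wt, LinearMap.comp_apply]
  erw [this]
  rw [DirectSum.toModule_lof]
  rfl

theorem ext_V (T : CommFam ι A) {F G : A →ₗ[ℂ] B} (h : ∀ χ, ∀ a ∈ T.V χ, F a = G a) : F = G := by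
  ext a
  have ha : a ∈ ⨆ χ, T.V χ := T.iSup_V ▸ Submodule.mem_top
  induction ha using Submodule.iSup_induction' with
  | mem χ a ha => exact h χ a ha
  | zero => rw [map_zero, map_zero]
  | add x y _ _ hx hy => rw [map_add, map_add, hx, hy]

theorem wt_wt (T : CommFam ι A) (c c' : (ι → ℂ) → ℂ) (a : A) :
    T.wt c (T.wt c' a) = T.wt (c * c') a := by
  have : T.wt c ∘ₗ T.wt c' = T.wt (c * c') := T.ext_V fun χ a ha => by
    rw [LinearMap.comp_apply, T.wt_of_mem _ ha, map_smul, T.wt_of_mem _ ha, T.wt_of_mem _ ha,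
      smul_smul, mul_comm]
    rfl
  exact congrArg (fun F => F a) this

theorem wt_congr (T : CommFam ι A) {c c' : (ι → ℂ) → ℂ} (h : ∀ χ, T.V χ ≠ ⊥ → c χ = c' χ) :
    T.wt c = T.wt c' := by
  refine T.ext_V fun χ a ha => ?_
  rw [T.wt_of_mem _ ha, T.wt_of_mem _ ha]
  by_cases hχ : T.V χ = ⊥
  · rw [hχ, Submodule.mem_bot] at ha
    rw [ha, smul_zero, smul_zero]
  · rw [h χ hχ]

theorem wt_one (T : CommFam ι A) (a : A) : T.wt (fun _ => 1) a = a := by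
  have : T.wt (fun _ => 1) = LinearMap.id := T.ext_V fun χ a ha => by
    rw [T.wt_of_mem _ ha, one_smul]; rfl
  exact congrArg (fun F => F a) this

theorem wt_sum (T : CommFam ι A) {κ : Type*} (s : Finset κ) (c : κ → (ι → ℂ) → ℂ) (a : A) :
    T.wt (fun χ => ∑ j ∈ s, c j χ) a = ∑ j ∈ s, T.wt (c j) a := by
  have : T.wt (fun χ => ∑ j ∈ s, c j χ) = ∑ j ∈ s, T.wt (c j) := T.ext_V fun χ a ha => by
    rw [LinearMap.sum_apply, T.wt_of_mem _ ha, Finset.sum_smul]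
    exact Finset.sum_congr rfl fun j _ => (T.wt_of_mem _ ha).symm
  rw [this, LinearMap.sum_apply]

theorem wt_smul (T : CommFam ι A) (r : ℂ) (c : (ι → ℂ) → ℂ) (a : A) :
    T.wt (fun χ => r * c χ) a = r • T.wt c a := by
  have : T.wt (fun χ => r * c χ) = r • T.wt c := T.ext_V fun χ a ha => by
    rw [LinearMap.smul_apply, T.wt_of_mem _ ha, T.wt_of_mem _ ha, mul_smul]
  rw [this, LinearMap.smul_apply]

theorem map_wt {T : CommFam ι A} {T' : CommFam ι B} {F : A →ₗ[ℂ] B}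
    (hF : ∀ l a, F (T.D l a) = T'.D l (F a)) (c : (ι → ℂ) → ℂ) (a : A) :
    F (T.wt c a) = T'.wt c (F a) := by
  have : F ∘ₗ T.wt c = T'.wt c ∘ₗ F := T.ext_V fun χ a ha => by
    rw [LinearMap.comp_apply, LinearMap.comp_apply, T.wt_of_mem _ ha,
      T'.wt_of_mem _ (map_mem_V hF ha), map_smul]
  exact congrArg (fun F => F a) this

theorem wt_D (T : CommFam ι A) (c : (ι → ℂ) → ℂ) (l : ι) (a : A) :
    T.D l (T.wt c a) = T.wt c (T.D l a) :=
  map_wt (T := T) (T' := T) (F := T.D l)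
    (fun k a => congrArg (fun E : Module.End ℂ A => E a) (T.comm l k).eq) c a

theorem wt_mem_V (T : CommFam ι A) {c : (ι → ℂ) → ℂ} {χ : ι → ℂ} (h : ∀ ψ, ψ ≠ χ → c ψ = 0) (a : A) :
    T.wt c a ∈ T.V χ := by
  have ha : a ∈ ⨆ χ, T.V χ := T.iSup_V ▸ Submodule.mem_top
  induction ha using Submodule.iSup_induction' with
  | mem ψ a ha =>
    rw [T.wt_of_mem _ ha]
    by_cases e : ψ = χ
    · exact e ▸ Submodule.smul_mem _ _ ha
    · rw [h ψ e, zero_smul]; exact Submodule.zero_mem _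
  | zero => rw [map_zero]; exact Submodule.zero_mem _
  | add x y _ _ hx hy => rw [map_add]; exact Submodule.add_mem _ hx hy

end CommFam

namespace CommFam

variable {ι A : Type*} [CommRing A] [Algebra ℂ A] {T : CommFam ι A}

theorem mul_mem_V (hT : ∀ l a b, T.D l (a * b) = a * T.D l b + T.D l a * b) {χ ψ : ι → ℂ} {a b : A}
    (ha : a ∈ T.V χ) (hb : b ∈ T.V ψ) : a * b ∈ T.V (χ + ψ) := by
  rw [mem_V] at ha hb ⊢
  intro l
  obtain ⟨p, hp⟩ := ha l
  obtain ⟨q, hq⟩ := hb l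
  refine ⟨p + q, ?_⟩
  have key : ∀ r p q : ℕ, p + q ≤ r → ∀ a b, ((T.D l - χ l • 1) ^ p) a = 0 →
      ((T.D l - ψ l • 1) ^ q) b = 0 → ((T.D l - (χ + ψ) l • 1) ^ r) (a * b) = 0 := by
    intro r
    induction r with
    | zero =>
      intro p q h a b ha _
      obtain rfl : p = 0 := by omega
      rw [pow_zero, Module.End.one_apply] at ha
      rw [ha, zero_mul, map_zero]
    | succ r ih =>
      intro p q h a b ha hb
      rcases p with _ | p
      · rw [pow_zero, Module.End.one_apply] at ha
        rw [ha, zero_mul, map_zero]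
      rcases q with _ | q
      · rw [pow_zero, Module.End.one_apply] at hb
        rw [hb, mul_zero, map_zero]
      have e : (T.D l - (χ + ψ) l • 1) (a * b) =
          (T.D l - χ l • 1) a * b + a * (T.D l - ψ l • 1) b := by
        simp only [LinearMap.sub_apply, LinearMap.add_apply, LinearMap.smul_apply,
          Module.End.one_apply, hT, Pi.add_apply, add_smul, sub_mul, mul_sub, smul_mul_assoc, mul_smul_comm]
        abel
      rw [pow_succ, Module.End.mul_apply, e, map_add,
        ih p (q + 1) (by omega) _ _ (by rw [pow_succ, Module.End.mul_apply] at ha; exact ha) hb,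
        ih (p + 1) q (by omega) _ _ ha (by rw [pow_succ, Module.End.mul_apply] at hb; exact hb),
        add_zero]
  exact key _ p q le_rfl a b hp hq

theorem one_mem_V (hT : ∀ l a b, T.D l (a * b) = a * T.D l b + T.D l a * b) : (1 : A) ∈ T.V 0 := by
  rw [mem_V]
  intro l
  refine ⟨1, ?_⟩
  have := hT l 1 1
  simpa using this

variable [Module.Finite ℂ A]

theorem wt_mul (hT : ∀ l a b, T.D l (a * b) = a * T.D l b + T.D l a * b) {c : (ι → ℂ) → ℂ}
    (hc : ∀ χ ψ, c (χ + ψ) = c χ * c ψ) (a b : A) :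
    T.wt c (a * b) = T.wt c a * T.wt c b := by
  have : (LinearMap.mul ℂ A).compr₂ (T.wt c) = (LinearMap.mul ℂ A).compl₁₂ (T.wt c) (T.wt c) :=
    T.ext_V fun χ a ha => T.ext_V fun ψ b hb => by
      simp only [LinearMap.compr₂_apply, LinearMap.mul_apply', LinearMap.compl₁₂_apply]
      rw [T.wt_of_mem _ ha, T.wt_of_mem _ hb, T.wt_of_mem _ (mul_mem_V hT ha hb), hc,
        smul_mul_smul_comm]
  exact congrArg (fun F => F a b) this

theorem wt_leibniz (hT : ∀ l a b, T.D l (a * b) = a * T.D l b + T.D l a * b) {c : (ι → ℂ) → ℂ}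
    (hc : ∀ χ ψ, c (χ + ψ) = c χ + c ψ) (a b : A) :
    T.wt c (a * b) = a * T.wt c b + T.wt c a * b := by
  have : (LinearMap.mul ℂ A).compr₂ (T.wt c) =
      (LinearMap.mul ℂ A).compl₂ (T.wt c) + (LinearMap.mul ℂ A).comp (T.wt c) :=
    T.ext_V fun χ a ha => T.ext_V fun ψ b hb => by
      simp only [LinearMap.compr₂_apply, LinearMap.mul_apply', LinearMap.add_apply,
        LinearMap.compl₂_apply, LinearMap.comp_apply]
      rw [T.wt_of_mem _ ha, T.wt_of_mem _ hb, T.wt_of_mem _ (mul_mem_V hT ha hb), hc,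
        mul_smul_comm, smul_mul_assoc, add_smul, add_comm]
  exact congrArg (fun F => F a b) this

/-- The weights of an algebra lie in the monoid generated by the weights of generators. -/
theorem weight_mem_closure (hT : ∀ l a b, T.D l (a * b) = a * T.D l b + T.D l a * b)
    {κ : Type*} {y : κ → A} {μ : κ → ι → ℂ} (hy : ∀ i, y i ∈ T.V (μ i))
    (hgen : Algebra.adjoin ℂ (Set.range y) = ⊤) {χ : ι → ℂ} (hχ : T.V χ ≠ ⊥) :
    χ ∈ AddSubmonoid.closure (Set.range μ) := by
  classical
  by_contra hn
  refine hχ (eq_bot_iff.2 fun a ha => ?_)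
  have key : ∀ b ∈ Submonoid.closure (Set.range y),
      ∃ ψ ∈ AddSubmonoid.closure (Set.range μ), b ∈ T.V ψ := by
    intro b hb
    induction hb using Submonoid.closure_induction with
    | mem b hb =>
      obtain ⟨i, rfl⟩ := hb
      exact ⟨μ i, AddSubmonoid.subset_closure ⟨i, rfl⟩, hy i⟩
    | one => exact ⟨0, zero_mem _, one_mem_V hT⟩
    | mul b c _ _ hb hc =>
      obtain ⟨ψ, h1, h2⟩ := hb
      obtain ⟨ψ', h1', h2'⟩ := hc
      exact ⟨ψ + ψ', add_mem h1 h1', mul_mem_V hT h2 h2'⟩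
  let c : (ι → ℂ) → ℂ := fun ψ => if ψ = χ then 1 else 0
  have hz : ∀ b, T.wt c b = 0 := by
    intro b
    have hb : b ∈ Submodule.span ℂ (Submonoid.closure (Set.range y) : Set A) := by
      rw [← Algebra.adjoin_eq_span, hgen]
      exact Submodule.mem_top
    induction hb using Submodule.span_induction with
    | mem b hb =>
      obtain ⟨ψ, h1, h2⟩ := key b hb
      rw [T.wt_of_mem _ h2]
      have : ψ ≠ χ := fun e => hn (e ▸ h1)
      simp [c, this]
    | zero => exact map_zero _
    | add x y _ _ hx hy => rw [map_add, hx, hy, add_zero]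
    | smul r x _ hx => rw [map_smul, hx, smul_zero]
  have := hz a
  rw [T.wt_of_mem _ ha] at this
  simpa [c] using this

end CommFam
end Weights
section Fields

variable {m n N N' : ℕ}

/-- Commuting families of vector fields vanishing at the origin. -/
structure CommVF (m n : ℕ) where
  /-- the vector fields -/
  Z : Fin m → Map0 n
  comm : ∀ k l, ∀ᶠ x in 𝓝 0, fderiv ℂ (Z k) x (Z l x) = fderiv ℂ (Z l) x (Z k x)

/-- The action of commuting vector fields on jets. -/
noncomputable def CommVF.fam (W : CommVF m n) (N : ℕ) : CommFam (Fin m) (Jet n N) where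
  D l := der N (W.Z l)
  comm k l := LinearMap.ext fun a => der_comm (W.comm k l) a

theorem CommVF.leibniz (W : CommVF m n) (l : Fin m) (a b : Jet n N) :
    (W.fam N).D l (a * b) = a * (W.fam N).D l b + (W.fam N).D l a * b := der_mul _ _ _

variable (N) in
/-- The value of a jet at the origin. -/
noncomputable def ev : Jet n N →ₐ[ℂ] ℂ :=
  Ideal.Quotient.liftₐ (vanishing n N) ((Pi.evalAlgHom ℂ (fun _ : Fin n → ℂ => ℂ) 0).comp (O n).val)
    (fun f hf => by
      have h : f.1 =O[𝓝 0] fun x => ‖x - 0‖ ^ (N + 1) := by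
        simp only [sub_zero]; exact hf
      exact h.eq_zero_of_norm_pow N.succ_ne_zero)

theorem ev_jet (f : O n) : ev N (jet N f) = f.1 0 := rfl

theorem CommVF.ev_D (W : CommVF m n) (l : Fin m) (a : Jet n N) : ev N ((W.fam N).D l a) = 0 := by
  obtain ⟨f, rfl⟩ := jet_surjective a
  change ev N (der N (W.Z l) (jet N f)) = 0
  rw [der_jet, ev_jet]
  change fderiv ℂ f.1 0 (W.Z l 0) = 0
  rw [(W.Z l).map_zero, map_zero]

theorem CommVF.ev_eq_zero (W : CommVF m n) {χ : Fin m → ℂ} (hχ : χ ≠ 0) {a : Jet n N}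
    (ha : a ∈ (W.fam N).V χ) : ev N a = 0 := by
  obtain ⟨l, hl⟩ := Function.ne_iff.1 hχ
  rw [CommFam.mem_V] at ha
  obtain ⟨k, hk⟩ := ha l
  have key : ∀ (k : ℕ) (a : Jet n N), ev N ((((W.fam N).D l - χ l • 1) ^ k) a) = (- χ l) ^ k * ev N a := by
    intro k
    induction k with
    | zero => intro a; simp
    | succ k ih =>
      intro a
      rw [pow_succ, Module.End.mul_apply, ih, pow_succ, mul_assoc]
      congr 1
      rw [LinearMap.sub_apply, map_sub, W.ev_D, LinearMap.smul_apply, map_smul]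
      simp
  have := key k a
  rw [hk, map_zero] at this
  exact (mul_eq_zero.1 this.symm).resolve_left (pow_ne_zero _ (neg_ne_zero.2 hl))

theorem CommVF.ev_wt (W : CommVF m n) (c : (Fin m → ℂ) → ℂ) (a : Jet n N) :
    ev N ((W.fam N).wt c a) = c 0 * ev N a := by
  have : (ev N).toLinearMap ∘ₗ (W.fam N).wt c = c 0 • (ev N).toLinearMap :=
    (W.fam N).ext_V fun χ a ha => by
      rw [LinearMap.comp_apply, (W.fam N).wt_of_mem _ ha, map_smul, LinearMap.smul_apply]
      by_cases h : χ = 0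
      · rw [h]
      · rw [AlgHom.toLinearMap_apply, W.ev_eq_zero h ha, smul_zero, smul_zero]
  exact congrArg (fun F => F a) this

theorem CommVF.trunc_wt (W : CommVF m n) (h : N ≤ N') (c : (Fin m → ℂ) → ℂ) (a : Jet n N') :
    trunc h ((W.fam N').wt c a) = (W.fam N).wt c (trunc h a) :=
  CommFam.map_wt (T := W.fam N') (T' := W.fam N) (F := (trunc h).toLinearMap)
    (fun _ a => trunc_der h _ a) c a

/-- Families of vector fields related by a map. -/
def Rel (φ : Map0 n) (W W' : CommVF m n) : Prop :=
  ∀ l, ∀ᶠ x in 𝓝 0, fderiv ℂ φ x (W'.Z l x) = W.Z l (φ x)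

theorem Rel.mem_V {φ : Map0 n} {W W' : CommVF m n} (h : Rel φ W W') {χ : Fin m → ℂ}
    {a : Jet n N} (ha : a ∈ (W.fam N).V χ) : compJ N φ a ∈ (W'.fam N).V χ :=
  CommFam.map_mem_V (T := W.fam N) (T' := W'.fam N) (F := (compJ N φ).toLinearMap)
    (fun l a => compJ_der (h l) a) ha

theorem InvPair.fderiv_comp' {φ y : Map0 n} (h : InvPair φ y) :
    ∀ᶠ x in 𝓝 0, ∀ u, fderiv ℂ φ x (fderiv ℂ y (φ x) u) = u := by
  filter_upwards [φ.tendsto.eventually h.fderiv_comp, h.right] with x hx hx' u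
  rw [hx'] at hx
  exact hx u

theorem exists_rel (W : CommVF m n) {φ y : Map0 n} (hy : InvPair φ y) : ∃ W', Rel φ W W' := by
  let Z' : Fin m → Map0 n := fun l => Map0.ofCoord (fun i => compO φ (derO (W.Z l) (y.coord i)))
    (fun i => by
      change fderiv ℂ _ (φ 0) (W.Z l (φ 0)) = 0
      rw [φ.map_zero, (W.Z l).map_zero, map_zero])
  have hrel : ∀ l, ∀ᶠ x in 𝓝 0, fderiv ℂ φ x (Z' l x) = W.Z l (φ x) := by
    intro l
    filter_upwards [φ.tendsto.eventually (derO_coord (W.Z l) y), hy.fderiv_comp'] with x h1 h2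
    have : Z' l x = fderiv ℂ y (φ x) (W.Z l (φ x)) := funext h1
    rw [this, h2]
  refine ⟨⟨Z', fun k l => ?_⟩, hrel⟩
  have e : ∀ k l, ∀ᶠ x in 𝓝 0, ∀ i, fderiv ℂ (Z' k) x (Z' l x) i =
      (compO φ (derO (W.Z l) (derO (W.Z k) (y.coord i)))).1 x := by
    intro k l
    filter_upwards [derO_coord (Z' l) (Z' k), eventually_all.2 fun i =>
      compO_derO (hrel l) (derO (W.Z k) (y.coord i))] with x h1 h2 i
    rw [← h1, h2]
    rfl
  filter_upwards [e k l, e l k, eventually_all.2 fun i =>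
    φ.tendsto.eventually (derO_comm (W.comm k l) (y.coord i))] with x h1 h2 h3
  ext i
  rw [h1, h2]
  exact (h3 i).symm

end Fields
section Prepared

variable {m n N N' : ℕ}

/-- The coordinates are generalized weight vectors in the algebra of `N`-jets. -/
def Prep (W : CommVF m n) (μ : Fin n → Fin m → ℂ) (N : ℕ) : Prop :=
  ∀ i, jet N (co i) ∈ (W.fam N).V (μ i)

theorem der_dg_co (a : Fin n → ℂ) (i : Fin n) :
    der N (Map0.ofCLM (dg a)) (jet N (co i)) = a i • jet N (co i) := by
  rw [der_co, ← map_smul]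
  congr 1
  ext x
  change dg a x i = a i * x i
  rw [dg_apply]

theorem Prep.wt_add {W : CommVF m n} {μ : Fin n → Fin m → ℂ} (h : Prep W μ N)
    {ρ : (Fin m → ℂ) → ℂ} (hρ : ∀ χ ψ, ρ (χ + ψ) = ρ χ + ρ ψ) :
    (W.fam N).wt ρ = der N (Map0.ofCLM (dg fun i => ρ (μ i))) := by
  refine eq_of_leibniz (CommFam.wt_leibniz W.leibniz hρ) (der_mul _) adjoin_co ?_
  rintro _ ⟨i, rfl⟩
  rw [(W.fam N).wt_of_mem _ (h i), der_dg_co]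

theorem Prep.wt_mul {W : CommVF m n} {μ : Fin n → Fin m → ℂ} (h : Prep W μ N)
    {c : (Fin m → ℂ) → ℂ} (hc : ∀ χ ψ, c (χ + ψ) = c χ * c ψ) (hc0 : c 0 = 1) (a : Jet n N) :
    (W.fam N).wt c a = compJ N (Map0.ofCLM (dg fun i => c (μ i))) a := by
  have h1 : (W.fam N).wt c 1 = 1 := by
    rw [(W.fam N).wt_of_mem _ (CommFam.one_mem_V W.leibniz), hc0, one_smul]
  have : AlgHom.ofLinearMap ((W.fam N).wt c) h1 (CommFam.wt_mul W.leibniz hc) =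
      compJ N (Map0.ofCLM (dg fun i => c (μ i))) := by
    refine AlgHom.ext_of_adjoin_eq_top adjoin_co ?_
    rintro _ ⟨i, rfl⟩
    change (W.fam N).wt c _ = _
    rw [(W.fam N).wt_of_mem _ (h i), compJ_co, ← map_smul]
    congr 1
    ext x
    change c (μ i) * x i = dg (fun i => c (μ i)) x i
    rw [dg_apply]
  exact congrArg (fun F => F a) this

theorem Prep.commutes {W : CommVF m n} {μ : Fin n → Fin m → ℂ} (h : ∀ N, Prep W μ N) (l : Fin m) :
    ∀ᶠ x in 𝓝 0, fderiv ℂ (W.Z l) x (dg (fun i => μ i l) x) = dg (fun i => μ i l) (W.Z l x) := by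
  let S := Map0.ofCLM (dg fun i => μ i l)
  have key : ∀ i N, jet N (derO S ((W.Z l).coord i)) = jet N (μ i l • (W.Z l).coord i) := by
    intro i N
    have e := (h N).wt_add (ρ := fun χ => χ l) (fun _ _ => rfl)
    have e1 := (W.fam N).wt_D (fun χ => χ l) l (jet N (co i))
    rw [e] at e1
    change der N (W.Z l) (der N S (jet N (co i))) = der N S (der N (W.Z l) (jet N (co i))) at e1
    rw [der_dg_co, map_smul, der_co, der_jet] at e1
    rw [← e1, map_smul]
  have : ∀ i, ∀ᶠ x in 𝓝 0, (derO S ((W.Z l).coord i)).1 x = μ i l * W.Z l x i := by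
    intro i
    have := eventually_eq_zero_of_isBigO_pow
      ((analyticAt_val (derO S ((W.Z l).coord i))).sub (analyticAt_val (μ i l • (W.Z l).coord i)))
      fun N => jet_eq_jet.1 (key i N)
    filter_upwards [this] with x hx
    exact sub_eq_zero.1 hx
  filter_upwards [eventually_all.2 this, derO_coord S (W.Z l)] with x h1 h2
  ext i
  rw [dg_apply, ← h1, h2]
  rfl

/-- Linear forms as functions. -/
noncomputable def linO (α : (Fin n → ℂ) →L[ℂ] ℂ) : O n := ⟨α, α.analyticAt 0⟩

theorem jet_linO_eq_zero {α : (Fin n → ℂ) →L[ℂ] ℂ} (h : jet 1 (linO α) = 0) : α = 0 := by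
  have h1 : (fun x => α x) =O[𝓝 0] fun x => ‖x‖ ^ (1 + 1) := jet_eq_zero.1 h
  have h2 := (fderiv_isBigO_pow (α.analyticAt 0) h1)
  have h3 : (fun x => fderiv ℂ α x) =O[𝓝 0] fun x : Fin n → ℂ => ‖x - 0‖ ^ 1 := by
    simpa only [sub_zero] using h2
  have := h3.eq_zero_of_norm_pow one_ne_zero
  rwa [ContinuousLinearMap.fderiv] at this

theorem der_linO (X : Map0 n) (α : (Fin n → ℂ) →L[ℂ] ℂ) :
    der 1 X (jet 1 (linO α)) = jet 1 (linO (α.comp (fderiv ℂ X 0))) := by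
  rw [der_jet]
  refine jet_eq_jet.2 ?_
  have h1 : (fun x => X x - X 0 - fderiv ℂ X 0 (x - 0)) =O[𝓝 0] fun x => ‖x - 0‖ ^ 2 := by
    obtain ⟨p, hp⟩ := X.analyticAt
    have h := hp.isBigO_sub_partialSum_pow 2
    simp only [zero_add] at h
    refine h.congr (fun x => ?_) fun x => by rw [sub_zero]
    rw [hp.fderiv_eq, FormalMultilinearSeries.partialSum, Finset.sum_range_succ,
      Finset.sum_range_one, hp.coeff_zero, sub_sub]
    simp only [sub_zero]
    rfl
  simp only [X.map_zero, sub_zero] at h1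
  refine ((α.isBigO_comp _ _).trans h1).congr (fun x => ?_) fun _ => rfl
  change α _ = fderiv ℂ α x (X x) - α (fderiv ℂ X 0 x)
  rw [ContinuousLinearMap.fderiv, map_sub]

theorem der_pow_linO (X : Map0 n) (c : ℂ) (k : ℕ) (α : (Fin n → ℂ) →L[ℂ] ℂ) :
    ((der 1 X - c • 1) ^ k) (jet 1 (linO α)) =
      jet 1 (linO (α.comp ((fderiv ℂ X 0 - c • 1) ^ k))) := by
  induction k generalizing α with
  | zero => rfl
  | succ k ih =>
    have e : (der 1 X - c • 1) (jet 1 (linO α)) = jet 1 (linO (α.comp (fderiv ℂ X 0 - c • 1))) := by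
      rw [LinearMap.sub_apply, der_linO, LinearMap.smul_apply, Module.End.one_apply, ← map_smul,
        ← map_sub]
      congr 1
      ext x
      change α (fderiv ℂ X 0 x) - c * α x = α (fderiv ℂ X 0 x - c • x)
      rw [map_sub, map_smul, smul_eq_mul]
    rw [pow_succ, Module.End.mul_apply, e, ih, pow_succ']
    rfl

theorem isSemisimple_dg (a : Fin n → ℂ) :
    Module.End.IsSemisimple (dg a : Module.End ℂ (Fin n → ℂ)) := by
  classical
  let p : Polynomial ℂ := ∏ z ∈ Finset.univ.image a, (Polynomial.X - Polynomial.C z)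
  have hp : p.Separable := Polynomial.separable_prod_X_sub_C_iff'.2 fun _ _ _ _ h => h
  refine Module.End.isSemisimple_of_squarefree_aeval_eq_zero hp.squarefree ?_
  have key : ∀ (q : Polynomial ℂ) (u : Fin n → ℂ) (i : Fin n),
      Polynomial.aeval (dg a : Module.End ℂ (Fin n → ℂ)) q u i = q.eval (a i) * u i := by
    intro q
    induction q using Polynomial.induction_on' with
    | add q r hq hr => intro u i; simp [hq, hr, add_mul]
    | monomial k c =>
      intro u i
      have : ∀ (k : ℕ) u, ((dg a : Module.End ℂ (Fin n → ℂ)) ^ k) u i = a i ^ k * u i := by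
        intro k
        induction k with
        | zero => intro u; simp
        | succ k ih =>
          intro u
          rw [pow_succ, Module.End.mul_apply, ih, pow_succ, mul_assoc]
          congr 1
          exact dg_apply _ _ _
      simp [Polynomial.aeval_monomial, this, Algebra.algebraMap_eq_smul_one, mul_assoc]
  ext u i
  rw [LinearMap.comp_apply, key, Polynomial.eval_prod, Finset.prod_eq_zero (i := a i)]
  · simp
  · simp
  · simp

theorem Prep.isNilpotent {W : CommVF m n} {μ : Fin n → Fin m → ℂ} (h : Prep W μ 1) (l : Fin m)
    (hc : Commute (fderiv ℂ (W.Z l) 0) (dg fun i => μ i l)) :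
    IsNilpotent (fderiv ℂ (W.Z l) 0 - dg fun i => μ i l) := by
  set B := fderiv ℂ (W.Z l) 0
  set S := dg fun i => μ i l
  have h1 : ∀ i, ∃ k : ℕ, (ContinuousLinearMap.proj (R := ℂ) (φ := fun _ : Fin n => ℂ) i).comp
      ((B - μ i l • 1) ^ k) = 0 := by
    intro i
    obtain ⟨k, hk⟩ := CommFam.mem_V.1 (h i) l
    refine ⟨k, jet_linO_eq_zero ?_⟩
    rw [← der_pow_linO]
    exact hk
  choose K hK using h1
  refine ⟨∑ i, K i, ?_⟩
  have hsc : ∀ (c : ℂ) (L : (Fin n → ℂ) →L[ℂ] (Fin n → ℂ)), Commute (c • 1) L := fun c L => by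
    ext u i
    simp
  have h2 : ∀ i (k : ℕ) u, ((B - S) ^ k) u i = ((B - μ i l • 1) ^ k) u i := by
    intro i k
    induction k with
    | zero => intro u; rfl
    | succ k ih =>
      intro u
      have hcom : Commute ((B - μ i l • 1) ^ k) (S - μ i l • 1) :=
        ((hc.sub_left (hsc _ _)).sub_right (hsc _ _).symm).pow_left k
      have e1 : ((B - S) ^ (k + 1)) u = ((B - S) ^ k) ((B - S) u) := by rw [pow_succ]; rfl
      have e2 : ((B - μ i l • 1) ^ (k + 1)) u = ((B - μ i l • 1) ^ k) ((B - μ i l • 1) u) := by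
        rw [pow_succ]; rfl
      have e3 : (B - S) u = (B - μ i l • 1) u - (S - μ i l • 1) u := by
        simp
      have e4 : ((B - μ i l • 1) ^ k) ((S - μ i l • 1) u) =
          (S - μ i l • 1) (((B - μ i l • 1) ^ k) u) :=
        congrArg (fun L : (Fin n → ℂ) →L[ℂ] (Fin n → ℂ) => L u) hcom.eq
      rw [e1, e2, ih, e3, map_sub, e4, Pi.sub_apply, sub_eq_self]
      simp [S, dg_apply]
  ext u i
  have hle : K i ≤ ∑ i, K i := Finset.single_le_sum (fun _ _ => Nat.zero_le _) (Finset.mem_univ i)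
  rw [h2, ← Nat.add_sub_cancel' hle, pow_add]
  exact congrArg (fun L => L (((B - μ i l • 1) ^ (∑ i, K i - K i)) u)) (hK i)

end Prepared
section NormalForm

variable {m n N N' : ℕ}

theorem Prep.normalForm {W : CommVF m n} {μ : Fin n → Fin m → ℂ} (h : ∀ N, Prep W μ N) (l : Fin m) :
    ∃ t ∈ 𝓝 (0 : Fin n → ℂ), ∀ U ⊆ t, InPDNormalForm ℂ (W.Z l) U := by
  have h0 := Prep.commutes h l
  set S := dg fun i => μ i l with hS
  have hZ := (W.Z l).analyticAt
  have hd : AnalyticAt ℂ (fderiv ℂ (W.Z l)) 0 := hZ.fderiv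
  have hcom : Commute (fderiv ℂ (W.Z l) 0) S := by
    have e1 := (hd.differentiableAt.hasFDerivAt.clm_apply (S.hasFDerivAt (x := 0)))
    have e2 : HasFDerivAt (fun x => S (W.Z l x)) (S.comp (fderiv ℂ (W.Z l) 0)) 0 :=
      S.hasFDerivAt.comp (0 : Fin n → ℂ) hZ.differentiableAt.hasFDerivAt
    have e3 := (e2.congr_of_eventuallyEq h0).unique e1
    ext1 u
    have := congrArg (fun L => L u) e3
    simpa using this.symm
  refine ⟨_, h0, fun U hU => ⟨S, fderiv ℂ (W.Z l) 0 - S, by abel, isSemisimple_dg _, ?_, ?_, ?_⟩⟩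
  · obtain ⟨k, hk⟩ := Prep.isNilpotent (h 1) l hcom
    refine ⟨k, LinearMap.ext fun u => ?_⟩
    have e : ∀ (L : (Fin n → ℂ) →L[ℂ] (Fin n → ℂ)) (k : ℕ),
        ((L : Module.End ℂ (Fin n → ℂ)) ^ k) u = (L ^ k) u := by
      intro L k
      rw [Module.End.pow_apply, FunLike.coe_pow_eq_iterate]
      rfl
    rw [e, hk]
    rfl
  · exact (hcom.sub_left (Commute.refl S)).symm.eq
  · intro x hx
    rw [VectorField.lieBracket_eq]
    change fderiv ℂ S x (W.Z l x) - fderiv ℂ (W.Z l) x (S x) = 0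
    rw [ContinuousLinearMap.fderiv, (hU hx : _ = _), sub_self]

/-- Coordinates which are generalized weight vectors to all orders provide a normalization. -/
theorem exists_normalization (W : CommVF m n) {y : Map0 n} {μ : Fin n → Fin m → ℂ}
    (hy : Function.Bijective (fderiv ℂ y 0)) (h : ∀ N i, jet N (y.coord i) ∈ (W.fam N).V (μ i)) :
    ∃ (φ : Map0 n) (W' : CommVF m n), Function.Bijective (fderiv ℂ φ 0) ∧ Rel φ W W' ∧
      ∀ l, ∃ t ∈ 𝓝 (0 : Fin n → ℂ), ∀ U ⊆ t, InPDNormalForm ℂ (W'.Z l) U := by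
  obtain ⟨φ, hφ⟩ := exists_invPair y hy
  obtain ⟨W', hW'⟩ := exists_rel W hφ
  refine ⟨φ, W', ?_, hW', Prep.normalForm (μ := μ) fun N i => ?_⟩
  · have h1 := hφ.symm.fderiv_comp.self_of_nhds
    have h2 := hφ.fderiv_comp'.self_of_nhds
    rw [φ.map_zero] at h1 h2
    exact ⟨Function.LeftInverse.injective (g := fderiv ℂ y 0) h1,
      Function.RightInverse.surjective (g := fderiv ℂ y 0) h2⟩
  · have := hW'.mem_V (h N i)
    rwa [compJ_jet, show jet N (compO φ (y.coord i)) = jet N (co i) from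
      jet_eq_of_eventuallyEq (hφ.right.mono fun x hx => congrFun hx i)] at this

end NormalForm
section Splitting

open Matrix

variable {m n q : ℕ} (X : Matrix (Fin n) (Fin m) ℂ) (F : Matrix (Fin q) (Fin n) ℂ)
  (T : Matrix (Fin m) (Fin n) ℂ) (W : Matrix (Fin n) (Fin q) ℂ)

/-- The common denominator of the splitting. -/
noncomputable def splitDen : ℂ := ((F * W).det * (T * X).det) ^ 2

/-- The left inverse of `X`, up to a denominator. -/
noncomputable def splitLeft : Matrix (Fin m) (Fin n) ℂ :=
  ((F * W).det * (T * X).det) • ((T * X).adjugate * (T * ((F * W).det • 1 - W * (F * W).adjugate * F)))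

/-- The right inverse of `F`, up to a denominator. -/
noncomputable def splitRight : Matrix (Fin n) (Fin q) ℂ :=
  ((T * X).det ^ 2 * (F * W).det) • (W * (F * W).adjugate)

variable {X F}

theorem splitLeft_mul (h : F * X = 0) : splitLeft X F T W * X = splitDen X F T W • 1 := by
  rw [splitLeft, smul_mul, Matrix.mul_assoc, Matrix.mul_assoc, Matrix.sub_mul, Matrix.mul_assoc _ F, h,
    Matrix.mul_zero, sub_zero, smul_mul, Matrix.one_mul, Matrix.mul_smul, Matrix.mul_smul,
    adjugate_mul, smul_smul, smul_smul, splitDen]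
  congr 1
  ring

theorem mul_splitLeft_add (e : Fin n ≃ Fin m ⊕ Fin q) (h : F * X = 0) :
    X * splitLeft X F T W + splitRight X F T W * F = splitDen X F T W • 1 := by
  by_cases hD : (F * W).det * (T * X).det = 0
  · have h1 : (T * X).det ^ 2 * (F * W).det = 0 := by
      rw [sq, mul_assoc, mul_comm (T * X).det (F * W).det, hD, mul_zero]
    rw [splitLeft, splitRight, splitDen, hD, h1]
    simp
  have hD' : splitDen X F T W ≠ 0 := pow_ne_zero 2 hD
  have hR : F * splitRight X F T W = splitDen X F T W • 1 := by
    rw [splitRight, Matrix.mul_smul, ← Matrix.mul_assoc, mul_adjugate, smul_smul, splitDen]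
    congr 1
    ring
  have hQR : splitLeft X F T W * splitRight X F T W = 0 := by
    have : ((F * W).det • 1 - W * (F * W).adjugate * F) * (W * (F * W).adjugate) = 0 := by
      rw [Matrix.sub_mul, Matrix.mul_assoc _ F, ← Matrix.mul_assoc F, mul_adjugate, smul_mul,
        Matrix.one_mul, Matrix.mul_smul, Matrix.mul_one, sub_self]
    rw [splitLeft, splitRight, smul_mul, Matrix.mul_smul, Matrix.mul_assoc, Matrix.mul_assoc, this,
      Matrix.mul_zero, Matrix.mul_zero, smul_zero, smul_zero]
  set D := splitDen X F T W
  have key : fromRows (splitLeft X F T W) F * fromCols (D⁻¹ • X) (D⁻¹ • splitRight X F T W) = 1 := by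
    rw [fromRows_mul_fromCols, Matrix.mul_smul, Matrix.mul_smul, Matrix.mul_smul, Matrix.mul_smul,
      splitLeft_mul T W h, hQR, h, hR, smul_smul, inv_mul_cancel₀ hD', smul_zero, smul_zero, smul_smul,
      inv_mul_cancel₀ hD', one_smul, one_smul, fromBlocks_one]
  have := (fromCols_mul_fromRows_eq_one_comm e _ _ _ _).2 key
  rw [fromCols_mul_fromRows, smul_mul, smul_mul, ← smul_add] at this
  rw [← this, smul_smul, mul_inv_cancel₀ hD', one_smul]

theorem analyticAt_det {E : Type*} [NormedAddCommGroup E] [NormedSpace ℂ E] {p : ℕ} {A : E → Matrix (Fin p) (Fin p) ℂ} {x : E}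
    (h : ∀ i j, AnalyticAt ℂ (fun y => A y i j) x) : AnalyticAt ℂ (fun y => (A y).det) x := by
  simp only [det_apply']
  exact Finset.analyticAt_fun_sum _ fun σ _ =>
    analyticAt_const.mul (Finset.analyticAt_fun_prod _ fun i _ => h _ _)

theorem analyticAt_adjugate {E : Type*} [NormedAddCommGroup E] [NormedSpace ℂ E] {p : ℕ} {A : E → Matrix (Fin p) (Fin p) ℂ} {x : E}
    (h : ∀ i j, AnalyticAt ℂ (fun y => A y i j) x) (i j : Fin p) :
    AnalyticAt ℂ (fun y => (A y).adjugate i j) x := by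
  simp only [adjugate_apply]
  refine analyticAt_det fun a b => ?_
  by_cases hab : a = j
  · simp only [updateRow_apply, hab, if_true]
    exact analyticAt_const
  · simp only [updateRow_apply, hab, if_false]
    exact h a b

theorem analyticAt_mul_apply {E : Type*} [NormedAddCommGroup E] [NormedSpace ℂ E] {a b c : ℕ}
    {A : E → Matrix (Fin a) (Fin b) ℂ} {B : E → Matrix (Fin b) (Fin c) ℂ} {x : E}
    (hA : ∀ i j, AnalyticAt ℂ (fun y => A y i j) x) (hB : ∀ i j, AnalyticAt ℂ (fun y => B y i j) x)
    (i : Fin a) (j : Fin c) : AnalyticAt ℂ (fun y => (A y * B y) i j) x := by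
  simp only [mul_apply]
  exact Finset.analyticAt_fun_sum _ fun k _ => (hA i k).mul (hB k j)

theorem analyticAt_clm_of_apply {E F : Type*} [NormedAddCommGroup E] [NormedSpace ℂ E]
    [NormedAddCommGroup F] [NormedSpace ℂ F] {p : ℕ} {A : E → (Fin p → ℂ) →L[ℂ] F} {x : E}
    (h : ∀ j, AnalyticAt ℂ (fun y => A y (Pi.single j 1)) x) : AnalyticAt ℂ A x := by
  have e : A = fun y => ∑ j, ContinuousLinearMap.smulRightL ℂ (Fin p → ℂ) F
      (ContinuousLinearMap.proj j) (A y (Pi.single j 1)) := by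
    funext y
    ext v
    conv_lhs => rw [pi_eq_sum_univ' v, map_sum]
    rw [_root_.sum_apply]
    exact Finset.sum_congr rfl fun j _ => by rw [map_smul]; rfl
  rw [e]
  refine Finset.analyticAt_fun_sum _ fun j _ => ?_
  exact (ContinuousLinearMap.analyticAt _ _).comp (h j)

/-- Matrices as continuous linear maps. -/
noncomputable def mat {a b : ℕ} (A : Matrix (Fin a) (Fin b) ℂ) : (Fin b → ℂ) →L[ℂ] (Fin a → ℂ) :=
  LinearMap.toContinuousLinearMap A.mulVecLin

theorem mat_apply {a b : ℕ} (A : Matrix (Fin a) (Fin b) ℂ) (v : Fin b → ℂ) : mat A v = A *ᵥ v := rfl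

theorem analyticAt_mat {E : Type*} [NormedAddCommGroup E] [NormedSpace ℂ E] {a b : ℕ}
    {A : E → Matrix (Fin a) (Fin b) ℂ} {x : E} (h : ∀ i j, AnalyticAt ℂ (fun y => A y i j) x) :
    AnalyticAt ℂ (fun y => mat (A y)) x := by
  refine analyticAt_clm_of_apply fun j => analyticAt_pi_iff.2 fun i => ?_
  simpa [mat_apply] using h i j

section

variable {E : Type*} [NormedAddCommGroup E] [NormedSpace ℂ E] {X : E → Matrix (Fin n) (Fin m) ℂ}
  {F : E → Matrix (Fin q) (Fin n) ℂ} {x : E}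

theorem analyticAt_splitLeft (hX : ∀ i j, AnalyticAt ℂ (fun y => X y i j) x)
    (hF : ∀ i j, AnalyticAt ℂ (fun y => F y i j) x) (i : Fin m) (j : Fin n) :
    AnalyticAt ℂ (fun y => splitLeft (X y) (F y) T W i j) x := by
  have h1 : ∀ i j, AnalyticAt ℂ (fun y => (F y * W) i j) x :=
    analyticAt_mul_apply hF fun _ _ => analyticAt_const
  have h2 : ∀ i j, AnalyticAt ℂ (fun y => (T * X y) i j) x :=
    analyticAt_mul_apply (A := fun _ => T) (fun _ _ => analyticAt_const) hX
  have h3 : ∀ i j, AnalyticAt ℂ (fun y => ((F y * W).det • 1 - W * (F y * W).adjugate * F y :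
      Matrix (Fin n) (Fin n) ℂ) i j) x := by
    intro i j
    simp only [Matrix.sub_apply, Matrix.smul_apply, smul_eq_mul]
    exact ((analyticAt_det h1).mul analyticAt_const).sub
      (analyticAt_mul_apply (A := fun y => W * (F y * W).adjugate)
        (analyticAt_mul_apply (A := fun _ => W) (fun _ _ => analyticAt_const)
          (analyticAt_adjugate h1)) hF i j)
  simp only [splitLeft, Matrix.smul_apply, smul_eq_mul]
  exact ((analyticAt_det h1).mul (analyticAt_det h2)).mul (analyticAt_mul_apply
    (A := fun y => (T * X y).adjugate) (analyticAt_adjugate h2)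
    (analyticAt_mul_apply (A := fun _ => T) (fun _ _ => analyticAt_const) h3) i j)

theorem analyticAt_splitRight (hX : ∀ i j, AnalyticAt ℂ (fun y => X y i j) x)
    (hF : ∀ i j, AnalyticAt ℂ (fun y => F y i j) x) (i : Fin n) (j : Fin q) :
    AnalyticAt ℂ (fun y => splitRight (X y) (F y) T W i j) x := by
  have h1 : ∀ i j, AnalyticAt ℂ (fun y => (F y * W) i j) x :=
    analyticAt_mul_apply hF fun _ _ => analyticAt_const
  have h2 : ∀ i j, AnalyticAt ℂ (fun y => (T * X y) i j) x :=
    analyticAt_mul_apply (A := fun _ => T) (fun _ _ => analyticAt_const) hX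
  simp only [splitRight, Matrix.smul_apply, smul_eq_mul]
  exact (((analyticAt_det h2).pow 2).mul (analyticAt_det h1)).mul (analyticAt_mul_apply
    (A := fun _ => W) (fun _ _ => analyticAt_const) (analyticAt_adjugate h1) i j)

end

end Splitting

section Integrable

open Matrix

variable {m n q d : ℕ}

/-- The vector fields of the family as a single map. -/
noncomputable def CommVF.fld (W : CommVF m n) (x : Fin n → ℂ) : (Fin m → ℂ) →L[ℂ] (Fin n → ℂ) :=
  ∑ l, (ContinuousLinearMap.proj (R := ℂ) (φ := fun _ : Fin m => ℂ) l).smulRight (W.Z l x)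

theorem CommVF.fld_apply (W : CommVF m n) (x : Fin n → ℂ) (β : Fin m → ℂ) :
    W.fld x β = ∑ l, β l • W.Z l x := by
  rw [CommVF.fld, _root_.sum_apply]
  rfl

theorem CommVF.fld_single (W : CommVF m n) (x : Fin n → ℂ) (l : Fin m) :
    W.fld x (Pi.single l 1) = W.Z l x := by
  rw [W.fld_apply, Finset.sum_eq_single l]
  · simp
  · intro k _ hk
    simp [hk]
  · simp

theorem CommVF.analyticAt_fld (W : CommVF m n) : AnalyticAt ℂ W.fld 0 :=
  analyticAt_clm_of_apply fun l => by
    simp only [W.fld_single]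
    exact (W.Z l).analyticAt

theorem CommVF.fderiv_fld (W : CommVF m n) : ∀ᶠ x in 𝓝 0, ∀ u β,
    fderiv ℂ W.fld x u β = ∑ l, β l • fderiv ℂ (W.Z l) x u := by
  filter_upwards [eventually_all.2 fun l => (W.Z l).analyticAt.eventually_analyticAt,
    W.analyticAt_fld.eventually_analyticAt] with x hx hW u β
  have h1 : HasFDerivAt (fun x => W.fld x β) _ x :=
    hW.differentiableAt.hasFDerivAt.clm_apply (hasFDerivAt_const β x)
  have h2 : HasFDerivAt (fun x => ∑ l, β l • W.Z l x) _ x :=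
    HasFDerivAt.fun_sum fun l _ => (hx l).differentiableAt.hasFDerivAt.fun_const_smul (β l)
  have := h1.unique (h2.congr_of_eventuallyEq (Eventually.of_forall fun x => W.fld_apply x β))
  have := congrArg (fun L => L u) this
  simpa [_root_.sum_apply] using this

theorem CommVF.fderiv_fld_comm (W : CommVF m n) : ∀ᶠ x in 𝓝 0, ∀ β β',
    fderiv ℂ W.fld x (W.fld x β) β' = fderiv ℂ W.fld x (W.fld x β') β := by
  filter_upwards [W.fderiv_fld, eventually_all.2 fun l => eventually_all.2 fun k => W.comm l k]
    with x h1 h2 β β'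
  rw [h1, h1]
  simp only [W.fld_apply, map_sum, map_smul, Finset.smul_sum]
  rw [Finset.sum_comm]
  refine Finset.sum_congr rfl fun l _ => Finset.sum_congr rfl fun k _ => ?_
  rw [h2, smul_comm]

/-- First integrals of a commuting family, with a rational splitting whose denominator vanishes to
order at most `d`. -/
structure IntData (W : CommVF m n) (q d : ℕ) where
  /-- the first integrals -/
  f : (Fin n → ℂ) → Fin q → ℂ
  /-- the numerator of the left inverse of the vector fields -/
  Qh : (Fin n → ℂ) → (Fin n → ℂ) →L[ℂ] (Fin m → ℂ)
  /-- the numerator of the right inverse of the differential of the first integrals -/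
  R : (Fin n → ℂ) → (Fin q → ℂ) →L[ℂ] (Fin n → ℂ)
  /-- the common denominator -/
  Δ : (Fin n → ℂ) → ℂ
  hf : AnalyticAt ℂ f 0
  hQh : AnalyticAt ℂ Qh 0
  hR : AnalyticAt ℂ R 0
  hΔ : AnalyticAt ℂ Δ 0
  hQX : ∀ᶠ x in 𝓝 0, ∀ β, Qh x (W.fld x β) = Δ x • β
  hXQ : ∀ᶠ x in 𝓝 0, ∀ u, W.fld x (Qh x u) + R x (fderiv ℂ f x u) = Δ x • u
  hfX : ∀ᶠ x in 𝓝 0, ∀ β, fderiv ℂ f x (W.fld x β) = 0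
  hd : ¬ Δ =O[𝓝 0] fun x => ‖x‖ ^ (d + 1)

theorem exists_left_inverse_of_linearIndependent {a b : ℕ} {A : Matrix (Fin a) (Fin b) ℂ}
    (h : LinearIndependent ℂ A.col) : ∃ T : Matrix (Fin b) (Fin a) ℂ, T * A = 1 := by
  obtain ⟨g, hg⟩ := LinearMap.exists_leftInverse_of_injective A.mulVecLin
    (LinearMap.ker_eq_bot.2 (mulVec_injective_iff.2 h))
  refine ⟨LinearMap.toMatrix' g, ?_⟩
  have := congrArg LinearMap.toMatrix' hg
  rwa [LinearMap.toMatrix'_comp, ← toLin'_apply', LinearMap.toMatrix'_toLin', LinearMap.toMatrix'_id]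
    at this

theorem exists_intData (hmn : m ≤ n) {U : Set (Fin n → ℂ)} (hUo : IsOpen U) (hUc : IsConnected U)
    (h0U : (0 : Fin n → ℂ) ∈ U) {X : Fin m → (Fin n → ℂ) → (Fin n → ℂ)}
    {f : Fin (n - m) → (Fin n → ℂ) → ℂ}
    (hXan : ∀ i, AnalyticOnNhd ℂ (X i) U) (hfan : ∀ j, AnalyticOnNhd ℂ (f j) U)
    (hfirst : ∀ i j, ∀ x ∈ U, fderiv ℂ (f j) x (X i x) = 0)
    (hXind : ∃ x ∈ U, LinearIndependent ℂ (fun i => X i x))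
    (hfind : ∃ x ∈ U, LinearIndependent ℂ (fun j => fderiv ℂ (f j) x))
    (W : CommVF m n) (hW : ∀ l x, W.Z l x = X l x) : ∃ d, Nonempty (IntData W (n - m) d) := by
  let XM : (Fin n → ℂ) → Matrix (Fin n) (Fin m) ℂ := fun x => of fun i l => X l x i
  let FM : (Fin n → ℂ) → Matrix (Fin (n - m)) (Fin n) ℂ := fun x =>
    of fun j i => fderiv ℂ (f j) x (Pi.single i 1)
  have hXM : ∀ x ∈ U, ∀ i l, AnalyticAt ℂ (fun x => XM x i l) x := fun x hx i l =>
    analyticAt_pi_iff.1 (hXan l x hx) i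
  have hFM : ∀ x ∈ U, ∀ j i, AnalyticAt ℂ (fun x => FM x j i) x := fun x hx j i =>
    analyticAt_clm_apply (hfan j x hx).fderiv analyticAt_const
  have hFM_apply : ∀ x u j, (FM x *ᵥ u) j = fderiv ℂ (f j) x u := by
    intro x u j
    conv_rhs => rw [pi_eq_sum_univ' u, map_sum]
    rw [mulVec_eq_sum, Finset.sum_apply]
    refine Finset.sum_congr rfl fun i _ => ?_
    rw [map_smul, op_smul_eq_smul]
    rfl
  have hXM_apply : ∀ x β, XM x *ᵥ β = W.fld x β := by
    intro x β
    rw [W.fld_apply, mulVec_eq_sum]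
    refine Finset.sum_congr rfl fun l _ => ?_
    rw [hW, op_smul_eq_smul]
    rfl
  have hzero : ∀ x ∈ U, FM x * XM x = 0 := by
    intro x hx
    ext j l
    exact (hFM_apply x (X l x) j).trans (hfirst l j x hx)
  obtain ⟨x₁, hx₁, h₁⟩ := hXind
  obtain ⟨x₂, hx₂, h₂⟩ := hfind
  obtain ⟨T, hT⟩ := exists_left_inverse_of_linearIndependent (A := XM x₁) h₁
  obtain ⟨C, hC⟩ : ∃ C : Matrix (Fin n) (Fin (n - m)) ℂ, FM x₂ * C = 1 := by
    let ev : ((Fin n → ℂ) →L[ℂ] ℂ) →ₗ[ℂ] (Fin n → ℂ) :=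
      { toFun := fun L i => L (Pi.single i 1)
        map_add' := fun _ _ => rfl
        map_smul' := fun _ _ => rfl }
    have hev : LinearMap.ker ev = ⊥ := by
      refine LinearMap.ker_eq_bot'.2 fun L hL => ?_
      exact ContinuousLinearMap.coe_injective (LinearMap.pi_ext' fun i => LinearMap.ext_ring
        (congrFun hL i))
    obtain ⟨C, hC⟩ := exists_left_inverse_of_linearIndependent (A := (FM x₂)ᵀ) (h₂.map' ev hev)
    refine ⟨Cᵀ, ?_⟩
    have := congrArg transpose hC
    rwa [transpose_mul, transpose_transpose, transpose_one] at this
  have hM1 : ∀ x ∈ U, ∀ i j, AnalyticAt ℂ (fun x => (FM x * C) i j) x := fun x hx =>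
    analyticAt_mul_apply (hFM x hx) fun _ _ => analyticAt_const
  have hM2 : ∀ x ∈ U, ∀ i j, AnalyticAt ℂ (fun x => (T * XM x) i j) x := fun x hx =>
    analyticAt_mul_apply (fun _ _ => analyticAt_const) (hXM x hx)
  have hJ1 : ∀ x ∈ U, AnalyticAt ℂ (fun x => (FM x * C).det) x := fun x hx => analyticAt_det (hM1 x hx)
  have hJ2 : ∀ x ∈ U, AnalyticAt ℂ (fun x => (T * XM x).det) x := fun x hx => analyticAt_det (hM2 x hx)
  have hΔ : AnalyticAt ℂ (fun x => splitDen (XM x) (FM x) T C) 0 :=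
    (hJ1 0 h0U |>.mul (hJ2 0 h0U)).pow 2
  have hQ := analyticAt_splitLeft T C (hXM 0 h0U) (hFM 0 h0U)
  have hR := analyticAt_splitRight T C (hXM 0 h0U) (hFM 0 h0U)
  have hf0 : AnalyticAt ℂ (fun x j => f j x) 0 := analyticAt_pi_iff.2 fun j => hfan j 0 h0U
  have hfd : ∀ x ∈ U, ∀ u, fderiv ℂ (fun x j => f j x) x u = FM x *ᵥ u := by
    intro x hx u
    ext j
    rw [hFM_apply, fderiv_pi fun j => (hfan j x hx).differentiableAt]
    rfl
  have hUn : ∀ᶠ x in 𝓝 0, x ∈ U := hUo.mem_nhds h0U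
  obtain ⟨d, hd⟩ : ∃ d, ¬ (fun x => splitDen (XM x) (FM x) T C) =O[𝓝 0]
      fun x : Fin n → ℂ => ‖x‖ ^ (d + 1) := by
    by_contra! hcon
    have h := eventually_eq_zero_of_isBigO_pow hΔ hcon
    have hJ : AnalyticOnNhd ℂ (fun x => (FM x * C).det * (T * XM x).det) U :=
      fun x hx => (hJ1 x hx).mul (hJ2 x hx)
    have h' : ∀ x ∈ U, (FM x * C).det * (T * XM x).det = 0 := by
      refine hJ.eqOn_zero_of_preconnected_of_eventuallyEq_zero hUc.isPreconnected h0U ?_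
      filter_upwards [h] with x hx
      exact pow_eq_zero_iff two_ne_zero |>.1 hx
    have h1 : ∀ᶠ x in 𝓝 x₂, (FM x * C).det ≠ 0 :=
      (hJ1 x₂ hx₂).continuousAt.eventually_ne (by rw [hC, det_one]; exact one_ne_zero)
    have h2 : ∀ x ∈ U, (T * XM x).det = 0 := by
      refine AnalyticOnNhd.eqOn_zero_of_preconnected_of_eventuallyEq_zero (fun x hx => hJ2 x hx)
        hUc.isPreconnected hx₂ ?_
      filter_upwards [h1, hUo.mem_nhds hx₂] with x hx hxU
      exact (mul_eq_zero.1 (h' x hxU)).resolve_left hx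
    have := h2 x₁ hx₁
    rw [hT, det_one] at this
    exact one_ne_zero this
  have e : Fin n ≃ Fin m ⊕ Fin (n - m) :=
    (finCongr (by omega : n = m + (n - m))).trans finSumFinEquiv.symm
  refine ⟨d, ⟨{ f := fun x j => f j x
                Qh := fun x => mat (splitLeft (XM x) (FM x) T C)
                R := fun x => mat (splitRight (XM x) (FM x) T C)
                Δ := fun x => splitDen (XM x) (FM x) T C
                hf := hf0
                hQh := analyticAt_mat hQ
                hR := analyticAt_mat hR
                hΔ := hΔ
                hQX := ?_
                hXQ := ?_
                hfX := ?_
                hd := hd }⟩⟩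
  · filter_upwards [hUn] with x hx β
    rw [← hXM_apply, mat_apply, mulVec_mulVec, splitLeft_mul T C (hzero x hx), smul_mulVec, one_mulVec]
  · filter_upwards [hUn] with x hx u
    rw [hfd x hx, mat_apply, mat_apply, ← hXM_apply, mulVec_mulVec, mulVec_mulVec, ← add_mulVec,
      mul_splitLeft_add T C e (hzero x hx), smul_mulVec, one_mulVec]
  · filter_upwards [hUn] with x hx β
    rw [hfd x hx, ← hXM_apply, mulVec_mulVec, hzero x hx, zero_mulVec]

/-- Integrability data is invariant under changes of coordinates. -/
theorem IntData.transport {W W' : CommVF m n} {φ y : Map0 n} (h : Rel φ W W') (hy : InvPair φ y)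
    (I : IntData W q d) : Nonempty (IntData W' q d) := by
  have hfld : ∀ᶠ x in 𝓝 0, ∀ β, fderiv ℂ φ x (W'.fld x β) = W.fld (φ x) β := by
    filter_upwards [eventually_all.2 h] with x hx β
    simp only [CommVF.fld_apply, map_sum, map_smul, hx]
  have comp0 : ∀ {F : Type} [NormedAddCommGroup F] [NormedSpace ℂ F] {g : (Fin n → ℂ) → F},
      AnalyticAt ℂ g 0 → AnalyticAt ℂ (fun x => g (φ x)) 0 := by
    intro F _ _ g hg
    exact AnalyticAt.comp (g := g) (f := φ) (by rwa [φ.map_zero]) φ.analyticAt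
  have hφ' : AnalyticAt ℂ (fderiv ℂ φ) 0 := φ.analyticAt.fderiv
  have hy' : AnalyticAt ℂ (fderiv ℂ y) 0 := y.analyticAt.fderiv
  have hfder : ∀ᶠ x in 𝓝 0, ∀ u, fderiv ℂ (fun x => I.f (φ x)) x u =
      fderiv ℂ I.f (φ x) (fderiv ℂ φ x u) := by
    filter_upwards [φ.analyticAt.eventually_analyticAt,
      φ.tendsto.eventually I.hf.eventually_analyticAt] with x h1 h2 u
    have : HasFDerivAt (fun x => I.f (φ x)) _ x := HasFDerivAt.comp (g := I.f) (f := φ) x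
      h2.differentiableAt.hasFDerivAt h1.differentiableAt.hasFDerivAt
    rw [this.fderiv]
    rfl
  refine ⟨{ f := fun x => I.f (φ x)
            Qh := fun x => (I.Qh (φ x)).comp (fderiv ℂ φ x)
            R := fun x => (fderiv ℂ y (φ x)).comp (I.R (φ x))
            Δ := fun x => I.Δ (φ x)
            hf := comp0 I.hf
            hQh := analyticAt_clm_comp (comp0 I.hQh) hφ'
            hR := analyticAt_clm_comp (comp0 hy') (comp0 I.hR)
            hΔ := comp0 I.hΔ
            hQX := ?_
            hXQ := ?_
            hfX := ?_
            hd := ?_ }⟩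
  · filter_upwards [hfld, φ.tendsto.eventually I.hQX] with x h1 h2 β
    change I.Qh (φ x) (fderiv ℂ φ x _) = _
    rw [h1, h2]
  · filter_upwards [hfld, φ.tendsto.eventually I.hXQ, hfder,
      hy.symm.fderiv_comp] with x h1 h2 h3 inj u
    change W'.fld x (I.Qh (φ x) (fderiv ℂ φ x u)) + fderiv ℂ y (φ x) (I.R (φ x) _) = _
    rw [h3]
    rw [← inj (W'.fld x _), h1, ← map_add, h2, map_smul, inj]
  · filter_upwards [hfld, φ.tendsto.eventually I.hfX, hfder] with x h1 h2 h3 β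
    rw [h3, h1, h2]
  · intro hd
    refine I.hd ((isBigO_comp y hd).congr' ?_ EventuallyEq.rfl)
    filter_upwards [hy.left] with x hx
    rw [hx]

end Integrable

section Prepare

variable {m n N M : ℕ}

theorem fderiv_eq_of_jet_eq (hM : 1 ≤ M) {f g : O n} (h : jet M f = jet M g) :
    fderiv ℂ f.1 0 = fderiv ℂ g.1 0 := by
  have h1 := fderiv_isBigO_pow ((analyticAt_val f).sub (analyticAt_val g)) (jet_eq_jet.1 h)
  have h2 : (fun x => fderiv ℂ (f.1 - g.1) x) =O[𝓝 0]
      fun x : Fin n → ℂ => ‖x - 0‖ ^ M := by simpa only [sub_zero] using h1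
  have h3 := h2.eq_zero_of_norm_pow (by omega)
  rw [fderiv_sub (analyticAt_val f).differentiableAt (analyticAt_val g).differentiableAt] at h3
  exact sub_eq_zero.1 h3

theorem fderiv_apply_eq (y : Map0 n) (u : Fin n → ℂ) (i : Fin n) :
    fderiv ℂ y 0 u i = fderiv ℂ (y.coord i).1 0 u := by
  have := hasFDerivAt_pi'.1 y.analyticAt.differentiableAt.hasFDerivAt i
  exact (congrArg (fun L => L u) this.fderiv).symm

theorem Map0.fderiv_eq_of_jet_eq (hM : 1 ≤ M) {y z : Map0 n}
    (h : ∀ i, jet M (y.coord i) = jet M (z.coord i)) : fderiv ℂ y 0 = fderiv ℂ z 0 := by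
  ext1 u
  ext i
  rw [fderiv_apply_eq, fderiv_apply_eq, ZungPD.fderiv_eq_of_jet_eq hM (h i)]

theorem span_fderiv_eq_top (W : CommVF m n) (hM : 1 ≤ M) :
    Submodule.span ℂ {α : (Fin n → ℂ) →L[ℂ] ℂ | ∃ (f : O n) (χ : Fin m → ℂ),
      jet M f ∈ (W.fam M).V χ ∧ fderiv ℂ f.1 0 = α} = ⊤ := by
  refine eq_top_iff.2 fun α _ => ?_
  set L := Submodule.span ℂ {α : (Fin n → ℂ) →L[ℂ] ℂ | ∃ (f : O n) (χ : Fin m → ℂ),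
    jet M f ∈ (W.fam M).V χ ∧ fderiv ℂ f.1 0 = α}
  have key : ∀ a : Jet n M, ∀ f : O n, jet M f = a → fderiv ℂ f.1 0 ∈ L := by
    intro a
    have ha : a ∈ ⨆ χ, (W.fam M).V χ := by rw [(W.fam M).iSup_V]; trivial
    refine Submodule.iSup_induction _
      (motive := fun a => ∀ f : O n, jet M f = a → fderiv ℂ f.1 0 ∈ L) ha ?_ ?_ ?_
    · rintro χ a ha f rfl
      exact Submodule.subset_span ⟨f, χ, ha, rfl⟩
    · intro f hf
      exact Submodule.subset_span ⟨f, 0, by rw [hf]; exact zero_mem _, rfl⟩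
    · intro a b ha hb f hf
      obtain ⟨g, rfl⟩ := jet_surjective a
      obtain ⟨h, rfl⟩ := jet_surjective b
      rw [← map_add] at hf
      rw [fderiv_eq_of_jet_eq hM hf]
      have : fderiv ℂ (g + h).1 0 = fderiv ℂ g.1 0 + fderiv ℂ h.1 0 :=
        fderiv_add (analyticAt_val g).differentiableAt (analyticAt_val h).differentiableAt
      rw [this]
      exact add_mem (ha g rfl) (hb h rfl)
  have := key _ (linO α) rfl
  have e : fderiv ℂ (linO α).1 0 = α := ContinuousLinearMap.fderiv α
  rwa [e] at this

theorem exists_weight_coords (W : CommVF m n) (hM : 1 ≤ M) :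
    ∃ (y : Map0 n) (μ : Fin n → Fin m → ℂ), Function.Bijective (fderiv ℂ y 0) ∧
      ∀ i, jet M (y.coord i) ∈ (W.fam M).V (μ i) := by
  have hspan := span_fderiv_eq_top W hM
  set s := {α : (Fin n → ℂ) →L[ℂ] ℂ | ∃ (f : O n) (χ : Fin m → ℂ),
    jet M f ∈ (W.fam M).V χ ∧ fderiv ℂ f.1 0 = α}
  obtain ⟨α, hαs, hα⟩ : ∃ α : Fin n → ((Fin n → ℂ) →L[ℂ] ℂ), (∀ i, α i ∈ s) ∧
      Submodule.span ℂ (Set.range α) = ⊤ := by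
    have hr : Module.finrank ℂ (Submodule.span ℂ s) = n := by
      rw [hspan, finrank_top,
        ← (LinearMap.toContinuousLinearMap (𝕜 := ℂ) (E := Fin n → ℂ) (F' := ℂ)).finrank_eq]
      exact (Subspace.dual_finrank_eq).trans (by simp)
    obtain ⟨α, h1, h2, -⟩ := Submodule.exists_fun_fin_finrank_span_eq ℂ s
    refine ⟨fun i => α (Fin.cast hr.symm i), fun i => h1 _, ?_⟩
    have e : Set.range (fun i => α (Fin.cast hr.symm i)) = Set.range α :=
      (finCongr hr.symm).surjective.range_comp α
    rw [e, h2, hspan]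
  choose f χ hf hfα using hαs
  let g : Fin n → O n := fun i => f i - algebraMap ℂ (O n) ((f i).1 0)
  have hg0 : ∀ i, (g i).1 0 = 0 := fun i => sub_self ((f i).1 0)
  have hgd : ∀ i, fderiv ℂ (g i).1 0 = α i := by
    intro i
    rw [← hfα i]
    exact fderiv_sub_const ((f i).1 0)
  have hgV : ∀ i, jet M (g i) ∈ (W.fam M).V (χ i) := by
    intro i
    rw [map_sub, AlgHom.commutes]
    refine sub_mem (hf i) ?_
    by_cases h : χ i = 0
    · rw [h, Algebra.algebraMap_eq_smul_one]
      exact Submodule.smul_mem _ _ (CommFam.one_mem_V W.leibniz)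
    · rw [← ev_jet (N := M) (f i), W.ev_eq_zero h (hf i), map_zero]
      exact zero_mem _
  let y : Map0 n := Map0.ofCoord g hg0
  have hinj : Function.Injective (fderiv ℂ y 0) := by
    rw [injective_iff_map_eq_zero]
    intro u hu
    have h1 : ∀ i, α i u = 0 := by
      intro i
      rw [← hgd]
      exact (fderiv_apply_eq y u i).symm.trans (by rw [hu]; rfl)
    have h2 : ∀ β : (Fin n → ℂ) →L[ℂ] ℂ, β u = 0 := by
      intro β
      have hβ : β ∈ Submodule.span ℂ (Set.range α) := by rw [hα]; trivial
      induction hβ using Submodule.span_induction with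
      | mem x hx => obtain ⟨i, rfl⟩ := hx; exact h1 i
      | zero => rfl
      | add a b _ _ ha hb => rw [_root_.add_apply, ha, hb, add_zero]
      | smul c a _ ha => rw [_root_.smul_apply, ha, smul_zero]
    ext i
    exact h2 (ContinuousLinearMap.proj i)
  exact ⟨y, χ, ⟨hinj, LinearMap.injective_iff_surjective (f := (fderiv ℂ y 0 : (Fin n → ℂ) →ₗ[ℂ] _)).1
    hinj⟩, hgV⟩

theorem exists_prep (W : CommVF m n) (hM : 1 ≤ M) : ∃ (φ y : Map0 n) (W' : CommVF m n)
    (μ : Fin n → Fin m → ℂ), InvPair φ y ∧ Rel φ W W' ∧ Prep W' μ M := by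
  obtain ⟨y, μ, hy, hμ⟩ := exists_weight_coords W hM
  obtain ⟨φ, hφ⟩ := exists_invPair y hy
  obtain ⟨W', hW'⟩ := exists_rel W hφ
  refine ⟨φ, y, W', μ, hφ, hW', fun i => ?_⟩
  have := hW'.mem_V (hμ i)
  rw [compJ_jet] at this
  have e : jet M (compO φ (y.coord i)) = jet M (co i) := by
    refine jet_eq_of_eventuallyEq ?_
    filter_upwards [hφ.right] with x hx
    change y (φ x) i = x i
    rw [hx]
  rwa [e] at this

end Prepare

section Symmetric

variable {m n q d N M : ℕ}

theorem isBigO_clm_of_apply {E F : Type*} [NormedAddCommGroup F] [NormedSpace ℂ F] {p : ℕ}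
    {A : E → (Fin p → ℂ) →L[ℂ] F} {l : Filter E} {g : E → ℝ}
    (h : ∀ j, (fun y => A y (Pi.single j 1)) =O[l] g) : A =O[l] g := by
  have e : A = fun y => ∑ j, ContinuousLinearMap.smulRightL ℂ (Fin p → ℂ) F
      (ContinuousLinearMap.proj j) (A y (Pi.single j 1)) := by
    funext y
    ext v
    conv_lhs => rw [pi_eq_sum_univ' v, map_sum]
    rw [_root_.sum_apply]
    exact Finset.sum_congr rfl fun j _ => by rw [map_smul]; rfl
  rw [e]
  exact IsBigO.fun_sum fun j _ => (ContinuousLinearMap.isBigO_comp _ _ _).trans (h j)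

theorem Prep.der_coord {W : CommVF m n} {μ : Fin n → Fin m → ℂ} (h : Prep W μ N)
    {ρ : (Fin m → ℂ) → ℂ} (hρ : ∀ χ ψ, ρ (χ + ψ) = ρ χ + ρ ψ) (l : Fin m) (i : Fin n) :
    der N (Map0.ofCLM (dg fun i => ρ (μ i))) (jet N ((W.Z l).coord i)) =
      ρ (μ i) • jet N ((W.Z l).coord i) := by
  have e1 := (W.fam N).wt_D ρ l (jet N (co i))
  rw [h.wt_add hρ] at e1
  change der N (W.Z l) (der N _ (jet N (co i))) = der N _ (der N (W.Z l) (jet N (co i))) at e1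
  rw [der_dg_co, map_smul, der_co] at e1
  exact e1.symm

theorem Prep.comp_coord {W : CommVF m n} {μ : Fin n → Fin m → ℂ} (h : Prep W μ N)
    {c : (Fin m → ℂ) → ℂ} (hc : ∀ χ ψ, c (χ + ψ) = c χ * c ψ) (hc0 : c 0 = 1) (l : Fin m)
    (i : Fin n) : compJ N (Map0.ofCLM (dg fun i => c (μ i))) (jet N ((W.Z l).coord i)) =
      c (μ i) • jet N ((W.Z l).coord i) := by
  have e1 := (W.fam N).wt_D c l (jet N (co i))
  change der N (W.Z l) _ = (W.fam N).wt c (der N (W.Z l) _) at e1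
  rw [(W.fam N).wt_of_mem _ (h i), map_smul, der_co, h.wt_mul hc hc0] at e1
  exact e1.symm

theorem IntData.jet_mem_V {W : CommVF m n} (I : IntData W q d) {f : O n} (j : Fin q)
    (hf : ∀ x, f.1 x = I.f x j) : jet N f ∈ (W.fam N).V 0 := by
  rw [CommFam.mem_V]
  refine fun l => ⟨1, ?_⟩
  rw [pow_one, LinearMap.sub_apply, Pi.zero_apply, zero_smul, LinearMap.zero_apply, sub_zero]
  change der N (W.Z l) (jet N f) = 0
  rw [der_jet, ← map_zero (jet N)]
  refine jet_eq_of_eventuallyEq ?_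
  filter_upwards [I.hfX, I.hf.eventually_analyticAt] with x hx hfx
  have h1 := hx (Pi.single l 1)
  rw [W.fld_single] at h1
  have h2 := hasFDerivAt_pi'.1 hfx.differentiableAt.hasFDerivAt j
  rw [← funext hf] at h2
  change fderiv ℂ f.1 x (W.Z l x) = 0
  rw [h2.fderiv]
  exact congrFun h1 j

/-- Prepared commuting vector fields with enough first integrals have circle symmetries. -/
noncomputable def Prep.symData {W : CommVF m n} {μ : Fin n → Fin m → ℂ} (h : Prep W μ M)
    (I : IntData W q d) {ρ : (Fin m → ℂ) → ℂ} (hρ : ∀ χ ψ, ρ (χ + ψ) = ρ χ + ρ ψ)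
    {k : Fin n → ℤ} (hk : ∀ i, ρ (μ i) = k i) : SymData n (Fin m → ℂ) (Fin q → ℂ) M where
  X := W.fld
  f := I.f
  k := k
  Qh := I.Qh
  R := I.R
  Δ := I.Δ
  hX := W.analyticAt_fld
  hf := I.hf
  hQh := I.hQh
  hR := I.hR
  hΔ := I.hΔ
  hQX := I.hQX
  hXQ := I.hXQ
  hfX := I.hfX
  hcomm := W.fderiv_fld_comm
  hDX := by
    refine isBigO_clm_of_apply fun l => isBigO_pi.2 fun i => ?_
    have h1 := h.der_coord hρ l i
    simp only [hk] at h1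
    rw [der_jet, ← map_smul, jet_eq_jet] at h1
    refine h1.congr' ?_ EventuallyEq.rfl
    filter_upwards [W.fderiv_fld, derO_coord (Map0.ofCLM (dg fun i => (k i : ℂ))) (W.Z l)]
      with x h2 h3
    rw [h3, _root_.sub_apply, h2, Finset.sum_eq_single l, Pi.single_eq_same, one_smul,
      ContinuousLinearMap.comp_apply, W.fld_single, Pi.sub_apply, dg_apply]
    · rfl
    · intro b _ hb
      rw [Pi.single_eq_of_ne hb, zero_smul]
    · simp
  hfD := by
    refine isBigO_pi.2 fun j => ?_
    let f : O n := ⟨fun x => I.f x j, analyticAt_pi_iff.1 I.hf j⟩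
    have h1 := (W.fam M).wt_of_mem ρ (I.jet_mem_V (N := M) (f := f) j fun _ => rfl)
    have h0 : ρ 0 = 0 := by simpa using hρ 0 0
    rw [h0, zero_smul, h.wt_add hρ] at h1
    simp only [hk] at h1
    rw [der_jet, jet_eq_zero] at h1
    refine h1.congr' ?_ EventuallyEq.rfl
    filter_upwards [I.hf.eventually_analyticAt] with x hx
    have h2 := hasFDerivAt_pi'.1 hx.differentiableAt.hasFDerivAt j
    exact congrArg (fun L => L (dg (fun i => (k i : ℂ)) x)) h2.fderiv
  hrot := by
    intro ζ hζ
    have hζ0 : ζ ≠ 0 := norm_ne_zero_iff.1 (by rw [hζ]; exact one_ne_zero)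
    have hc : ∀ i, Complex.exp (ρ (μ i) * Complex.log ζ) = ζ ^ k i := by
      intro i
      rw [hk, Complex.exp_int_mul, Complex.exp_log hζ0]
    refine isBigO_clm_of_apply fun l => isBigO_pi.2 fun i => ?_
    have h1 := h.comp_coord (c := fun χ => Complex.exp (ρ χ * Complex.log ζ))
      (fun χ ψ => by rw [hρ, add_mul, Complex.exp_add])
      (by have h0 : ρ 0 = 0 := by simpa using hρ 0 0
          rw [h0, zero_mul, Complex.exp_zero]) l i
    simp only [hc] at h1
    rw [compJ_jet, ← map_smul, jet_eq_jet] at h1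
    refine (h1.const_mul_left (ζ ^ k i)⁻¹).congr (fun x => ?_) fun _ => rfl
    change (ζ ^ k i)⁻¹ * (W.Z l (rot k ζ x) i - ζ ^ k i * W.Z l x i) = _
    rw [_root_.sub_apply, ContinuousLinearMap.comp_apply, W.fld_single, W.fld_single, Pi.sub_apply,
      rot_apply, inv_zpow, mul_sub, inv_mul_cancel_left₀ (zpow_ne_zero _ hζ0)]

end Symmetric

section Weights

variable {m n N N' M : ℕ}

theorem CommVF.wt_eq_compJ (W : CommVF m n) {c : (Fin m → ℂ) → ℂ}
    (hc : ∀ χ ψ, c (χ + ψ) = c χ * c ψ) (hc0 : c 0 = 1) {φ : Map0 n}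
    (h : ∀ i, jet N (φ.coord i) = (W.fam N).wt c (jet N (co i))) (a : Jet n N) :
    (W.fam N).wt c a = compJ N φ a := by
  have h1 : (W.fam N).wt c 1 = 1 := by
    rw [(W.fam N).wt_of_mem _ (CommFam.one_mem_V W.leibniz), hc0, one_smul]
  have : AlgHom.ofLinearMap ((W.fam N).wt c) h1 (CommFam.wt_mul W.leibniz hc) = compJ N φ := by
    refine AlgHom.ext_of_adjoin_eq_top adjoin_co ?_
    rintro _ ⟨i, rfl⟩
    exact (h i).symm
  exact congrArg (fun F => F a) this

theorem CommVF.wt_eq_der (W : CommVF m n) {ρ : (Fin m → ℂ) → ℂ}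
    (hρ : ∀ χ ψ, ρ (χ + ψ) = ρ χ + ρ ψ) {Z : Map0 n}
    (h : ∀ i, jet N (Z.coord i) = (W.fam N).wt ρ (jet N (co i))) : (W.fam N).wt ρ = der N Z := by
  refine eq_of_leibniz (CommFam.wt_leibniz W.leibniz hρ) (der_mul _) adjoin_co ?_
  rintro _ ⟨i, rfl⟩
  rw [← h, der_co]

theorem CommVF.V_ne_bot_of_le (W : CommVF m n) (h : N ≤ N') {χ : Fin m → ℂ}
    (hχ : (W.fam N).V χ ≠ ⊥) : (W.fam N').V χ ≠ ⊥ := by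
  classical
  obtain ⟨a, ha, ha0⟩ := Submodule.exists_mem_ne_zero_of_ne_bot hχ
  obtain ⟨b, rfl⟩ := trunc_surjective h a
  have h1 : trunc h ((W.fam N').wt (fun ψ => if ψ = χ then 1 else 0) b) = trunc h b := by
    rw [W.trunc_wt, (W.fam N).wt_of_mem _ ha, if_pos rfl, one_smul]
  refine (Submodule.ne_bot_iff _).2 ⟨(W.fam N').wt (fun ψ => if ψ = χ then 1 else 0) b,
    (W.fam N').wt_mem_V (fun ψ hψ => if_neg hψ) b, fun h0 => ha0 ?_⟩
  rw [← h1, h0, map_zero]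

theorem Prep.weight_mem {W : CommVF m n} {μ : Fin n → Fin m → ℂ} (h : Prep W μ M) (hM : 1 ≤ M)
    {χ : Fin m → ℂ} (hχ : (W.fam N).V χ ≠ ⊥) : χ ∈ AddSubmonoid.closure (Set.range μ) := by
  classical
  wlog hN : M ≤ N generalizing N
  · exact this (N := M) (W.V_ne_bot_of_le (by omega) hχ) le_rfl
  choose y hy using fun i => jet_surjective
    ((W.fam N).wt (fun χ => if χ = μ i then 1 else 0) (jet N (co i)))
  let Y : Map0 n := Map0.ofCoord y fun i => by
    rw [← ev_jet (N := N), hy, W.ev_wt, ev_jet]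
    exact mul_zero _
  have hY : fderiv ℂ Y 0 = fderiv ℂ (Map0.id n) 0 := by
    refine Map0.fderiv_eq_of_jet_eq hM fun i => ?_
    change jet M (y i) = jet M (co i)
    rw [← trunc_jet hN, hy, W.trunc_wt, trunc_jet, (W.fam M).wt_of_mem _ (h i), if_pos rfl, one_smul]
  obtain ⟨φ, hφ⟩ := exists_invPair Y (by
    rw [hY]
    have : fderiv ℂ (Map0.id n) 0 = ContinuousLinearMap.id ℂ _ := fderiv_id
    rw [this]
    exact Function.bijective_id)
  refine CommFam.weight_mem_closure W.leibniz (y := fun i => jet N (Y.coord i)) (μ := μ) (fun i => ?_)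
    (InvPair.adjoin hφ) hχ
  change jet N (y i) ∈ _
  rw [hy]
  exact (W.fam N).wt_mem_V (fun ψ hψ => if_neg hψ) _

theorem Prep.exists_int {W : CommVF m n} {μ : Fin n → Fin m → ℂ} (h : Prep W μ M) (hM : 1 ≤ M)
    {ρ : (Fin m → ℂ) → ℂ} (hρ : ∀ χ ψ, ρ (χ + ψ) = ρ χ + ρ ψ) {k : Fin n → ℤ}
    (hk : ∀ i, ρ (μ i) = k i) {χ : Fin m → ℂ} (hχ : (W.fam N).V χ ≠ ⊥) : ∃ j : ℤ, ρ χ = j := by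
  have := h.weight_mem hM hχ
  clear hχ
  induction this using AddSubmonoid.closure_induction with
  | mem x hx =>
    obtain ⟨i, rfl⟩ := hx
    exact ⟨k i, hk i⟩
  | zero => exact ⟨0, by simpa using hρ 0 0⟩
  | add x y _ _ hx hy =>
    obtain ⟨a, ha⟩ := hx
    obtain ⟨b, hb⟩ := hy
    exact ⟨a + b, by rw [hρ, ha, hb]; push_cast; rfl⟩

open Classical in
/-- The indicator function of a level set of a character. -/
noncomputable def lev (ρ : (Fin m → ℂ) → ℂ) (j : ℤ) (χ : Fin m → ℂ) : ℂ := if ρ χ = j then 1 else 0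

theorem lev_of_eq {ρ : (Fin m → ℂ) → ℂ} {j : ℤ} {χ : Fin m → ℂ} (h : ρ χ = j) : lev ρ j χ = 1 := if_pos h

theorem lev_of_ne {ρ : (Fin m → ℂ) → ℂ} {j : ℤ} {χ : Fin m → ℂ} (h : ρ χ ≠ j) : lev ρ j χ = 0 := if_neg h

theorem sum_lev {ρ : (Fin m → ℂ) → ℂ} {s : Finset ℤ} {χ : Fin m → ℂ} {l : ℤ} (hl : l ∈ s)
    (h : ρ χ = l) (F : ℤ → ℂ) : ∑ j ∈ s, F j * lev ρ j χ = F l := by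
  rw [Finset.sum_eq_single_of_mem l hl, lev_of_eq h, mul_one]
  intro j _ hj
  rw [lev_of_ne (fun h' => hj (by rw [h] at h'; exact_mod_cast h'.symm)), mul_zero]

theorem Prep.exists_levels {W : CommVF m n} {μ : Fin n → Fin m → ℂ} (h : Prep W μ M) (hM : 1 ≤ M)
    {ρ : (Fin m → ℂ) → ℂ} (hρ : ∀ χ ψ, ρ (χ + ψ) = ρ χ + ρ ψ) {k : Fin n → ℤ}
    (hk : ∀ i, ρ (μ i) = k i) (N : ℕ) : ∃ s : Finset ℤ, (∀ i, k i ∈ s) ∧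
      (∀ χ, (W.fam N).V χ ≠ ⊥ → ∃ l ∈ s, ρ χ = (l : ℤ)) ∧
      ∀ (F : ℤ → ℂ) (c : (Fin m → ℂ) → ℂ), (∀ (χ) (l : ℤ), ρ χ = l → c χ = F l) → ∀ a,
        ∑ j ∈ s, F j • (W.fam N).wt (lev ρ j) a = (W.fam N).wt c a := by
  classical
  let κ : (Fin m → ℂ) → ℤ := fun χ => ⌊(ρ χ).re⌋
  let s : Finset ℤ := (W.fam N).finite_weights.toFinset.image κ ∪ Finset.univ.image k
  have hs : ∀ χ, (W.fam N).V χ ≠ ⊥ → ∃ l ∈ s, ρ χ = (l : ℤ) := by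
    intro χ hχ
    obtain ⟨j, hj⟩ := h.exists_int hM hρ hk hχ
    refine ⟨j, Finset.mem_union_left _ (Finset.mem_image.2 ⟨χ, by simpa using hχ, ?_⟩), hj⟩
    simp [κ, hj]
  refine ⟨s, fun i => Finset.mem_union_right _ (Finset.mem_image_of_mem _ (Finset.mem_univ i)), hs, ?_⟩
  intro F c hc a
  simp only [← (W.fam N).wt_smul]
  rw [← (W.fam N).wt_sum]
  refine congrArg (fun L => L a) ((W.fam N).wt_congr fun χ hχ => ?_)
  obtain ⟨l, hl, hl'⟩ := hs χ hχ
  rw [sum_lev hl hl', hc χ l hl']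

end Weights

section Approximants

variable {m n q d N N' M : ℕ}

theorem isBigO_of_jet_eq {f g : O n} {F : (Fin n → ℂ) → ℂ} (h : jet N f = jet N g)
    (hF : ∀ᶠ x in 𝓝 0, f.1 x - g.1 x = F x) : F =O[𝓝 0] fun x => ‖x‖ ^ (N + 1) :=
  (jet_eq_jet.1 h).congr' hF EventuallyEq.rfl

/-- A linear combination of maps. -/
noncomputable def Map0.comb {κ : Type*} (s : Finset κ) (F : κ → ℂ) (P : κ → Map0 n) : Map0 n where
  toFun x := ∑ j ∈ s, F j • P j x
  analyticAt := Finset.analyticAt_fun_sum _ fun j _ => (P j).analyticAt.fun_const_smul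
  map_zero := Finset.sum_eq_zero fun j _ => by rw [(P j).map_zero, smul_zero]

theorem Map0.coord_comb {κ : Type*} (s : Finset κ) (F : κ → ℂ) (P : κ → Map0 n) (i : Fin n) :
    (Map0.comb s F P).coord i = ∑ j ∈ s, F j • (P j).coord i := by
  ext x
  change (∑ j ∈ s, F j • P j x) i = (O n).val (∑ j ∈ s, F j • (P j).coord i) x
  rw [map_sum, Finset.sum_apply, Finset.sum_apply]
  rfl

theorem Map0.fderiv_comb {κ : Type*} (s : Finset κ) (F : κ → ℂ) (P : κ → Map0 n) :
    ∀ᶠ x in 𝓝 0, fderiv ℂ (Map0.comb s F P) x = ∑ j ∈ s, F j • fderiv ℂ (P j) x := by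
  filter_upwards [(Filter.eventually_all_finset s).2 fun j _ => (P j).analyticAt.eventually_analyticAt]
    with x hx
  exact (HasFDerivAt.fun_sum fun j hj =>
    (hx j hj).differentiableAt.hasFDerivAt.fun_const_smul (F j)).fderiv

theorem exists_harmonics (W : CommVF m n) (ρ : (Fin m → ℂ) → ℂ) {k : Fin n → ℤ} {s : Finset ℤ}
    (hk : ∀ i, k i ∈ s) (hs : ∀ a, ∑ j ∈ s, (W.fam N).wt (lev ρ j) a = a) : ∃ P : ℤ → Map0 n,
      (∀ j i, jet N ((P j).coord i) = (W.fam N).wt (lev ρ j) (jet N (co i))) ∧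
      ∀ x, ∑ j ∈ s, P j x = x := by
  classical
  choose r hr using fun j i => jet_surjective ((W.fam N).wt (lev ρ j) (jet N (co i)))
  have hr0 : ∀ j i, (r j i).1 0 = 0 := fun j i => by
    rw [← ev_jet (N := N), hr, W.ev_wt, ev_jet]
    exact mul_zero _
  let p : ℤ → Fin n → O n := fun j i =>
    if j = k i then co i - ∑ l ∈ s.erase (k i), r l i else r j i
  have hp0 : ∀ j i, (p j i).1 0 = 0 := fun j i => by
    simp only [p]
    split_ifs
    · rw [← ev_jet (N := N), map_sub, map_sum, map_sub, map_sum, ev_jet]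
      simp only [ev_jet, hr0]
      rw [Finset.sum_const_zero, sub_zero]
      rfl
    · exact hr0 j i
  refine ⟨fun j => Map0.ofCoord (p j) (hp0 j), fun j i => ?_, fun x => ?_⟩
  · change jet N (p j i) = _
    simp only [p]
    split_ifs with h
    · rw [map_sub, map_sum]
      simp only [hr]
      rw [h, sub_eq_iff_eq_add]
      conv_lhs => rw [← hs (jet N (co i)), ← Finset.add_sum_erase s _ (hk i)]
    · exact hr j i
  · funext i
    rw [Finset.sum_apply]
    change ∑ j ∈ s, (p j i).1 x = x i
    have h1 : ∑ j ∈ s, p j i = co i := by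
      rw [← Finset.add_sum_erase s _ (hk i)]
      have : ∑ j ∈ s.erase (k i), p j i = ∑ j ∈ s.erase (k i), r j i :=
        Finset.sum_congr rfl fun j hj => if_neg (Finset.ne_of_mem_erase hj)
      rw [this]
      simp only [p, if_true, sub_add_cancel]
    have h2 := congrArg (fun f => (O n).val f x) h1
    simp only [map_sum, Finset.sum_apply] at h2
    exact h2

/-- An approximate circle action of high order is one of lower order. -/
def Approx.mono {P G : Type*} [NormedAddCommGroup P] [NormedSpace ℂ P] [CompleteSpace P]
    [NormedAddCommGroup G] [NormedSpace ℂ G] [CompleteSpace G] {S : SymData n P G M}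
    {g : (Fin n → ℂ) → ℂ} (A : Approx S g N') (h : N ≤ N') : Approx S g N :=
  { A with
    hX := fun ζ hζ => isBigO_pow_of_le (by omega) (A.hX ζ hζ)
    hZ := fun ζ hζ => isBigO_pow_of_le (by omega) (A.hZ ζ hζ)
    hfZ := isBigO_pow_of_le (by omega) A.hfZ
    hg := fun ζ hζ => isBigO_pow_of_le (by omega) (A.hg ζ hζ) }

theorem Prep.exists_approx {W : CommVF m n} {μ : Fin n → Fin m → ℂ} (h : Prep W μ M) (hM : 1 ≤ M)
    (I : IntData W q d) {ρ : (Fin m → ℂ) → ℂ} (hρ : ∀ χ ψ, ρ (χ + ψ) = ρ χ + ρ ψ)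
    {k : Fin n → ℤ} (hk : ∀ i, ρ (μ i) = k i) (hMN : M ≤ N) (g : O n) :
    ∃ A : Approx (h.symData I hρ hk) g.1 N, ∀ j,
      jet N ⟨A.h j, A.hh j⟩ = (W.fam N).wt (lev ρ j) (jet N g) := by
  classical
  have hρ0 : ρ 0 = 0 := by simpa using hρ 0 0
  obtain ⟨s, hks, hVs, hs⟩ := h.exists_levels hM hρ hk N
  obtain ⟨P, hP, hPs⟩ := exists_harmonics W ρ hks fun a => by
    have := hs (fun _ => 1) (fun _ => 1) (fun _ _ _ => rfl) a
    rw [(W.fam N).wt_one] at this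
    simpa only [one_smul] using this
  have hcomb : ∀ (F : ℤ → ℂ) (c : (Fin m → ℂ) → ℂ), (∀ (χ) (l : ℤ), ρ χ = l → c χ = F l) → ∀ i,
      jet N ((Map0.comb s F P).coord i) = (W.fam N).wt c (jet N (co i)) := by
    intro F c hc i
    rw [Map0.coord_comb, map_sum, ← hs F c hc]
    simp only [map_smul, hP]
  have hzero : ∀ j ∉ s, ∀ a, (W.fam N).wt (lev ρ j) a = 0 := by
    intro j hj a
    have : (W.fam N).wt (lev ρ j) = (W.fam N).wt (fun χ => 0 * 1) := (W.fam N).wt_congr fun χ hχ => by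
      obtain ⟨l, hl, hl'⟩ := hVs χ hχ
      rw [lev_of_ne, zero_mul]
      rw [hl']
      intro e
      rw [Int.cast_inj.1 e] at hl
      exact hj hl
    rw [this, (W.fam N).wt_smul, zero_smul]
  choose r hr using fun j => jet_surjective ((W.fam N).wt (lev ρ j) (jet N g))
  let H : ℤ → O n := fun j => if j ∈ s then r j else 0
  have hH : ∀ j, jet N (H j) = (W.fam N).wt (lev ρ j) (jet N g) := by
    intro j
    simp only [H]
    split_ifs with hj
    · exact hr j
    · rw [map_zero, hzero j hj]
  let γ : ℂ → (Fin m → ℂ) → ℂ := fun ζ χ => Complex.exp (ρ χ * Complex.log ζ)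
  have hγadd : ∀ ζ χ ψ, γ ζ (χ + ψ) = γ ζ χ * γ ζ ψ := fun ζ χ ψ => by
    simp only [γ, hρ, add_mul, Complex.exp_add]
  have hγ0 : ∀ ζ, γ ζ 0 = 1 := fun ζ => by simp only [γ, hρ0, zero_mul, Complex.exp_zero]
  have hγ : ∀ ζ : ℂ, ‖ζ‖ = 1 → ∀ (χ) (l : ℤ), ρ χ = l → γ ζ χ = ζ ^ l := by
    intro ζ hζ χ l hl
    have hζ0 : ζ ≠ 0 := norm_ne_zero_iff.1 (by rw [hζ]; exact one_ne_zero)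
    simp only [γ]
    rw [hl, Complex.exp_int_mul, Complex.exp_log hζ0]
  let Γ : ℂ → Map0 n := fun ζ => Map0.comb s (fun j => ζ ^ j) P
  have hΓ : ∀ ζ : ℂ, ‖ζ‖ = 1 → ∀ a, (W.fam N).wt (γ ζ) a = compJ N (Γ ζ) a := fun ζ hζ =>
    W.wt_eq_compJ (hγadd ζ) (hγ0 ζ) (hcomb _ _ (hγ ζ hζ))
  let Z : Map0 n := Map0.comb s (fun j => (j : ℂ)) P
  have hZ : (W.fam N).wt ρ = der N Z := W.wt_eq_der hρ (hcomb _ _ fun χ l hl => hl)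
  refine ⟨
    { s := s
      p := fun j => P j
      h := fun j => (H j).1
      hp := fun j => (P j).analyticAt
      hp0 := fun j => (P j).map_zero
      hh := fun j => (H j).2
      hs := fun j hj => by simp only [H, if_neg hj]; rfl
      hsum := Eventually.of_forall hPs
      hsmall := ?_, hX := ?_, hZ := ?_, hfZ := ?_, hg := ?_ }, hH⟩
  · intro j i hj
    have h1 : jet M ((P j).coord i) = 0 := by
      rw [← trunc_jet hMN, hP, W.trunc_wt, trunc_jet, (W.fam M).wt_of_mem _ (h i), lev_of_ne, zero_smul]
      rw [hk]
      exact fun e => hj (Int.cast_inj.1 e).symm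
    exact jet_eq_zero.1 h1
  · intro ζ hζ
    refine isBigO_clm_of_apply fun l => isBigO_pi.2 fun i => ?_
    have h1 := (W.fam N).wt_D (γ ζ) l (jet N (co i))
    rw [hΓ ζ hζ, hΓ ζ hζ, compJ_co] at h1
    change der N (W.Z l) _ = compJ N (Γ ζ) (der N (W.Z l) _) at h1
    rw [der_co, der_jet, compJ_jet] at h1
    refine isBigO_of_jet_eq h1.symm ?_
    filter_upwards [derO_coord (W.Z l) (Γ ζ), Map0.fderiv_comb s (fun j => ζ ^ j) P] with x h2 h3
    rw [h2, h3]
    change W.Z l (∑ j ∈ s, ζ ^ j • P j x) i - (∑ j ∈ s, ζ ^ j • fderiv ℂ (P j) x) (W.Z l x) i =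
      (W.fld (∑ j ∈ s, ζ ^ j • P j x) (Pi.single l 1) -
        (∑ j ∈ s, ζ ^ j • fderiv ℂ (P j) x) (W.fld x (Pi.single l 1))) i
    rw [W.fld_single, W.fld_single]
    rfl
  · intro ζ hζ
    refine isBigO_pi.2 fun i => ?_
    have h1 : der N Z (jet N ((Γ ζ).coord i)) =
        jet N ((Map0.comb s (fun j => (j : ℂ) * ζ ^ j) P).coord i) := by
      rw [← hZ, hcomb _ _ (hγ ζ hζ), (W.fam N).wt_wt,
        hcomb _ (ρ * γ ζ) fun χ l hl => by rw [Pi.mul_apply, hγ ζ hζ χ l hl, hl]]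
    rw [der_jet] at h1
    refine isBigO_of_jet_eq h1 ?_
    filter_upwards [derO_coord Z (Γ ζ), Map0.fderiv_comb s (fun j => ζ ^ j) P] with x h2 h3
    rw [h2, h3]
    rfl
  · refine isBigO_pi.2 fun j => ?_
    let f : O n := ⟨fun x => I.f x j, analyticAt_pi_iff.1 I.hf j⟩
    have h1 := (W.fam N).wt_of_mem ρ (I.jet_mem_V (N := N) (f := f) j fun _ => rfl)
    rw [hρ0, zero_smul, hZ, der_jet, jet_eq_zero] at h1
    refine h1.congr' ?_ EventuallyEq.rfl
    filter_upwards [I.hf.eventually_analyticAt] with x hx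
    have h2 := hasFDerivAt_pi'.1 hx.differentiableAt.hasFDerivAt j
    exact congrArg (fun L => L (Z x)) h2.fderiv
  · intro ζ hζ
    have h1 : compJ N (Γ ζ) (jet N g) = jet N (∑ j ∈ s, ζ ^ j • H j) := by
      rw [← hΓ ζ hζ, map_sum, ← hs _ _ (hγ ζ hζ)]
      simp only [map_smul, hH]
    rw [compJ_jet] at h1
    refine isBigO_of_jet_eq h1 (Eventually.of_forall fun x => ?_)
    have h2 : (∑ j ∈ s, ζ ^ j • H j : O n).1 x = ∑ j ∈ s, ζ ^ j * (H j).1 x := by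
      change (O n).val (∑ j ∈ s, ζ ^ j • H j) x = _
      rw [map_sum, Finset.sum_apply]
      rfl
    rw [h2]
    rfl

/-- The projection with coefficients `c` of any analytic function converges. -/
def Convergent (W : CommVF m n) (c : (Fin m → ℂ) → ℂ) : Prop :=
  ∀ g : O n, ∃ p : O n, ∀ N, jet N p = (W.fam N).wt c (jet N g)

theorem Convergent.one (W : CommVF m n) : Convergent W 1 := fun g =>
  ⟨g, fun N => ((W.fam N).wt_one _).symm⟩

theorem Convergent.mul {W : CommVF m n} {c c' : (Fin m → ℂ) → ℂ} (h : Convergent W c)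
    (h' : Convergent W c') : Convergent W (c * c') := fun g => by
  obtain ⟨p, hp⟩ := h' g
  obtain ⟨r, hr⟩ := h p
  exact ⟨r, fun N => by rw [hr, hp, (W.fam N).wt_wt]⟩

theorem Convergent.prod {W : CommVF m n} {κ : Type*} (s : Finset κ) {c : κ → (Fin m → ℂ) → ℂ}
    (h : ∀ j ∈ s, Convergent W (c j)) : Convergent W (∏ j ∈ s, c j) :=
  Finset.prod_induction _ (Convergent W) (fun _ _ => Convergent.mul) (Convergent.one W) h

theorem Prep.convergent_lev {W : CommVF m n} {μ : Fin n → Fin m → ℂ} (h : Prep W μ (6 * d + 2))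
    (I : IntData W q d) {ρ : (Fin m → ℂ) → ℂ} (hρ : ∀ χ ψ, ρ (χ + ψ) = ρ χ + ρ ψ)
    {k : Fin n → ℤ} (hk : ∀ i, ρ (μ i) = k i) (k₀ : ℤ) : Convergent W (lev ρ k₀) := by
  intro g
  choose A hA using fun N => h.exists_approx (by omega) I hρ hk (le_max_right N (6 * d + 2)) g
  have hA' : ∀ N, jet N ⟨(A N).h k₀, (A N).hh k₀⟩ = (W.fam N).wt (lev ρ k₀) (jet N g) := fun N => by
    rw [← trunc_jet (le_max_left N (6 * d + 2)), hA, W.trunc_wt, trunc_jet]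
  obtain ⟨p, hp, hpA⟩ := SymData.exists_analyticAt_harmonic (h.symData I hρ hk) d le_rfl I.hd
    (analyticAt_val g) (fun N => (A N).mono (le_max_left _ _)) k₀ (fun N N' hN => by
      refine isBigO_of_jet_eq (f := ⟨(A N').h k₀, (A N').hh k₀⟩) (g := ⟨(A N).h k₀, (A N).hh k₀⟩) ?_
        (Eventually.of_forall fun x => rfl)
      rw [hA', ← trunc_jet hN, hA', W.trunc_wt, trunc_jet])
  refine ⟨⟨p, hp⟩, fun N => ?_⟩
  rw [← hA']
  exact jet_eq_jet.2 (hpA N)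

end Approximants

section Separation

variable {m n q d N N' M : ℕ}

theorem exists_integral_characters (μ : Fin n → Fin m → ℂ) :
    ∃ (r : ℕ) (ρ : Fin r → (Fin m → ℂ) → ℂ) (k : Fin r → Fin n → ℤ),
      (∀ j χ ψ, ρ j (χ + ψ) = ρ j χ + ρ j ψ) ∧ (∀ j i, ρ j (μ i) = k j i) ∧
      ∀ χ ∈ AddSubmonoid.closure (Set.range μ), ∀ ψ ∈ AddSubmonoid.closure (Set.range μ),
        (∀ j, ρ j χ = ρ j ψ) → χ = ψ := by
  let E : Submodule ℚ (Fin m → ℂ) := Submodule.span ℚ (Set.range μ)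
  have hE : AddSubmonoid.closure (Set.range μ) ≤ E.toAddSubmonoid :=
    AddSubmonoid.closure_le.2 Submodule.subset_span
  have : FiniteDimensional ℚ E := FiniteDimensional.span_of_finite ℚ (Set.finite_range μ)
  let β := Module.finBasis ℚ E
  choose g hg using fun j => LinearMap.exists_extend (β.coord j)
  choose D hD using fun j => IsLocalization.exist_integer_multiples_of_finite
    (nonZeroDivisors ℤ) (fun i => g j (μ i))
  choose k hk using hD
  refine ⟨_, fun j χ => (((D j : ℤ) • g j χ : ℚ) : ℂ), k, fun j χ ψ => ?_, fun j i => ?_,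
    fun χ hχ ψ hψ h => ?_⟩
  · beta_reduce
    rw [map_add, smul_add, Rat.cast_add]
  · have := hk j i
    simp only at this ⊢
    rw [← this]
    simp
  · have h1 : (⟨χ, hE hχ⟩ : E) = ⟨ψ, hE hψ⟩ := by
      refine β.ext_elem fun j => ?_
      have h2 : g j χ = g j ψ :=
        smul_right_injective ℚ (nonZeroDivisors.coe_ne_zero (D j)) (Rat.cast_injective (h j))
      have h3 := congrArg (fun L => L ⟨χ, hE hχ⟩) (hg j)
      have h4 := congrArg (fun L => L ⟨ψ, hE hψ⟩) (hg j)
      change g j χ = β.repr ⟨χ, hE hχ⟩ j at h3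
      change g j ψ = β.repr ⟨ψ, hE hψ⟩ j at h4
      rw [← h3, ← h4, h2]
    exact congrArg Subtype.val h1

open Classical in
theorem Prep.exists_convergent {W : CommVF m n} {μ : Fin n → Fin m → ℂ} (h : Prep W μ (6 * d + 2))
    (I : IntData W q d) (i : Fin n) (g : O n) : ∃ p : O n,
      ∀ N, jet N p = (W.fam N).wt (fun χ => if χ = μ i then 1 else 0) (jet N g) := by
  obtain ⟨r, ρ, k, hρ, hk, hsep⟩ := exists_integral_characters μ
  obtain ⟨p, hp⟩ := Convergent.prod Finset.univ
    (fun j _ => h.convergent_lev I (hρ j) (hk j) (k j i)) g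
  refine ⟨p, fun N => ?_⟩
  rw [hp]
  refine congrArg (fun L => L (jet N g)) ((W.fam N).wt_congr fun χ hχ => ?_)
  rw [Finset.prod_apply]
  split_ifs with hi
  · exact Finset.prod_eq_one fun j _ => lev_of_eq (by rw [hi, hk])
  · by_contra h0
    refine hi (hsep χ (h.weight_mem (by omega) hχ) _ (AddSubmonoid.subset_closure ⟨i, rfl⟩) fun j => ?_)
    by_contra hj
    refine h0 (Finset.prod_eq_zero (Finset.mem_univ j) (lev_of_ne ?_))
    rwa [← hk]

theorem Prep.exists_weight_coords {W : CommVF m n} {μ : Fin n → Fin m → ℂ}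
    (h : Prep W μ (6 * d + 2)) (I : IntData W q d) : ∃ y : Map0 n,
      Function.Bijective (fderiv ℂ y 0) ∧ ∀ N i, jet N (y.coord i) ∈ (W.fam N).V (μ i) := by
  classical
  choose y hy using fun i => h.exists_convergent I i (co i)
  let Y : Map0 n := Map0.ofCoord y fun i => by
    rw [← ev_jet (N := 0), hy, W.ev_wt, ev_jet]
    exact mul_zero _
  refine ⟨Y, ?_, fun N i => ?_⟩
  · have hY : fderiv ℂ Y 0 = fderiv ℂ (Map0.id n) 0 := by
      refine Map0.fderiv_eq_of_jet_eq (M := 6 * d + 2) (by omega) fun i => ?_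
      change jet _ (y i) = jet _ (co i)
      rw [hy, (W.fam _).wt_of_mem _ (h i), if_pos rfl, one_smul]
    have : fderiv ℂ (Map0.id n) 0 = ContinuousLinearMap.id ℂ _ := fderiv_id
    rw [hY, this]
    exact Function.bijective_id
  · change jet N (y i) ∈ _
    rw [hy]
    exact (W.fam N).wt_mem_V (fun ψ hψ => if_neg hψ) _

theorem InvPair.bijective {φ y : Map0 n} (h : InvPair φ y) : Function.Bijective (fderiv ℂ φ 0) := by
  have h1 := h.fderiv_comp.self_of_nhds
  have h2 := h.symm.fderiv_comp.self_of_nhds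
  rw [y.map_zero] at h1
  rw [φ.map_zero] at h2
  exact Function.bijective_iff_has_inverse.2 ⟨_, h2, h1⟩

theorem exists_normal_form {W : CommVF m n} (I : IntData W q d) :
    ∃ (φ : Map0 n) (W' : CommVF m n), Function.Bijective (fderiv ℂ φ 0) ∧ Rel φ W W' ∧
      ∀ l, ∃ t ∈ 𝓝 0, ∀ U ⊆ t, InPDNormalForm ℂ (W'.Z l) U := by
  obtain ⟨φ₁, y₁, W₁, μ, hy₁, hrel₁, hprep⟩ := exists_prep W (M := 6 * d + 2) (by omega)
  obtain ⟨I₁⟩ := I.transport hrel₁ hy₁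
  obtain ⟨y, hy, hyV⟩ := hprep.exists_weight_coords I₁
  obtain ⟨φ₂, W₂, hφ₂, hrel₂, hnf⟩ := exists_normalization W₁ hy hyV
  let φ : Map0 n := ⟨fun x => φ₁ (φ₂ x), AnalyticAt.comp (g := φ₁)
    (by rw [φ₂.map_zero]; exact φ₁.analyticAt) φ₂.analyticAt, by rw [φ₂.map_zero, φ₁.map_zero]⟩
  have hφ : ∀ᶠ x in 𝓝 0, ∀ u, fderiv ℂ φ x u = fderiv ℂ φ₁ (φ₂ x) (fderiv ℂ φ₂ x u) := by
    filter_upwards [φ₂.tendsto.eventually φ₁.analyticAt.eventually_analyticAt,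
      φ₂.analyticAt.eventually_analyticAt] with x h1 h2 u
    exact congrArg (fun L => L u) (HasFDerivAt.comp (g := φ₁) (f := φ₂) x
      h1.differentiableAt.hasFDerivAt h2.differentiableAt.hasFDerivAt).fderiv
  refine ⟨φ, W₂, ?_, fun l => ?_, hnf⟩
  · have h0 := hφ.self_of_nhds
    rw [φ₂.map_zero] at h0
    have : ⇑(fderiv ℂ φ 0) = fderiv ℂ φ₁ 0 ∘ fderiv ℂ φ₂ 0 := funext h0
    rw [this]
    exact hy₁.bijective.comp hφ₂
  · filter_upwards [hφ, hrel₂ l, φ₂.tendsto.eventually (hrel₁ l)] with x h1 h2 h3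
    rw [h1, h2, h3]

end Separation

end ZungPD

/-- **Simultaneous Poincaré–Dulac normalization for commuting integrable vector
fields** (Zung). An `m`-tuple of pairwise commuting, almost-everywhere linearly
independent holomorphic vector fields on `(ℂⁿ, 0)` vanishing at `0`, with
`n - m` almost-everywhere functionally independent common holomorphic first
integrals, admits a simultaneous convergent Poincaré–Dulac normalization. -/
theorem integrable_simultaneous_PDNormalization
    (n m : ℕ) (hn : 1 ≤ n) (hm : 1 ≤ m) (hmn : m ≤ n)
    (U : Set (Fin n → ℂ)) (hUopen : IsOpen U) (hUconn : IsConnected U)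
    (h0U : (0 : Fin n → ℂ) ∈ U)
    (X : Fin m → (Fin n → ℂ) → (Fin n → ℂ))
    (f : Fin (n - m) → (Fin n → ℂ) → ℂ)
    (hXan : ∀ i, AnalyticOnNhd ℂ (X i) U)
    (hfan : ∀ j, AnalyticOnNhd ℂ (f j) U)
    (hX0 : ∀ i, X i 0 = 0)
    (hcomm : ∀ i j, ∀ x ∈ U, VectorField.lieBracket ℂ (X i) (X j) x = 0)
    (hfirst : ∀ i j, ∀ x ∈ U, fderiv ℂ (f j) x (X i x) = 0)
    (hXind : ∃ x ∈ U, LinearIndependent ℂ (fun i => X i x))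
    (hfind : ∃ x ∈ U, LinearIndependent ℂ (fun j => fderiv ℂ (f j) x)) :
    ∃ (V : Set (Fin n → ℂ)) (φ : (Fin n → ℂ) → (Fin n → ℂ))
      (Y : Fin m → (Fin n → ℂ) → (Fin n → ℂ)),
      IsOpen V ∧ (0 : Fin n → ℂ) ∈ V ∧
      AnalyticOnNhd ℂ φ V ∧ φ 0 = 0 ∧ Function.Bijective (fderiv ℂ φ 0) ∧
      (∀ i, AnalyticOnNhd ℂ (Y i) V) ∧ (∀ i, Y i 0 = 0) ∧
      (∀ i, InPDNormalForm ℂ (Y i) V) ∧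
      ∀ i, ∀ x ∈ V, fderiv ℂ φ x (Y i x) = X i (φ x) := by
  let W : ZungPD.CommVF m n :=
    { Z := fun l => ⟨X l, hXan l 0 h0U, hX0 l⟩
      comm := fun k l => by
        filter_upwards [hUopen.mem_nhds h0U] with x hx
        exact (sub_eq_zero.1 (hcomm k l x hx)).symm }
  obtain ⟨d, ⟨I⟩⟩ := ZungPD.exists_intData hmn hUopen hUconn h0U hXan hfan hfirst hXind hfind W
    fun _ _ => rfl
  obtain ⟨φ, W', hφ, hrel, hnf⟩ := ZungPD.exists_normal_form I
  choose t ht hnf using hnf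
  have h1 : ∀ᶠ x in 𝓝 (0 : Fin n → ℂ), AnalyticAt ℂ φ x ∧ ∀ l, AnalyticAt ℂ (W'.Z l) x ∧
      x ∈ t l ∧ fderiv ℂ φ x (W'.Z l x) = X l (φ x) :=
    φ.analyticAt.eventually_analyticAt.and <| eventually_all.2 fun l =>
      (W'.Z l).analyticAt.eventually_analyticAt.and ((show ∀ᶠ x in 𝓝 0, x ∈ t l from ht l).and (hrel l))
  obtain ⟨V, hV, hVo, h0V⟩ := eventually_nhds_iff.1 h1
  exact ⟨V, φ, fun l => W'.Z l, hVo, h0V, fun x hx => (hV x hx).1, φ.map_zero, hφ,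
    fun l x hx => ((hV x hx).2 l).1, fun l => (W'.Z l).map_zero,
    fun l => hnf l V fun x hx => ((hV x hx).2 l).2.1, fun l x hx => ((hV x hx).2 l).2.2⟩
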